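/- arXiv:2512.16585 — 2 statements merged into one kernel-verified Lean document; each statement's English description precedes it below -/
import Mathlib

section
/- Let G be a finitely generated nilpotent group and let T be its torsion subgroup (the set of elements of finite order, which is a finite normal subgroup of G). Then there exist a finite group Q and an injective group homomorphism i : G → (G/T) × Q whose image has finite index in (G/T) × Q. -/
open Subgroup in
/-- If the center of a finitely generated group is torsion, then so is the center of the quotient
by the center. -/
theorem isOfFinOrder_of_mem_center_quotient_center {G : Type*} [Group G] [Group.FG G]
    (h : ∀ z ∈ center G, IsOfFinOrder z) (x : G ⧸ center G) (hx : x ∈ center (G ⧸ center G)) :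
    IsOfFinOrder x := by
  induction x using QuotientGroup.induction_on with | _ x
  have key (y : G) : ∃ m : ℕ, 0 < m ∧ Commute y (x ^ m) := by
    obtain ⟨c, hc⟩ : ∃ c, c = y * x * y⁻¹ * x⁻¹ := ⟨_, rfl⟩
    have hcZ : c ∈ center G := by
      rw [← QuotientGroup.eq_one_iff, hc]
      have := mem_center_iff.mp hx (y : G ⧸ center G)
      simp only [QuotientGroup.mk_mul, QuotientGroup.mk_inv]
      rw [this]
      group
    have hyx : y * x * y⁻¹ = c * x := by rw [hc]; group
    obtain ⟨m, hm, hcm⟩ := (h c hcZ).exists_pow_eq_one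
    refine ⟨m, hm, ?_⟩
    have hcx : Commute c x := (mem_center_iff.mp hcZ x).symm
    rw [commute_iff_eq, ← mul_inv_eq_iff_eq_mul, ← conj_pow, hyx, hcx.mul_pow, hcm, one_mul]
  choose m hm hcomm using key
  obtain ⟨S, hS⟩ := Group.fg_def.mp ‹Group.FG G›
  have hle : closure (S : Set G) ≤ centralizer {x ^ ∏ s ∈ S, m s} := by
    refine (closure_le _).mpr fun s hs ↦ mem_centralizer_singleton_iff.mpr ?_
    obtain ⟨k, hk⟩ := Finset.dvd_prod_of_mem m hs
    rw [hk, pow_mul]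
    exact ((hcomm s).pow_right k).eq
  refine isOfFinOrder_iff_pow_eq_one.mpr ⟨∏ s ∈ S, m s, Finset.prod_pos fun s _ ↦ hm s, ?_⟩
  rw [← QuotientGroup.mk_pow, QuotientGroup.eq_one_iff, mem_center_iff]
  intro g
  exact mem_centralizer_singleton_iff.mp (hle (hS ▸ mem_top g))

open scoped IsMulCommutative in
/-- A finitely generated nilpotent group with torsion center is finite. -/
theorem Group.IsNilpotent.finite_of_isOfFinOrder_center {G : Type*} [Group G] [Group.IsNilpotent G]
    [Group.FG G] (h : ∀ z ∈ Subgroup.center G, IsOfFinOrder z) : Finite G := by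
  suffices H : Group.FG G → (∀ z ∈ Subgroup.center G, IsOfFinOrder z) → Finite G from H ‹_› h
  refine Group.nilpotent_center_quotient_ind
    (P := fun G _ _ ↦ Group.FG G → (∀ z ∈ Subgroup.center G, IsOfFinOrder z) → Finite G) G
    (fun G _ _ _ _ ↦ inferInstance) fun G _ _ ih _ hZ ↦ ?_
  have : Finite (G ⧸ Subgroup.center G) :=
    ih inferInstance (isOfFinOrder_of_mem_center_quotient_center hZ)
  have := Subgroup.finiteIndex_of_finite_quotient (H := Subgroup.center G)
  have : Finite (Subgroup.center G) := CommGroup.finite_of_fg_isMulTorsion _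
    fun z ↦ Submonoid.isOfFinOrder_coe.mp (hZ z z.2)
  exact Finite.of_subgroup_quotient (Subgroup.center G)

/-- Among the normal subgroups meeting a given subgroup trivially there is a maximal one. -/
theorem Subgroup.exists_maximal_normal_disjoint {G : Type*} [Group G] (T : Subgroup G) :
    ∃ N : Subgroup G, Maximal (fun N ↦ N.Normal ∧ Disjoint N T) N := by
  suffices h : ∀ c ⊆ {N : Subgroup G | N.Normal ∧ Disjoint N T}, IsChain (· ≤ ·) c → ∀ y ∈ c,
      ∃ ub ∈ {N : Subgroup G | N.Normal ∧ Disjoint N T}, ∀ z ∈ c, z ≤ ub from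
    (zorn_le_nonempty₀ _ h ⊥ ⟨inferInstance, disjoint_bot_left⟩).imp fun _ ↦ And.right
  intro c hc hchain y hy
  have hmem {x : G} : x ∈ sSup c ↔ ∃ s ∈ c, x ∈ s :=
    Subgroup.mem_sSup_of_directedOn ⟨y, hy⟩ hchain.directedOn
  refine ⟨sSup c, ⟨⟨fun n hn g ↦ ?_⟩, ?_⟩, fun z hz ↦ le_sSup hz⟩
  · obtain ⟨s, hs, hns⟩ := hmem.mp hn
    exact hmem.mpr ⟨s, hs, (hc hs).1.conj_mem n hns g⟩
  · rw [Subgroup.disjoint_def]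
    intro x hx hxT
    obtain ⟨s, hs, hxs⟩ := hmem.mp hx
    exact Subgroup.disjoint_def.mp (hc hs).2 hxs hxT

/-- In a finitely generated nilpotent group, every finite subgroup is disjoint from some normal
subgroup of finite index. -/
theorem Group.IsNilpotent.exists_normal_finite_quotient_disjoint {G : Type*} [Group G]
    [Group.IsNilpotent G] [Group.FG G] (T : Subgroup G) [Finite T] :
    ∃ N : Subgroup G, N.Normal ∧ Finite (G ⧸ N) ∧ Disjoint N T := by
  obtain ⟨N, ⟨hN, hNT⟩, hmax⟩ := T.exists_maximal_normal_disjoint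
  refine ⟨N, hN, finite_of_isOfFinOrder_center fun z hz ↦ ?_, hNT⟩
  by_contra hfin
  have hzn : (Subgroup.zpowers z).Normal :=
    ⟨fun n hn g ↦ by
      rwa [Subgroup.mem_center_iff.mp (Subgroup.zpowers_le.mpr hz hn) g, mul_inv_cancel_right]⟩
  let M := (Subgroup.zpowers z).comap (QuotientGroup.mk' N)
  have hNM : N ≤ M := by
    intro n hn
    rw [Subgroup.mem_comap, QuotientGroup.mk'_apply, (QuotientGroup.eq_one_iff n).mpr hn]
    exact one_mem _
  have hMT : Disjoint M T := by
    rw [Subgroup.disjoint_def]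
    intro x hxM hxT
    obtain ⟨k, hk⟩ := Subgroup.mem_zpowers_iff.mp hxM
    have hx : IsOfFinOrder (z ^ k) :=
      hk ▸ (QuotientGroup.mk' N).isOfFinOrder
        (Submonoid.isOfFinOrder_coe.mpr (isOfFinOrder_of_finite (⟨x, hxT⟩ : T)))
    obtain rfl | hk0 := eq_or_ne k 0
    · refine Subgroup.disjoint_def.mp hNT ?_ hxT
      rw [← QuotientGroup.eq_one_iff]
      simpa using hk.symm
    · obtain ⟨n, hn, hzn⟩ := isOfFinOrder_iff_zpow_eq_one.mp hx
      rw [← zpow_mul] at hzn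
      exact absurd (isOfFinOrder_iff_zpow_eq_one.mpr ⟨_, mul_ne_zero hk0 hn, hzn⟩) hfin
  have hMN : M ≤ N := hmax ⟨inferInstance, hMT⟩ hNM
  obtain ⟨g, rfl⟩ := QuotientGroup.mk'_surjective N z
  refine hfin ?_
  rw [QuotientGroup.mk'_apply,
    (QuotientGroup.eq_one_iff g).mpr (hMN (Subgroup.mem_zpowers _))]
  exact IsOfFinOrder.one

/-- A finitely generated nilpotent group `G` with torsion subgroup `T`
embeds with finite index into `(G ⧸ T) × Q` for some finite group `Q`. -/
theorem nilpotent_embeds_finite_index_in_quotient_times_finite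
    {G : Type*} [Group G] [Group.IsNilpotent G] [Group.FG G]
    (T : Subgroup G) [T.Normal]
    (hT : ∀ g : G, g ∈ T ↔ IsOfFinOrder g) (hTfin : Finite T) :
    ∃ (Q : Type) (_ : Group Q) (_ : Finite Q) (i : G →* (G ⧸ T) × Q),
      Function.Injective i ∧ i.range.index ≠ 0 := by
  obtain ⟨N, hN, hfin, hNT⟩ := Group.IsNilpotent.exists_normal_finite_quotient_disjoint T
  let e : Shrink.{0} (G ⧸ N) ≃* G ⧸ N := Shrink.mulEquiv
  let f : G →* Shrink.{0} (G ⧸ N) := e.symm.toMonoidHom.comp (QuotientGroup.mk' N)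
  have hf (g : G) : f g = 1 ↔ g ∈ N := by simp [f]
  refine ⟨Shrink.{0} (G ⧸ N), inferInstance, .of_equiv _ e.toEquiv.symm,
    (QuotientGroup.mk' T).prod f, ?_, ?_⟩
  · rw [injective_iff_map_eq_one]
    intro g hg
    rw [MonoidHom.prod_apply, Prod.mk_eq_one, hf, QuotientGroup.mk'_apply,
      QuotientGroup.eq_one_iff] at hg
    exact Subgroup.disjoint_def.mp hNT hg.2 hg.1
  · have : Finite (Shrink.{0} (G ⧸ N)) := .of_equiv _ e.toEquiv.symm
    have := Subgroup.finiteIndex_of_finite_quotient (H := N)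
    have hle : (N.map (QuotientGroup.mk' T)).prod ⊥ ≤ ((QuotientGroup.mk' T).prod f).range := by
      rintro ⟨_, _⟩ ⟨⟨n, hn, rfl⟩, rfl⟩
      exact ⟨n, Prod.ext rfl ((hf n).mpr hn)⟩
    refine ne_zero_of_dvd_ne_zero ?_ (Subgroup.index_dvd_of_le hle)
    rw [Subgroup.index_prod, Subgroup.index_bot]
    refine mul_ne_zero (ne_zero_of_dvd_ne_zero Subgroup.FiniteIndex.index_ne_zero
      (N.index_map_dvd (QuotientGroup.mk'_surjective T))) Nat.card_pos.ne'
end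

section
/- Let G ≤ (𝔲⁰(n,ℚ), ∗) be an LR-group with underlying Lie ring L. Then for any finite generating set S of G and any Guivarc'h length l on L, RF_{G,S} ≈ RF_{L,l}. -/
noncomputable section

/-- Word norm of `g` with respect to generating set `S`: the least `k` such that `g` is a
product of `k` elements of `S ∪ S⁻¹`. -/
def wordNorm {G : Type*} [Group G] (S : Set G) (g : G) : ℕ :=
  sInf {k | ∃ l : List G, l.length = k ∧ (∀ x ∈ l, x ∈ S ∨ x⁻¹ ∈ S) ∧ l.prod = g}

/-- Divisibility function relative to a family `P` of subgroups:
`min {[G:N] : N ∈ P, g ∉ N, [G:N] < ∞}`. -/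
def groupDivP {G : Type*} [Group G] (P : Set (Subgroup G)) (g : G) : ℕ :=
  sInf {k | ∃ N ∈ P, g ∉ N ∧ N.index = k ∧ k ≠ 0}

/-- Residual finiteness growth relative to a family of subgroups `P`:
`max {D_{G,P}(g) : 0 < ‖g‖_{G,S} ≤ r}`. -/
def groupRFP (G : Type*) [Group G] (P : Set (Subgroup G)) (S : Set G) (r : ℝ) : ℕ :=
  sSup {d | ∃ g : G, 0 < wordNorm S g ∧ (wordNorm S g : ℝ) ≤ r ∧ groupDivP P g = d}

/-- Residual finiteness growth of a group, via all finite-index normal subgroups. -/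
def groupRF (G : Type*) [Group G] (S : Set G) (r : ℝ) : ℕ :=
  groupRFP G {N | N.Normal} S r

/-- `f ⪯ g` : there is `C > 0` with `f r ≤ C * g (C * r)` for all `r ≥ max 1 (1/C)`. -/
def FDom (f g : ℝ → ℝ) : Prop :=
  ∃ C : ℝ, 0 < C ∧ ∀ r : ℝ, max 1 (1 / C) ≤ r → f r ≤ C * g (C * r)

/-- `f ≈ g`. -/
def FEquiv (f g : ℝ → ℝ) : Prop :=
  FDom f g ∧ FDom g f

end

open scoped TensorProduct

noncomputable section

/-- The index of a Lie ideal of a Lie ring `L` as an additive subgroup. -/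
def idealIndex {L : Type*} [LieRing L] (I : LieIdeal ℤ L) : ℕ :=
  AddSubgroup.index (LieSubmodule.toSubmodule I).toAddSubgroup

/-- Divisibility function of a Lie ring relative to a family `P` of ideals:
`min {[L:I] : I ∈ P, v ∉ I, [L:I] < ∞}`. -/
def lieDivP {L : Type*} [LieRing L] (P : Set (LieIdeal ℤ L)) (v : L) : ℕ :=
  sInf {k | ∃ I ∈ P, v ∉ I ∧ idealIndex I = k ∧ k ≠ 0}

/-- Residual finiteness growth of a Lie ring w.r.t. a length function `ℓ` and
a family `P` of ideals. -/
def lieRFP (L : Type*) [LieRing L] (P : Set (LieIdeal ℤ L)) (ℓ : L → ℝ) (r : ℝ) : ℕ :=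
  sSup {d | ∃ v : L, 0 < ℓ v ∧ ℓ v ≤ r ∧ lieDivP P v = d}

/-- Residual finiteness growth of a Lie ring w.r.t. a length function `ℓ`, using all
finite-index ideals. -/
def lieRF (L : Type*) [LieRing L] (ℓ : L → ℝ) (r : ℝ) : ℕ :=
  lieRFP L Set.univ ℓ r

/-- A vector space norm on a real vector space. -/
def IsVectorNorm {V : Type*} [AddCommGroup V] [Module ℝ V] (N : V → ℝ) : Prop :=
  (∀ x, 0 ≤ N x) ∧ (∀ x, N x = 0 ↔ x = 0) ∧ (∀ (r : ℝ) (x), N (r • x) = |r| * N x) ∧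
    ∀ x y, N (x + y) ≤ N x + N y

/-- A norm on a Lie ring `L`: the restriction of a vector space norm on `ℝ ⊗ L` along
the canonical map `v ↦ 1 ⊗ v`. -/
def IsLieRingNorm {L : Type*} [LieRing L] (ν : L → ℝ) : Prop :=
  ∃ N : (ℝ ⊗[ℤ] L) → ℝ, IsVectorNorm N ∧ ∀ v : L, ν v = N ((1 : ℝ) ⊗ₜ[ℤ] v)

/-- A Guivarc'h length on a Lie ring `L`, where `L ⊗ ℝ` is nilpotent of class (at most) `c`:
there are subspaces `𝔞ᵢ` with `γᵢ(L ⊗ ℝ) = 𝔞ᵢ ⊕ ⋯ ⊕ 𝔞_c`, norms `nᵢ` on the `𝔞ᵢ`, and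
(necessarily unique) component projections `comp i`, such that
`ℓ v = max_i nᵢ(vᵢ)^(1/i)` where `v = v₁ + ⋯ + v_c` in `L ⊗ ℝ`.
(Mathlib's `lowerCentralSeries _ _ _ (i : ℕ)` is `γ_{i+1}` of the paper, and the component
`i : Fin c` corresponds to the paper's index `i + 1`.) -/
def IsGuivarchLength {L : Type*} [LieRing L] (c : ℕ) (ℓ : L → ℝ) : Prop :=
  ∃ (a : Fin c → Submodule ℝ (ℝ ⊗[ℤ] L)) (n : Fin c → (ℝ ⊗[ℤ] L) → ℝ)
    (comp : Fin c → (ℝ ⊗[ℤ] L) → (ℝ ⊗[ℤ] L)),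
    LieModule.lowerCentralSeries ℝ (ℝ ⊗[ℤ] L) (ℝ ⊗[ℤ] L) c = ⊥ ∧
    (∀ i : Fin c,
      LieSubmodule.toSubmodule (LieModule.lowerCentralSeries ℝ (ℝ ⊗[ℤ] L) (ℝ ⊗[ℤ] L) (i : ℕ)) =
        ⨆ (j : Fin c) (_ : i ≤ j), a j) ∧
    iSupIndep a ∧
    (∀ i, ∀ x ∈ a i, 0 ≤ n i x) ∧
    (∀ i, ∀ x ∈ a i, (n i x = 0 ↔ x = 0)) ∧
    (∀ i (r : ℝ), ∀ x ∈ a i, n i (r • x) = |r| * n i x) ∧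
    (∀ i, ∀ x ∈ a i, ∀ y ∈ a i, n i (x + y) ≤ n i x + n i y) ∧
    (∀ i v, comp i v ∈ a i) ∧
    (∀ v, ∑ i, comp i v = v) ∧
    (∀ v : L, ℓ v = ⨆ i : Fin c, n i (comp i ((1 : ℝ) ⊗ₜ[ℤ] v)) ^ (((i : ℕ) : ℝ) + 1)⁻¹)

end
noncomputable section BCH

variable {n : ℕ}

/-- Strictly upper triangular matrix. -/
def IsStrictUpper (A : Matrix (Fin n) (Fin n) ℚ) : Prop :=
  ∀ i j : Fin n, j ≤ i → A i j = 0

/-- Exponential of a (nilpotent) matrix, by its finite power series. -/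
def expM (A : Matrix (Fin n) (Fin n) ℚ) : Matrix (Fin n) (Fin n) ℚ :=
  ∑ k ∈ Finset.range n, ((k.factorial : ℚ)⁻¹) • A ^ k

/-- Logarithm of a (unipotent) matrix, by its finite power series. -/
def logM (B : Matrix (Fin n) (Fin n) ℚ) : Matrix (Fin n) (Fin n) ℚ :=
  ∑ k ∈ Finset.Icc 1 (n - 1), (((-1 : ℚ) ^ (k + 1)) / (k : ℚ)) • (B - 1) ^ k

/-- The Baker–Campbell–Hausdorff product `A ∗ B = log (exp A * exp B)`. -/
def bch (A B : Matrix (Fin n) (Fin n) ℚ) : Matrix (Fin n) (Fin n) ℚ :=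
  logM (expM A * expM B)

end BCH

/-- `IsLRGroup n G ρ` says that the type `G`, carrying simultaneously a group structure
(`*`, the BCH product) and a Lie ring structure (`+`, `⁅·,·⁆`), is realized via the
injective map `ρ` as a subset of the strictly upper triangular matrices `𝔲⁰(n,ℚ)` which is
simultaneously a subgroup of `(𝔲⁰(n,ℚ), ∗)` and a Lie subring; i.e. `G` is an LR-group with
underlying Lie ring `L = G`. -/
structure IsLRGroup (n : ℕ) (G : Type*) [Group G] [LieRing G]
    (ρ : G → Matrix (Fin n) (Fin n) ℚ) : Prop where
  inj : Function.Injective ρ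
  upper : ∀ g : G, IsStrictUpper (ρ g)
  map_one : ρ 1 = 0
  map_mul : ∀ g h : G, ρ (g * h) = bch (ρ g) (ρ h)
  map_inv : ∀ g : G, ρ g⁻¹ = -ρ g
  map_zero : ρ 0 = 0
  map_add : ∀ g h : G, ρ (g + h) = ρ g + ρ h
  map_lie : ∀ g h : G, ρ ⁅g, h⁆ = ρ g * ρ h - ρ h * ρ g
  fg : Group.FG G

section TruncatedExpLog

open Polynomial

/-- The logarithm series truncated at order `N`. -/
noncomputable def truncLog {A : Type*} [Ring A] [Algebra ℚ A] (N : ℕ) (u : A) : A :=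
  ∑ k ∈ Finset.Icc 1 (N - 1), (((-1 : ℚ) ^ (k + 1)) / (k : ℚ)) • (u - 1) ^ k

/-- The polynomial `∑ (-1)^(k+1) X^k / k` over `1 ≤ k ≤ M`. -/
noncomputable def logPoly (M : ℕ) : ℚ[X] :=
  ∑ k ∈ Finset.range M, C ((-1 : ℚ) ^ k / ((k : ℚ) + 1)) * X ^ (k + 1)

/-- The polynomial `∑ X^k / k!` over `k < M`. -/
noncomputable def expPoly (M : ℕ) : ℚ[X] :=
  ∑ k ∈ Finset.range M, C ((k.factorial : ℚ)⁻¹) * X ^ k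

theorem X_dvd_logPoly (M : ℕ) : (X : ℚ[X]) ∣ logPoly M :=
  Finset.dvd_sum fun k _ => (dvd_pow_self X k.succ_ne_zero).mul_left _

theorem derivative_logPoly (M : ℕ) :
    (1 + X) * derivative (logPoly M) = 1 - (-X) ^ M := by
  induction M with
  | zero => simp [logPoly]
  | succ M ih =>
    rw [logPoly, Finset.sum_range_succ, ← logPoly, derivative_add, mul_add, ih,
      derivative_C_mul_X_pow]
    have h : ((M : ℚ) + 1) ≠ 0 := by positivity
    have : (-1 : ℚ) ^ M / (M + 1) * ((M + 1 : ℕ) : ℚ) = (-1) ^ M := by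
      push_cast; field_simp
    rw [this, Nat.add_sub_cancel]
    simp only [map_pow, map_neg, map_one]
    rw [neg_pow (X : ℚ[X]) M, neg_pow (X : ℚ[X]) (M + 1)]
    ring

theorem derivative_expPoly (M : ℕ) : derivative (expPoly (M + 1)) = expPoly M := by
  rw [expPoly, derivative_sum, Finset.sum_range_succ', expPoly]
  simp only [derivative_C_mul_X_pow, Nat.add_sub_cancel]
  simp only [Nat.factorial_zero, CharP.cast_eq_zero, mul_zero, map_zero,
    zero_mul, add_zero]
  refine Finset.sum_congr rfl fun k _ => ?_
  congr 2
  have h1 : ((k : ℚ) + 1) ≠ 0 := by positivity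
  have h2 : (k.factorial : ℚ) ≠ 0 := by positivity
  rw [Nat.factorial_succ]; push_cast; field_simp

theorem X_dvd_expPoly_sub_one (M : ℕ) : (X : ℚ[X]) ∣ expPoly (M + 1) - 1 := by
  rw [X_dvd_iff, coeff_zero_eq_eval_zero]
  rw [expPoly, Finset.sum_range_succ']
  simp [eval_finsetSum]

theorem X_pow_dvd_of_derivative {H : ℚ[X]} {M : ℕ} (h0 : H.coeff 0 = 0)
    (h : X ^ M ∣ derivative H) : X ^ (M + 1) ∣ H := by
  rw [X_pow_dvd_iff] at h ⊢
  rintro (_ | d) hd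
  · exact h0
  · have := h d (by omega)
    rw [coeff_derivative] at this
    exact (mul_eq_zero.1 this).resolve_right (by positivity)

theorem X_pow_dvd_of_linear_ode {H : ℚ[X]} {M : ℕ} (h0 : H.coeff 0 = 0)
    (h : X ^ M ∣ (1 + X) * derivative H - H) : X ^ (M + 1) ∣ H := by
  rw [X_pow_dvd_iff] at h ⊢
  intro d
  induction d with
  | zero => exact fun _ => h0
  | succ d ih =>
    intro hd
    have := h d (by omega)
    have ihd := ih (by omega)
    rw [add_mul, one_mul, coeff_sub, coeff_add, coeff_derivative, ihd] at this
    have hX : (X * derivative H).coeff d = 0 := by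
      cases d with
      | zero => simp
      | succ e => rw [coeff_X_mul, coeff_derivative, ihd, zero_mul]
    rw [hX, add_zero, sub_zero] at this
    exact (mul_eq_zero.1 this).resolve_right (by positivity)

theorem X_pow_dvd_expPoly_comp_logPoly (M : ℕ) :
    (X : ℚ[X]) ^ (M + 1) ∣ (expPoly (M + 1)).comp (logPoly M) - (1 + X) := by
  have hl := X_dvd_logPoly M
  apply X_pow_dvd_of_linear_ode
  · obtain ⟨q, hq⟩ := hl
    obtain ⟨p, hp⟩ := X_dvd_expPoly_sub_one M
    rw [sub_eq_iff_eq_add] at hp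
    rw [coeff_zero_eq_eval_zero, hp, hq]
    simp
  · have hs : expPoly (M + 1) = expPoly M + C ((M.factorial : ℚ)⁻¹) * X ^ M := by
      rw [expPoly, Finset.sum_range_succ, ← expPoly]
    have e : (1 + X) * derivative ((expPoly (M + 1)).comp (logPoly M) - (1 + X)) -
        ((expPoly (M + 1)).comp (logPoly M) - (1 + X)) =
        - (-X) ^ M * (expPoly M).comp (logPoly M) - C ((M.factorial : ℚ)⁻¹) * logPoly M ^ M := by
      rw [derivative_sub, derivative_comp, derivative_expPoly, hs]
      have := derivative_logPoly M
      simp only [add_comp, mul_comp, C_comp, X_pow_comp, derivative_add, derivative_one,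
        derivative_X, zero_add]
      linear_combination (expPoly M).comp (logPoly M) * this
    rw [e]
    refine dvd_sub ?_ ((pow_dvd_pow_of_dvd hl M).mul_left _)
    rw [neg_pow]
    exact Dvd.intro_left (-(-1) ^ M * (expPoly M).comp (logPoly M)) (by ring)

theorem X_pow_dvd_logPoly_comp_expPoly (M : ℕ) :
    (X : ℚ[X]) ^ (M + 1) ∣ (logPoly M).comp (expPoly (M + 1) - 1) - X := by
  have he := X_dvd_expPoly_sub_one M
  apply X_pow_dvd_of_derivative
  · obtain ⟨q, hq⟩ := X_dvd_logPoly M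
    obtain ⟨p, hp⟩ := he
    rw [coeff_zero_eq_eval_zero, hp, hq]
    simp
  · have hs : expPoly (M + 1) = expPoly M + C ((M.factorial : ℚ)⁻¹) * X ^ M := by
      rw [expPoly, Finset.sum_range_succ, ← expPoly]
    have hd := congrArg (fun p => p.comp (expPoly (M + 1) - 1)) (derivative_logPoly M)
    simp only [mul_comp, add_comp, one_comp, X_comp, sub_comp, pow_comp, neg_comp] at hd
    rw [derivative_sub, derivative_comp, derivative_sub, derivative_expPoly, derivative_one,
      derivative_X, sub_zero]
    have e : expPoly M * (derivative (logPoly M)).comp (expPoly (M + 1) - 1) - 1 =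
        - (-(expPoly (M + 1) - 1)) ^ M -
          X ^ M *
            (C ((M.factorial : ℚ)⁻¹) * (derivative (logPoly M)).comp (expPoly (M + 1) - 1)) := by
      linear_combination hd - (derivative (logPoly M)).comp (expPoly (M + 1) - 1) * hs
    rw [e]
    refine dvd_sub ?_ (dvd_mul_right _ _)
    rw [dvd_neg]
    exact pow_dvd_pow_of_dvd ((dvd_neg).2 he) M

variable {A : Type*} [Ring A] [Algebra ℚ A]

theorem truncLog_succ (M : ℕ) (u : A) : truncLog (M + 1) u = aeval (u - 1) (logPoly M) := by
  rw [truncLog, logPoly, Nat.add_sub_cancel, map_sum]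
  symm
  refine Finset.sum_bij (fun k _ => k + 1) (fun k hk => by simp at hk ⊢; omega)
    (fun _ _ _ _ h => by simpa using h)
    (fun k hk => ⟨k - 1, by simp at hk ⊢; omega, by simp at hk; omega⟩) fun k _ => ?_
  simp [Algebra.smul_def, pow_succ]

theorem exp_eq_aeval_expPoly {a : A} {M : ℕ} (ha : a ^ M = 0) :
    IsNilpotent.exp a = aeval a (expPoly M) := by
  rw [IsNilpotent.exp_eq_sum ha, expPoly, map_sum]
  simp [Algebra.smul_def]

theorem aeval_eq_of_X_pow_dvd {a : A} {M : ℕ} (ha : a ^ M = 0) {p q : ℚ[X]}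
    (h : X ^ M ∣ p - q) : aeval a p = aeval a q := by
  obtain ⟨r, hr⟩ := h
  rw [← sub_eq_zero, ← map_sub, hr, map_mul, map_pow, aeval_X, ha, zero_mul]

theorem aeval_pow_eq_zero {a : A} {M : ℕ} (ha : a ^ M = 0) {p : ℚ[X]} (h : X ∣ p) :
    (aeval a p) ^ M = 0 := by
  obtain ⟨r, hr⟩ := pow_dvd_pow_of_dvd h M
  rw [← map_pow, hr, map_mul, map_pow, aeval_X, ha, zero_mul]

theorem truncLog_pow_eq_zero {N : ℕ} {u : A} (hu : (u - 1) ^ N = 0) : truncLog N u ^ N = 0 := by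
  cases N with
  | zero => simpa using hu
  | succ M => rw [truncLog_succ]; exact aeval_pow_eq_zero hu (X_dvd_logPoly M)

theorem exp_truncLog {N : ℕ} {u : A} (hu : (u - 1) ^ N = 0) :
    IsNilpotent.exp (truncLog N u) = u := by
  cases N with
  | zero =>
    have : Subsingleton A := subsingleton_of_zero_eq_one (by simpa using hu.symm)
    exact Subsingleton.elim _ _
  | succ M =>
    rw [exp_eq_aeval_expPoly (truncLog_pow_eq_zero hu), truncLog_succ, ← aeval_comp,
      aeval_eq_of_X_pow_dvd hu (X_pow_dvd_expPoly_comp_logPoly M)]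
    simp

theorem truncLog_exp {N : ℕ} {a : A} (ha : a ^ N = 0) : truncLog N (IsNilpotent.exp a) = a := by
  cases N with
  | zero =>
    have : Subsingleton A := subsingleton_of_zero_eq_one (by simpa using ha.symm)
    exact Subsingleton.elim _ _
  | succ M =>
    have h : IsNilpotent.exp a - 1 = aeval a (expPoly (M + 1) - 1) := by
      rw [exp_eq_aeval_expPoly ha]; simp
    rw [truncLog_succ, h, ← aeval_comp,
      aeval_eq_of_X_pow_dvd ha (X_pow_dvd_logPoly_comp_expPoly M), aeval_X]

end TruncatedExpLog

section Dexp

open Finset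

/-- Sum over a rectangle, regrouped by antidiagonals. -/
theorem sum_antidiagonal_eq_sum_range {B : Type*} [AddCommMonoid B] (f : ℕ → ℕ → B) (K K' : ℕ)
    (h₁ : ∀ i m, K ≤ i → f i m = 0) (h₂ : ∀ i m, K' ≤ m → f i m = 0) :
    ∑ j ∈ range (K + K'), ∑ p ∈ antidiagonal j, f p.1 p.2
      = ∑ i ∈ range K, ∑ m ∈ range K', f i m := by
  rw [← sum_product', ← sum_fiberwise_of_maps_to (s := range K ×ˢ range K')
    (t := range (K + K')) (g := fun p => p.1 + p.2)]
  · refine sum_congr rfl fun j _ => (sum_subset ?_ ?_).symm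
    · intro p hp
      simpa using (mem_filter.1 hp).2
    · intro p hp hp'
      simp only [mem_filter, mem_product, mem_range, HasAntidiagonal.mem_antidiagonal] at hp hp'
      by_cases h : K ≤ p.1
      · exact h₁ _ _ h
      · exact h₂ _ _ (by by_contra h'; exact hp' ⟨⟨by omega, by omega⟩, hp⟩)
  · intro p hp
    simp only [mem_product, mem_range] at hp ⊢
    omega

variable {A : Type*} [Ring A] [Algebra ℚ A]

/-- The map `w ↦ w z - z w`. -/
def negAd (z w : A) : A := w * z - z * w

/-- The divided terms `(-ad z)^m w / (m+1)!` of the derivative of the exponential. -/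
noncomputable def dexpTerm (z w : A) (m : ℕ) : A :=
  (((m + 1).factorial : ℚ)⁻¹) • (negAd z)^[m] w

theorem negAd_smul (z w : A) (q : ℚ) : negAd z (q • w) = q • negAd z w := by
  simp [negAd, smul_sub]

theorem negAd_dexpTerm (z w : A) (m : ℕ) :
    negAd z (dexpTerm z w m) = ((m : ℚ) + 2) • dexpTerm z w (m + 1) := by
  rw [dexpTerm, negAd_smul, ← Function.iterate_succ_apply' (negAd z), dexpTerm, smul_smul]
  congr 1
  rw [Nat.factorial_succ (m + 1)]
  push_cast
  field_simp
  ring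

/-- Derivative of `z^(j+1) / (j+1)!`, expanded with all powers of `z` on the left. -/
theorem derivation_pow_eq (δ : A →+ A) (hδ : ∀ a b, δ (a * b) = δ a * b + a * δ b) (z : A)
    (j : ℕ) :
    ((j + 1).factorial : ℚ)⁻¹ • δ (z ^ (j + 1)) =
      ∑ p ∈ antidiagonal j, ((p.1.factorial : ℚ)⁻¹ • z ^ p.1) * dexpTerm z (δ z) p.2 := by
  induction j with
  | zero => simp [dexpTerm]
  | succ j ih =>
    have key : ((j : ℚ) + 2) • ∑ p ∈ antidiagonal (j + 1),
        ((p.1.factorial : ℚ)⁻¹ • z ^ p.1) * dexpTerm z (δ z) p.2 =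
        (∑ p ∈ antidiagonal j, ((p.1.factorial : ℚ)⁻¹ • z ^ p.1) * dexpTerm z (δ z) p.2) * z
          + ((j + 1).factorial : ℚ)⁻¹ • (z ^ (j + 1) * δ z) := by
      have e1 : ((j : ℚ) + 2) • ∑ p ∈ antidiagonal (j + 1),
          ((p.1.factorial : ℚ)⁻¹ • z ^ p.1) * dexpTerm z (δ z) p.2 =
          (∑ p ∈ antidiagonal (j + 1),
            (p.1 : ℚ) • (((p.1.factorial : ℚ)⁻¹ • z ^ p.1) * dexpTerm z (δ z) p.2)) +
          ∑ p ∈ antidiagonal (j + 1),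
            ((p.2 : ℚ) + 1) • (((p.1.factorial : ℚ)⁻¹ • z ^ p.1) * dexpTerm z (δ z) p.2) := by
        rw [smul_sum, ← sum_add_distrib]
        refine sum_congr rfl fun p hp => ?_
        rw [← add_smul]
        congr 1
        have := HasAntidiagonal.mem_antidiagonal.1 hp
        have : (p.1 : ℚ) + p.2 = j + 1 := by exact_mod_cast this
        linarith
      rw [e1, Nat.sum_antidiagonal_succ, Nat.sum_antidiagonal_succ']
      simp only [Nat.cast_zero, zero_smul, zero_add]
      rw [add_comm (_ • _), ← add_assoc, ← sum_add_distrib, sum_mul]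
      congr 1
      · refine sum_congr rfl fun p _ => ?_
        have h1 : ((p.1 + 1 : ℕ) : ℚ) • (((p.1 + 1).factorial : ℚ)⁻¹ • z ^ (p.1 + 1)) =
            ((p.1.factorial : ℚ)⁻¹ • z ^ p.1) * z := by
          rw [smul_smul, Nat.factorial_succ, pow_succ, smul_mul_assoc]
          congr 1
          have : ((p.1 + 1 : ℕ) : ℚ) ≠ 0 := by positivity
          push_cast at this ⊢
          field_simp
        have h2 := negAd_dexpTerm z (δ z) p.2
        rw [← smul_mul_assoc, h1]
        push_cast
        rw [show (p.2 : ℚ) + 1 + 1 = p.2 + 2 by ring, ← mul_smul_comm, ← h2, negAd]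
        noncomm_ring
      · simp [dexpTerm]
    have hz : δ (z ^ (j + 1 + 1)) = δ (z ^ (j + 1)) * z + z ^ (j + 1) * δ z := by
      rw [pow_succ z (j + 1), hδ]
    have h2 : ((j : ℚ) + 2) ≠ 0 := by positivity
    apply smul_right_injective A h2
    simp only
    rw [key, ← ih, hz, smul_smul, Nat.factorial_succ (j + 1), smul_add, smul_mul_assoc]
    have : ((j : ℚ) + 2) * (((j + 1 + 1) * (j + 1).factorial : ℕ) : ℚ)⁻¹
      = ((j + 1).factorial : ℚ)⁻¹ := by
      push_cast
      field_simp
      ring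
    rw [this]

theorem dexpTerm_eq_zero {z w : A} {K : ℕ} (h : (negAd z)^[K] w = 0) {m : ℕ} (hm : K ≤ m) :
    dexpTerm z w m = 0 := by
  obtain ⟨k, rfl⟩ := Nat.exists_eq_add_of_le' hm
  rw [dexpTerm, Function.iterate_add_apply, h]
  have : ∀ k, (negAd z)^[k] (0 : A) = 0 := fun k => by
    induction k with
    | zero => rfl
    | succ k ih => rw [Function.iterate_succ_apply', ih]; simp [negAd]
  rw [this, smul_zero]

/-- The derivative of the exponential of a nilpotent element. -/
theorem derivation_exp (δ : A →+ A) (hδ : ∀ a b, δ (a * b) = δ a * b + a * δ b) {z : A}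
    {K K' : ℕ} (hz : z ^ K = 0) (hw : (negAd z)^[K'] (δ z) = 0) :
    δ (IsNilpotent.exp z) = IsNilpotent.exp z * ∑ m ∈ range K', dexpTerm z (δ z) m := by
  have h1 : δ 1 = 0 := by simpa using hδ 1 1
  have hz' : z ^ (K + K' + 1) = 0 := pow_eq_zero_of_le (by omega) hz
  rw [IsNilpotent.exp_eq_sum hz', map_sum, sum_range_succ']
  simp only [pow_zero, map_rat_smul, h1, smul_zero, add_zero, derivation_pow_eq δ hδ]
  rw [sum_antidiagonal_eq_sum_range
    (fun i m => ((i.factorial : ℚ)⁻¹ • z ^ i) * dexpTerm z (δ z) m) K K', ← sum_mul_sum,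
    ← IsNilpotent.exp_eq_sum hz, ← IsNilpotent.exp_eq_sum hz']
  · intro i m hi
    simp [pow_eq_zero_of_le hi hz]
  · intro i m hm
    simp [dexpTerm_eq_zero hw hm]

/-- Conjugation by the exponential is the exponential of the commutator map. -/
theorem exp_mul_mul_exp_neg {z : A} {K : ℕ} (hz : z ^ K = 0) (w : A) :
    IsNilpotent.exp z * w * IsNilpotent.exp (-z) =
      ∑ k ∈ range (K + K), ((k.factorial : ℚ)⁻¹) • (fun u => z * u - u * z)^[k] w := by
  have hL : LinearMap.mulLeft ℚ z ^ K = 0 := by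
    rw [LinearMap.pow_mulLeft, hz, LinearMap.mulLeft_zero_eq_zero]
  have hR : LinearMap.mulRight ℚ (-z) ^ K = 0 := by
    rw [LinearMap.pow_mulRight, neg_pow, hz, mul_zero, LinearMap.mulRight_zero_eq_zero]
  have hc := LinearMap.commute_mulLeft_right (R := ℚ) z (-z)
  have hs : (LinearMap.mulLeft ℚ z + LinearMap.mulRight ℚ (-z)) ^ (K + K) = 0 := by
    rcases K.eq_zero_or_pos with rfl | hK
    · simpa using hL
    · exact pow_eq_zero_of_le (by omega)
        (hc.add_pow_eq_zero_of_add_le_succ_of_pow_eq_zero hL hR (Nat.le_succ (K + K)))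
  have h1 := IsNilpotent.exp_add_of_commute hc ⟨K, hL⟩ ⟨K, hR⟩
  have h2 := DFunLike.congr_fun h1 w
  rw [IsNilpotent.exp_eq_sum hs, IsNilpotent.exp_eq_sum hL, IsNilpotent.exp_eq_sum hR] at h2
  have hz' : (-z) ^ K = 0 := by rw [neg_pow, hz, mul_zero]
  rw [IsNilpotent.exp_eq_sum hz, IsNilpotent.exp_eq_sum hz', mul_assoc]
  have e : ∀ k, ((LinearMap.mulLeft ℚ z + LinearMap.mulRight ℚ (-z)) ^ k) w
      = (fun u => z * u - u * z)^[k] w := by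
    intro k
    rw [Module.End.pow_apply]
    congr 2
    ext u
    simp [sub_eq_add_neg]
  simp only [LinearMap.coe_sum, Finset.sum_apply, LinearMap.smul_apply, e, Module.End.mul_apply,
    LinearMap.pow_mulLeft, LinearMap.pow_mulRight, LinearMap.mulLeft_apply,
    LinearMap.mulRight_apply] at h2
  rw [h2]
  simp only [mul_sum, sum_mul, smul_sum, smul_mul_assoc, mul_smul_comm]
  rw [sum_comm]
  exact sum_congr rfl fun _ _ => sum_congr rfl fun _ _ => smul_comm _ _ _

end Dexp

section FilteredBCH

open Polynomial

/-- A decreasing multiplicative filtration vanishing at `N`. -/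
structure IsNilFiltration {A : Type*} [Ring A] [Algebra ℚ A] (I : ℕ → Submodule ℚ A) (N : ℕ) :
    Prop where
  antitone : Antitone I
  mul_mem : ∀ {a b : ℕ} {x y : A}, x ∈ I a → y ∈ I b → x * y ∈ I (a + b)
  eq_bot : I N = ⊥

/-- Polynomials all of whose coefficients lie in a given subspace. -/
def coeffsIn {A : Type*} [Ring A] [Algebra ℚ A] (S : Submodule ℚ A) : Submodule ℚ A[X] where
  carrier := {p | ∀ k, p.coeff k ∈ S}
  add_mem' hp hq k := by rw [coeff_add]; exact S.add_mem (hp k) (hq k)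
  zero_mem' k := by simp
  smul_mem' r p hp k := by rw [coeff_smul]; exact S.smul_mem _ (hp k)

variable {A : Type*} [Ring A] [Algebra ℚ A] {I : ℕ → Submodule ℚ A} {N : ℕ}

theorem IsNilFiltration.coeffsIn (h : IsNilFiltration I N) :
    IsNilFiltration (fun j => coeffsIn (I j)) N where
  antitone _ _ hab _ hp k := h.antitone hab (hp k)
  mul_mem hx hy k := by
    rw [coeff_mul]
    exact Submodule.sum_mem _ fun p _ => h.mul_mem (hx _) (hy _)
  eq_bot := by
    rw [eq_bot_iff]
    intro p hp
    rw [Submodule.mem_bot]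
    ext k
    have := hp k
    rw [h.eq_bot, Submodule.mem_bot] at this
    simpa using this

namespace IsNilFiltration

theorem pow_mem (h : IsNilFiltration I N) {x : A} (hx : x ∈ I 1) (k : ℕ) :
    x ^ (k + 1) ∈ I (k + 1) := by
  induction k with
  | zero => simpa using hx
  | succ k ih => rw [pow_succ]; exact h.mul_mem ih hx

theorem pow_eq_zero (h : IsNilFiltration I N) {x : A} (hx : x ∈ I 1) : x ^ (N + 1) = 0 := by
  have := h.antitone (Nat.le_succ N) (h.pow_mem hx N)
  rwa [h.eq_bot, Submodule.mem_bot] at this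

theorem exp_sub_one_mem (h : IsNilFiltration I N) {x : A} (hx : x ∈ I 1) :
    IsNilpotent.exp x - 1 ∈ I 1 := by
  rw [IsNilpotent.exp_eq_sum (h.pow_eq_zero hx), Finset.sum_range_succ']
  simp only [pow_zero, Nat.factorial_zero, Nat.cast_one, inv_one, one_smul, add_sub_cancel_right]
  exact Submodule.sum_mem _ fun k _ =>
    Submodule.smul_mem _ _ (h.antitone (Nat.le_add_left 1 k) (h.pow_mem hx k))

theorem exp_mul_exp_sub_one_mem (h : IsNilFiltration I N) {x y : A} (hx : x ∈ I 1)
    (hy : y ∈ I 1) : IsNilpotent.exp x * IsNilpotent.exp y - 1 ∈ I 1 := by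
  have hx' := h.exp_sub_one_mem hx
  have hy' := h.exp_sub_one_mem hy
  have e : IsNilpotent.exp x * IsNilpotent.exp y - 1 = (IsNilpotent.exp x - 1) +
      (IsNilpotent.exp y - 1) + (IsNilpotent.exp x - 1) * (IsNilpotent.exp y - 1) := by
    noncomm_ring
  rw [e]
  exact add_mem (add_mem hx' hy') (h.antitone (by norm_num) (h.mul_mem hx' hy'))

theorem truncLog_mem (h : IsNilFiltration I N) {u : A} (hu : u - 1 ∈ I 1) (M : ℕ) :
    truncLog M u ∈ I 1 := by
  refine Submodule.sum_mem _ fun k hk => Submodule.smul_mem _ _ ?_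
  obtain ⟨j, rfl⟩ : ∃ j, k = j + 1 := ⟨k - 1, by have := Finset.mem_Icc.1 hk; omega⟩
  exact h.antitone (Nat.le_add_left 1 j) (h.pow_mem hu j)

theorem negAd_iterate_mem (h : IsNilFiltration I N) {z w : A} (hz : z ∈ I 1) (hw : w ∈ I 1)
    (m : ℕ) : (negAd z)^[m] w ∈ I (m + 1) := by
  induction m with
  | zero => exact hw
  | succ m ih =>
    rw [Function.iterate_succ_apply', negAd]
    refine sub_mem (h.mul_mem ih hz) ?_
    rw [add_comm (m + 1)]
    exact h.mul_mem hz ih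

theorem negAd_iterate_eq_zero (h : IsNilFiltration I N) {z w : A} (hz : z ∈ I 1)
    (hw : w ∈ I 1) : (negAd z)^[N + 1] w = 0 := by
  have := h.antitone (show N ≤ N + 1 + 1 by omega) (h.negAd_iterate_mem hz hw (N + 1))
  rwa [h.eq_bot, Submodule.mem_bot] at this

end IsNilFiltration

theorem map_truncLog {B : Type*} [Ring B] [Algebra ℚ B] (f : A →+* B) (M : ℕ) (u : A) :
    f (truncLog M u) = truncLog M (f u) := by
  simp [truncLog, map_rat_smul]

theorem negAd_mem_coeffsIn {S T : Submodule ℚ A}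
    (hST : ∀ x ∈ S, ∀ y ∈ S, x * y - y * x ∈ T) {p q : A[X]}
    (hp : p ∈ coeffsIn S) (hq : q ∈ coeffsIn S) : negAd p q ∈ coeffsIn T := by
  intro k
  rw [negAd, coeff_sub, coeff_mul, coeff_mul, ← Finset.Nat.sum_antidiagonal_swap,
    ← Finset.sum_sub_distrib]
  exact Submodule.sum_mem _ fun x _ => hST _ (hq _) _ (hp _)

theorem coeff_derivative_eq_smul (p : A[X]) (k : ℕ) :
    (derivative p).coeff k = ((k : ℚ) + 1) • p.coeff (k + 1) := by
  rw [coeff_derivative, Algebra.smul_def, map_add, map_natCast, map_one]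
  exact (((Nat.cast_commute k _).add_left (Commute.one_left _))).eq.symm

theorem derivative_mem_coeffsIn {S : Submodule ℚ A} {p : A[X]} (hp : p ∈ coeffsIn S) :
    derivative p ∈ coeffsIn S := by
  intro k
  rw [coeff_derivative_eq_smul]
  exact S.smul_mem _ (hp _)

theorem mem_coeffsIn_of_derivative {S : Submodule ℚ A} {p : A[X]} (h0 : p.coeff 0 ∈ S)
    (hp : derivative p ∈ coeffsIn S) : p ∈ coeffsIn S := by
  intro k
  cases k with
  | zero => exact h0
  | succ k =>
    have h := hp k
    rw [coeff_derivative_eq_smul] at h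
    have h2 : ((k : ℚ) + 1) ≠ 0 := by positivity
    exact (S.smul_mem_iff h2).1 h

/-- **Baker–Campbell–Hausdorff**, qualitative form: a commutator-closed subspace of the
augmentation part of a nilpotent filtration is closed under `(x, y) ↦ log (exp x * exp y)`. -/
theorem truncLog_exp_mul_exp_mem (h : IsNilFiltration I N) {𝔫 : Submodule ℚ A} (h𝔫 : 𝔫 ≤ I 1)
    (hlie : ∀ x ∈ 𝔫, ∀ y ∈ 𝔫, x * y - y * x ∈ 𝔫) {x y : A} (hx : x ∈ 𝔫) (hy : y ∈ 𝔫) :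
    truncLog (N + 1) (IsNilpotent.exp x * IsNilpotent.exp y) ∈ 𝔫 := by
  have hP := h.coeffsIn
  have hCx : (C x : A[X]) ∈ coeffsIn (I 1) := fun k => by
    rw [coeff_C]; split_ifs
    exacts [h𝔫 hx, zero_mem _]
  have hXy : (C y * X : A[X]) ∈ coeffsIn (I 1) := fun k => by
    rw [coeff_C_mul_X]; split_ifs
    exacts [h𝔫 hy, zero_mem _]
  set E : A[X] := IsNilpotent.exp (C x) * IsNilpotent.exp (C y * X) with hE
  have hE1 : E - 1 ∈ coeffsIn (I 1) := hP.exp_mul_exp_sub_one_mem hCx hXy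
  set Z : A[X] := truncLog (N + 1) E with hZ
  have hZ1 : Z ∈ coeffsIn (I 1) := hP.truncLog_mem hE1 _
  have hZE : IsNilpotent.exp Z = E := exp_truncLog (hP.pow_eq_zero hE1)
  have hder : ∀ a b : A[X], (derivative : A[X] →ₗ[A] A[X]).toAddMonoidHom (a * b) =
      (derivative : A[X] →ₗ[A] A[X]).toAddMonoidHom a * b +
        a * (derivative : A[X] →ₗ[A] A[X]).toAddMonoidHom b := fun a b => derivative_mul
  have hnilC : IsNilpotent x := ⟨_, h.pow_eq_zero (h𝔫 hx)⟩
  have dXy : derivative (C y * X : A[X]) = C y := by rw [derivative_mul]; simp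
  have dE : derivative E = E * C y := by
    have e1 : IsNilpotent.exp (C x : A[X]) = C (IsNilpotent.exp x) := (hnilC.map_exp C).symm
    have hc : (negAd (C y * X : A[X])) (C y) = 0 := by
      rw [negAd, mul_assoc, X_mul, sub_self]
    have e2 := derivation_exp (derivative : A[X] →ₗ[A] A[X]).toAddMonoidHom hder (K' := 1)
      (hP.pow_eq_zero hXy) (by simp [dXy, hc])
    simp only [LinearMap.toAddMonoidHom_coe, dXy, Finset.sum_range_one] at e2
    rw [hE, derivative_mul, e2, e1, derivative_C, zero_mul, zero_add, mul_assoc]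
    simp [dexpTerm]
  have hdZ1 : derivative Z ∈ coeffsIn (I 1) := derivative_mem_coeffsIn hZ1
  have hsum : ∑ m ∈ Finset.range (N + 1), dexpTerm Z (derivative Z) m = C y := by
    have e := derivation_exp (derivative : A[X] →ₗ[A] A[X]).toAddMonoidHom hder
      (hP.pow_eq_zero hZ1) (hP.negAd_iterate_eq_zero hZ1 hdZ1)
    simp only [LinearMap.toAddMonoidHom_coe, hZE, dE] at e
    have hu : IsUnit E := hZE ▸ IsNilpotent.isUnit_exp ⟨_, hP.pow_eq_zero hZ1⟩
    exact (hu.mul_left_cancel e).symm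
  have hZ0 : Z.coeff 0 = x := by
    have e := map_truncLog (constantCoeff : A[X] →+* A) (N + 1) E
    have hn1 : IsNilpotent (C x : A[X]) := ⟨_, hP.pow_eq_zero hCx⟩
    have hn2 : IsNilpotent (C y * X : A[X]) := ⟨_, hP.pow_eq_zero hXy⟩
    rw [hE, map_mul, hn1.map_exp, hn2.map_exp] at e
    rw [← hE, ← hZ] at e
    simpa [truncLog_exp (h.pow_eq_zero (h𝔫 hx))] using e
  have step : ∀ j, 1 ≤ j → Z ∈ coeffsIn (𝔫 ⊔ I j) := by
    intro j hj
    induction j, hj using Nat.le_induction with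
    | base => exact fun k => (le_sup_right : I 1 ≤ 𝔫 ⊔ I 1) (hZ1 k)
    | succ j hj ih =>
      have hmono : 𝔫 ⊔ I (j + 1) ≤ 𝔫 ⊔ I j := sup_le_sup_left (h.antitone (Nat.le_succ j)) _
      have hcom : ∀ u ∈ 𝔫 ⊔ I j, ∀ v ∈ 𝔫 ⊔ I j, u * v - v * u ∈ 𝔫 ⊔ I (j + 1) := by
        intro u hu v hv
        obtain ⟨a, ha, b, hb, rfl⟩ := Submodule.mem_sup.1 hu
        obtain ⟨a', ha', b', hb', rfl⟩ := Submodule.mem_sup.1 hv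
        have e : (a + b) * (a' + b') - (a' + b') * (a + b) = (a * a' - a' * a) +
            (a * b' - b' * a + (b * a' - a' * b) + (b * b' - b' * b)) := by noncomm_ring
        rw [e]
        have l : ∀ {a b}, a ∈ 𝔫 → b ∈ I j → a * b ∈ I (j + 1) := fun ha hb => by
          rw [add_comm j]; exact h.mul_mem (h𝔫 ha) hb
        have r : ∀ {a b}, a ∈ 𝔫 → b ∈ I j → b * a ∈ I (j + 1) := fun ha hb =>
          h.mul_mem hb (h𝔫 ha)
        have m : ∀ {a b}, a ∈ I j → b ∈ I j → a * b ∈ I (j + 1) := fun ha hb =>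
          h.antitone (by omega) (h.mul_mem ha hb)
        exact Submodule.add_mem_sup (hlie _ ha _ ha')
          (add_mem (add_mem (sub_mem (l ha hb') (r ha hb')) (sub_mem (r ha' hb) (l ha' hb)))
            (sub_mem (m hb hb') (m hb' hb)))
      have hiter : ∀ m, (negAd Z)^[m + 1] (derivative Z) ∈ coeffsIn (𝔫 ⊔ I (j + 1)) := by
        intro m
        induction m with
        | zero => exact negAd_mem_coeffsIn hcom ih (derivative_mem_coeffsIn ih)
        | succ m ihm =>
          rw [Function.iterate_succ_apply']
          exact negAd_mem_coeffsIn hcom ih fun k => hmono (ihm k)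
      refine mem_coeffsIn_of_derivative ?_ ?_
      · rw [hZ0]; exact (le_sup_left : 𝔫 ≤ 𝔫 ⊔ I (j + 1)) hx
      · have e : derivative Z = C y -
            ∑ m ∈ Finset.range N, dexpTerm Z (derivative Z) (m + 1) := by
          rw [← hsum, Finset.sum_range_succ']
          simp [dexpTerm]
        rw [e]
        refine sub_mem (fun k => ?_)
          (Submodule.sum_mem _ fun m _ => Submodule.smul_mem _ _ (hiter m))
        rw [coeff_C]; split_ifs
        exacts [(le_sup_left : 𝔫 ≤ 𝔫 ⊔ I (j + 1)) hy, zero_mem _]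
  have hfin : Z ∈ coeffsIn 𝔫 := by
    have := step (N + 1) (Nat.le_add_left 1 N)
    rwa [eq_bot_iff.2 ((h.antitone (Nat.le_succ N)).trans h.eq_bot.le), sup_bot_eq] at this
  have hcomm : ∀ a : A, Commute ((RingHom.id A) a) 1 := fun a => Commute.one_right a
  have e := map_truncLog (eval₂RingHom' (RingHom.id A) (1 : A) hcomm) (N + 1) E
  have hn1 : IsNilpotent (C x : A[X]) := ⟨_, hP.pow_eq_zero hCx⟩
  have hn2 : IsNilpotent (C y * X : A[X]) := ⟨_, hP.pow_eq_zero hXy⟩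
  have ev : ∀ p : A[X], eval₂RingHom' (RingHom.id A) (1 : A) hcomm p = eval 1 p := fun _ => rfl
  rw [hE, map_mul, hn1.map_exp, hn2.map_exp, ← hE, ← hZ, ev, ev, ev] at e
  simp only [eval_C, eval_C_mul, eval_X, mul_one] at e
  rw [← e, eval_eq_sum]
  exact Submodule.sum_mem _ fun k _ => by simpa using hfin k

end FilteredBCH

section LieWords

/-- The iterated bracket `[b₁, [b₂, … [b_k, [x, y]]]]` for a word in the two letters `x`, `y`. -/
def lieWord {L : Type*} [LieRing L] (x y : L) : List Bool → L
  | [] => ⁅x, y⁆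
  | b :: w => ⁅bif b then x else y, lieWord x y w⁆

theorem map_lieWord {L L' : Type*} [LieRing L] [LieRing L'] (f : L → L')
    (hf : ∀ a b, f ⁅a, b⁆ = ⁅f a, f b⁆) (x y : L) (w : List Bool) :
    f (lieWord x y w) = lieWord (f x) (f y) w := by
  induction w with
  | nil => exact hf x y
  | cons b w ih => rw [lieWord, lieWord, hf, ih]; cases b <;> rfl

theorem lieWord_eq_zero {L : Type*} [LieRing L] {x y : L} (h : ⁅x, y⁆ = 0) (w : List Bool) :
    lieWord x y w = 0 := by
  induction w with
  | nil => exact h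
  | cons b w ih => rw [lieWord, ih, lie_zero]

variable {R L : Type*} [CommRing R] [LieRing L] [LieAlgebra R L]

theorem lie_mem_span_lieWord_of_letter (x y : L) (b : Bool) {m : L}
    (hm : m ∈ Submodule.span R (Set.range (lieWord x y))) :
    ⁅bif b then x else y, m⁆ ∈ Submodule.span R (Set.range (lieWord x y)) := by
  induction hm using Submodule.span_induction with
  | mem m hm =>
    obtain ⟨w, rfl⟩ := hm
    exact Submodule.subset_span ⟨b :: w, rfl⟩
  | zero => simp
  | add u v _ _ hu hv => rw [lie_add]; exact add_mem hu hv
  | smul r u _ hu => rw [lie_smul]; exact Submodule.smul_mem _ _ hu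

theorem lieWord_lie_mem_span (x y : L) (w : List Bool) {m : L}
    (hm : m ∈ Submodule.span R (Set.range (lieWord x y))) :
    ⁅lieWord x y w, m⁆ ∈ Submodule.span R (Set.range (lieWord x y)) := by
  induction w generalizing m with
  | nil =>
    rw [lieWord, lie_lie]
    exact sub_mem
      (lie_mem_span_lieWord_of_letter x y true (lie_mem_span_lieWord_of_letter x y false hm))
      (lie_mem_span_lieWord_of_letter x y false (lie_mem_span_lieWord_of_letter x y true hm))
  | cons b w ih =>
    rw [lieWord, lie_lie]
    exact sub_mem (lie_mem_span_lieWord_of_letter x y b (ih hm))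
      (ih (lie_mem_span_lieWord_of_letter x y b hm))

/-- The Lie subalgebra generated by two elements is spanned by them and the Lie words. -/
theorem lie_mem_span_insert_lieWord (x y : L) {u v : L}
    (hu : u ∈ Submodule.span R (insert x (insert y (Set.range (lieWord x y)))))
    (hv : v ∈ Submodule.span R (insert x (insert y (Set.range (lieWord x y))))) :
    ⁅u, v⁆ ∈ Submodule.span R (insert x (insert y (Set.range (lieWord x y)))) := by
  have hsub : Submodule.span R (Set.range (lieWord x y)) ≤
      Submodule.span R (insert x (insert y (Set.range (lieWord x y)))) :=
    Submodule.span_mono ((Set.subset_insert _ _).trans (Set.subset_insert _ _))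
  have hxy : ⁅x, y⁆ ∈ Submodule.span R (Set.range (lieWord x y)) :=
    Submodule.subset_span ⟨[], rfl⟩
  have hlet := lie_mem_span_lieWord_of_letter (R := R) x y
  apply hsub
  induction hu, hv using Submodule.span_induction₂ with
  | mem_mem a b ha hb =>
    rcases ha with rfl | rfl | ⟨w, rfl⟩ <;> rcases hb with rfl | rfl | ⟨w', rfl⟩
    · simp
    · exact hxy
    · exact hlet true (Submodule.subset_span ⟨w', rfl⟩)
    · rw [← lie_skew]; exact neg_mem hxy
    · simp
    · exact hlet false (Submodule.subset_span ⟨w', rfl⟩)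
    · rw [← lie_skew]; exact neg_mem (hlet true (Submodule.subset_span ⟨w, rfl⟩))
    · rw [← lie_skew]; exact neg_mem (hlet false (Submodule.subset_span ⟨w, rfl⟩))
    · exact lieWord_lie_mem_span x y w (Submodule.subset_span ⟨w', rfl⟩)
  | zero_left => simp
  | zero_right => simp
  | add_left a b c _ _ _ h1 h2 => rw [add_lie]; exact add_mem h1 h2
  | add_right a b c _ _ _ h1 h2 => rw [lie_add]; exact add_mem h1 h2
  | smul_left r a b _ _ h => rw [smul_lie]; exact Submodule.smul_mem _ _ h
  | smul_right r a b _ _ h => rw [lie_smul]; exact Submodule.smul_mem _ _ h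

end LieWords

section MatrixBCH

variable {n : ℕ}

/-- Families of matrices supported on or above the `d`-th superdiagonal. -/
def upperFiltration (ι : Type*) (n d : ℕ) : Submodule ℚ (ι → Matrix (Fin n) (Fin n) ℚ) where
  carrier := {f | ∀ p (i j : Fin n), (j : ℕ) < i + d → f p i j = 0}
  add_mem' hf hg p i j h := by simp [hf p i j h, hg p i j h]
  zero_mem' _ _ _ _ := rfl
  smul_mem' r f hf p i j h := by simp [hf p i j h]

theorem isNilFiltration_upperFiltration (ι : Type*) (n : ℕ) :
    IsNilFiltration (upperFiltration ι n) n where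
  antitone _ _ hab _ hf p i j h := hf p i j (by omega)
  mul_mem {a b} f g hf hg p i j h := by
    rw [Pi.mul_apply, Matrix.mul_apply]
    refine Finset.sum_eq_zero fun k _ => ?_
    by_cases hk : (k : ℕ) < i + a
    · rw [hf p i k hk, zero_mul]
    · rw [hg p k j (by omega), mul_zero]
  eq_bot := by
    rw [eq_bot_iff]
    intro f hf
    rw [Submodule.mem_bot]
    ext p i j
    exact hf p i j (by omega)

theorem IsStrictUpper.mem_upperFiltration {ι : Type*}
    {f : ι → Matrix (Fin n) (Fin n) ℚ} (hf : ∀ p, IsStrictUpper (f p)) :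
    f ∈ upperFiltration ι n 1 :=
  fun p i j h => hf p i j (Fin.le_def.2 (by omega))

theorem pow_eq_zero_of_mem_upperFiltration {X : Matrix (Fin n) (Fin n) ℚ}
    (h : (fun _ => X) ∈ upperFiltration Unit n 1) : X ^ n = 0 := by
  cases n with
  | zero => exact Subsingleton.elim _ _
  | succ k =>
    have := (isNilFiltration_upperFiltration Unit (k + 1)).pow_mem h k
    rw [(isNilFiltration_upperFiltration Unit (k + 1)).eq_bot, Submodule.mem_bot] at this
    exact congrFun this ()

theorem IsStrictUpper.pow_eq_zero {X : Matrix (Fin n) (Fin n) ℚ} (h : IsStrictUpper X) :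
    X ^ n = 0 :=
  pow_eq_zero_of_mem_upperFiltration (IsStrictUpper.mem_upperFiltration fun _ => h)

theorem expM_eq_exp {X : Matrix (Fin n) (Fin n) ℚ} (h : IsStrictUpper X) :
    expM X = IsNilpotent.exp X :=
  (IsNilpotent.exp_eq_sum h.pow_eq_zero).symm

theorem logM_eq_truncLog (B : Matrix (Fin n) (Fin n) ℚ) : logM B = truncLog n B := rfl

theorem expM_mul_expM_sub_one_pow {X Y : Matrix (Fin n) (Fin n) ℚ} (hX : IsStrictUpper X)
    (hY : IsStrictUpper Y) : (expM X * expM Y - 1) ^ n = 0 := by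
  have h := isNilFiltration_upperFiltration Unit n
  have hX' := IsStrictUpper.mem_upperFiltration (ι := Unit) fun _ => hX
  have hY' := IsStrictUpper.mem_upperFiltration (ι := Unit) fun _ => hY
  have e := h.exp_mul_exp_sub_one_mem hX' hY'
  apply pow_eq_zero_of_mem_upperFiltration
  convert e
  have m1 := IsNilpotent.map_exp ⟨_, h.pow_eq_zero hX'⟩
    (Pi.evalRingHom (fun _ : Unit => Matrix (Fin n) (Fin n) ℚ) ())
  have m2 := IsNilpotent.map_exp ⟨_, h.pow_eq_zero hY'⟩
    (Pi.evalRingHom (fun _ : Unit => Matrix (Fin n) (Fin n) ℚ) ())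
  simp only [Pi.evalRingHom_apply] at m1 m2
  ext p : 1
  simp [expM_eq_exp hX, expM_eq_exp hY, m1, m2]

theorem expM_bch {X Y : Matrix (Fin n) (Fin n) ℚ} (hX : IsStrictUpper X)
    (hY : IsStrictUpper Y) (h : IsStrictUpper (bch X Y)) :
    expM (bch X Y) = expM X * expM Y := by
  rw [expM_eq_exp h, bch, logM_eq_truncLog, exp_truncLog (expM_mul_expM_sub_one_pow hX hY)]

theorem logM_expM {X : Matrix (Fin n) (Fin n) ℚ} (hX : IsStrictUpper X) :
    logM (expM X) = X := by
  rw [expM_eq_exp hX, logM_eq_truncLog, truncLog_exp hX.pow_eq_zero]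

theorem truncLog_eq_of_le {A : Type*} [Ring A] [Algebra ℚ A] {M N : ℕ} {u : A} (hMN : M ≤ N)
    (hu : (u - 1) ^ M = 0) : truncLog N u = truncLog M u := by
  have h1 := truncLog_exp (pow_eq_zero_of_le hMN (truncLog_pow_eq_zero hu))
  rwa [exp_truncLog hu] at h1

attribute [local instance] LieRing.ofAssociativeRing LieAlgebra.ofAssociativeAlgebra

/-- The Baker–Campbell–Hausdorff formula with universal coefficients. -/
theorem exists_bch_formula (n : ℕ) : ∃ c : List Bool →₀ ℚ,
    ∀ X Y : Matrix (Fin n) (Fin n) ℚ, IsStrictUpper X → IsStrictUpper Y →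
      bch X Y = X + Y + c.sum fun w q => q • lieWord X Y w := by
  let ι := {X : Matrix (Fin n) (Fin n) ℚ // IsStrictUpper X} ×
    {X : Matrix (Fin n) (Fin n) ℚ // IsStrictUpper X}
  let x : ι → Matrix (Fin n) (Fin n) ℚ := fun p => p.1
  let y : ι → Matrix (Fin n) (Fin n) ℚ := fun p => p.2
  have hF := isNilFiltration_upperFiltration ι n
  have hx : x ∈ upperFiltration ι n 1 := IsStrictUpper.mem_upperFiltration fun p => p.1.2
  have hy : y ∈ upperFiltration ι n 1 := IsStrictUpper.mem_upperFiltration fun p => p.2.2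
  have hlie1 : ∀ u ∈ upperFiltration ι n 1, ∀ v ∈ upperFiltration ι n 1,
      ⁅u, v⁆ ∈ upperFiltration ι n 1 := fun u hu v hv => by
    rw [Ring.lie_def]
    exact sub_mem (hF.antitone (by norm_num) (hF.mul_mem hu hv))
      (hF.antitone (by norm_num) (hF.mul_mem hv hu))
  have hword : ∀ w, lieWord x y w ∈ upperFiltration ι n 1 := fun w => by
    induction w with
    | nil => exact hlie1 _ hx _ hy
    | cons b w ih => cases b; exacts [hlie1 _ hy _ ih, hlie1 _ hx _ ih]
  have hmem := truncLog_exp_mul_exp_mem hF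
    (𝔫 := Submodule.span ℚ (insert x (insert y (Set.range (lieWord x y)))))
    (Submodule.span_le.2 (by
      rintro u (rfl | rfl | ⟨w, rfl⟩)
      exacts [hx, hy, hword w]))
    (fun u hu v hv => lie_mem_span_insert_lieWord x y hu hv)
    (Submodule.subset_span (Set.mem_insert x _))
    (Submodule.subset_span (Set.mem_insert_of_mem _ (Set.mem_insert y _)))
  obtain ⟨α, u, hu, e1⟩ := Submodule.mem_span_insert.1 hmem
  obtain ⟨β, v, hv, rfl⟩ := Submodule.mem_span_insert.1 hu
  obtain ⟨c, rfl⟩ := Finsupp.mem_span_range_iff_exists_finsupp.1 hv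
  have key : ∀ X Y : Matrix (Fin n) (Fin n) ℚ, IsStrictUpper X → IsStrictUpper Y →
      bch X Y = α • X + (β • Y + c.sum fun w q => q • lieWord X Y w) := by
    intro X Y hX hY
    let p : ι := (⟨X, hX⟩, ⟨Y, hY⟩)
    let ev := Pi.evalRingHom (fun _ : ι => Matrix (Fin n) (Fin n) ℚ) p
    have e2 := congrArg ev e1
    rw [map_truncLog, map_mul, IsNilpotent.map_exp ⟨_, hF.pow_eq_zero hx⟩,
      IsNilpotent.map_exp ⟨_, hF.pow_eq_zero hy⟩, map_add, map_add, map_finsuppSum] at e2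
    have hw : ∀ w, ev (lieWord x y w) = lieWord X Y w := fun w =>
      map_lieWord ev (fun a b => by rw [Ring.lie_def, Ring.lie_def, map_sub, map_mul, map_mul])
        x y w
    simp only [map_rat_smul, hw] at e2
    have h1 : ev x = X := rfl
    have h2 : ev y = Y := rfl
    rw [h1, h2, ← expM_eq_exp hX, ← expM_eq_exp hY,
      truncLog_eq_of_le (Nat.le_succ n) (expM_mul_expM_sub_one_pow hX hY)] at e2
    exact e2
  have h0 : IsStrictUpper (0 : Matrix (Fin n) (Fin n) ℚ) := fun _ _ _ => rfl
  have hexp0 : expM (0 : Matrix (Fin n) (Fin n) ℚ) = 1 := by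
    rw [expM_eq_exp h0, IsNilpotent.exp_zero]
  have hα : ∀ X : Matrix (Fin n) (Fin n) ℚ, IsStrictUpper X → α • X = X := fun X hX => by
    have := key X 0 hX h0
    rw [bch, hexp0, mul_one, logM_expM hX] at this
    simpa [lieWord_eq_zero (lie_zero X), Finsupp.sum] using this.symm
  have hβ : ∀ X : Matrix (Fin n) (Fin n) ℚ, IsStrictUpper X → β • X = X := fun X hX => by
    have := key 0 X h0 hX
    rw [bch, hexp0, one_mul, logM_expM hX] at this
    simpa [lieWord_eq_zero (zero_lie X), Finsupp.sum] using this.symm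
  refine ⟨c, fun X Y hX hY => ?_⟩
  rw [key X Y hX hY, hα X hX, hβ Y hY, add_assoc]

/-- Conjugation in the BCH group is given by the exponential of the adjoint map. -/
theorem bch_bch_neg {X Y : Matrix (Fin n) (Fin n) ℚ} (hX : IsStrictUpper X)
    (hY : IsStrictUpper Y) (h : IsStrictUpper (bch X Y)) :
    bch (bch X Y) (-X) =
      ∑ k ∈ Finset.range (n + 1 + (n + 1)), ((k.factorial : ℚ)⁻¹) • (fun u => ⁅X, u⁆)^[k] Y := by
  have hX' : IsStrictUpper (-X) := fun i j hij => by simp [hX i j hij]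
  have hn : IsNilpotent X := ⟨n, hX.pow_eq_zero⟩
  let u : (Matrix (Fin n) (Fin n) ℚ)ˣ := ⟨IsNilpotent.exp X, IsNilpotent.exp (-X),
    IsNilpotent.exp_mul_exp_neg_self hn, IsNilpotent.exp_neg_mul_exp_self hn⟩
  have e := map_truncLog (MulSemiringAction.toRingHom _ (Matrix (Fin n) (Fin n) ℚ)
    (ConjAct.toConjAct u)) n (expM Y)
  rw [← logM_eq_truncLog, logM_expM hY, MulSemiringAction.toRingHom_apply,
    MulSemiringAction.toRingHom_apply, ConjAct.units_smul_def, ConjAct.units_smul_def,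
    ConjAct.ofConjAct_toConjAct] at e
  rw [bch, expM_bch hX hY h, logM_eq_truncLog, expM_eq_exp hX, expM_eq_exp hX']
  refine e.symm.trans ?_
  exact exp_mul_mul_exp_neg (pow_eq_zero_of_le (Nat.le_succ n) hX.pow_eq_zero) Y

end MatrixBCH

section BCHRing

/-- A group and Lie ring structure on a finitely generated free `ℤ`-module, related by
Baker–Campbell–Hausdorff formulas with common denominator `D`. -/
structure IsBCHRing (G : Type*) [Group G] [LieRing G] (D : ℤ) (s : Finset (List Bool))
    (c : List Bool → ℤ) (K : ℕ) (c' : ℕ → ℤ) : Prop where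
  D_ne_zero : D ≠ 0
  torsionFree : ∀ (m : ℤ) (g : G), m ≠ 0 → m • g = 0 → g = 0
  finite : Module.Finite ℤ G
  one_eq : (1 : G) = 0
  inv_eq : ∀ g : G, g⁻¹ = -g
  zpow_eq : ∀ (g : G) (k : ℤ), g ^ k = k • g
  mul_eq : ∀ x y : G, D • (x * y - x - y) = ∑ w ∈ s, c w • lieWord x y w
  conj_eq : ∀ g w : G, D • (g * w * g⁻¹ - w - ⁅g, w⁆) =
    ∑ k ∈ Finset.range K, c' k • (fun u => ⁅g, u⁆)^[k] ⁅g, ⁅g, w⁆⁆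

/-- A common denominator for finitely many rational numbers. -/
theorem exists_common_denominator {ι : Type*} (s : Finset ι) (q : ι → ℚ) :
    ∃ D : ℤ, D ≠ 0 ∧ ∃ z : ι → ℤ, ∀ i ∈ s, (D : ℚ) * q i = z i := by
  refine ⟨∏ i ∈ s, ((q i).den : ℤ), Finset.prod_ne_zero_iff.2 fun i _ => by simp, ?_⟩
  refine ⟨fun i => (∏ j ∈ s, ((q j).den : ℤ)) / (q i).den * (q i).num, fun i hi => ?_⟩
  obtain ⟨k, hk⟩ := Finset.dvd_prod_of_mem (fun j => ((q j).den : ℤ)) hi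
  have h0 : ((q i).den : ℤ) ≠ 0 := by simp
  beta_reduce
  rw [hk, Int.mul_ediv_cancel_left _ h0]
  push_cast
  rw [mul_right_comm, mul_comm ((q i).den : ℚ), Rat.mul_den_eq_num, mul_comm]

theorem mem_range_mapMatrix {n : ℕ} {M : Matrix (Fin n) (Fin n) ℚ}
    (h : ∀ i j, ∃ z : ℤ, (z : ℚ) = M i j) :
    M ∈ ((Int.castRingHom ℚ).mapMatrix (m := Fin n)).range := by
  choose z hz using h
  exact ⟨Matrix.of z, by ext i j; exact hz i j⟩

variable {n : ℕ} {G : Type*} [Group G] [LieRing G] {ρ : G → Matrix (Fin n) (Fin n) ℚ}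

namespace IsLRGroup

/-- The realization of an LR-group as an additive map. -/
def toAddMonoidHom (h : IsLRGroup n G ρ) : G →+ Matrix (Fin n) (Fin n) ℚ where
  toFun := ρ
  map_zero' := h.map_zero
  map_add' := h.map_add

theorem map_zsmul (h : IsLRGroup n G ρ) (m : ℤ) (g : G) : ρ (m • g) = m • ρ g :=
  _root_.map_zsmul h.toAddMonoidHom m g

theorem map_sub (h : IsLRGroup n G ρ) (x y : G) : ρ (x - y) = ρ x - ρ y :=
  _root_.map_sub h.toAddMonoidHom x y

theorem map_sum (h : IsLRGroup n G ρ) {ι : Type*} (s : Finset ι) (f : ι → G) :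
    ρ (∑ i ∈ s, f i) = ∑ i ∈ s, ρ (f i) :=
  _root_.map_sum h.toAddMonoidHom f s

theorem torsionFree (h : IsLRGroup n G ρ) (m : ℤ) (g : G) (hm : m ≠ 0) (hg : m • g = 0) :
    g = 0 := by
  apply h.inj
  have := congrArg ρ hg
  rw [h.map_zsmul, h.map_zero] at this
  rw [h.map_zero]
  rw [← Int.cast_smul_eq_zsmul ℚ] at this
  exact (smul_eq_zero.1 this).resolve_left (by exact_mod_cast hm)

theorem expM_mul (h : IsLRGroup n G ρ) (x y : G) :
    expM (ρ (x * y)) = expM (ρ x) * expM (ρ y) := by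
  rw [h.map_mul]
  exact expM_bch (h.upper x) (h.upper y) (h.map_mul x y ▸ h.upper (x * y))

theorem expM_sub_one (h : IsLRGroup n G ρ) (g : G) (i j : Fin n) (hij : j ≤ i) :
    (expM (ρ g) - 1) i j = 0 := by
  have hF := isNilFiltration_upperFiltration Unit n
  have hg := IsStrictUpper.mem_upperFiltration (ι := Unit) fun _ => h.upper g
  have e := hF.exp_sub_one_mem hg () i j (by have := Fin.le_def.1 hij; omega)
  have m := IsNilpotent.map_exp ⟨_, hF.pow_eq_zero hg⟩
    (Pi.evalRingHom (fun _ : Unit => Matrix (Fin n) (Fin n) ℚ) ())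
  simp only [Pi.evalRingHom_apply] at m
  rw [expM_eq_exp (h.upper g), ← m]
  exact e

/-- After conjugating by a diagonal matrix, all exponentials become integral. -/
theorem exists_conj_integral (h : IsLRGroup n G ρ) :
    ∃ u : (Matrix (Fin n) (Fin n) ℚ)ˣ, ∀ g : G,
      (u : Matrix (Fin n) (Fin n) ℚ) * expM (ρ g) * (u⁻¹ : (Matrix (Fin n) (Fin n) ℚ)ˣ) ∈
        (Int.castRingHom ℚ).mapMatrix.range := by
  obtain ⟨S, hS, hSfin⟩ := Monoid.fg_iff.1 (Group.fg_iff_monoid_fg.1 h.fg)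
  obtain ⟨D, hD, z, hz⟩ := exists_common_denominator
    (hSfin.toFinset ×ˢ (Finset.univ : Finset (Fin n × Fin n)))
    fun p => expM (ρ p.1) p.2.1 p.2.2
  have hD' : (D : ℚ) ≠ 0 := by exact_mod_cast hD
  let u : (Matrix (Fin n) (Fin n) ℚ)ˣ :=
    ⟨Matrix.diagonal fun i => ((D : ℚ) ^ (i : ℕ))⁻¹, Matrix.diagonal fun i => (D : ℚ) ^ (i : ℕ),
      by simp [Matrix.diagonal_mul_diagonal, hD'], by simp [Matrix.diagonal_mul_diagonal, hD']⟩
  refine ⟨u, fun g => ?_⟩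
  have hg : g ∈ Submonoid.closure S := hS ▸ Submonoid.mem_top g
  induction hg using Submonoid.closure_induction with
  | mem g hg =>
    refine mem_range_mapMatrix fun i j => ?_
    have e : ((u : Matrix (Fin n) (Fin n) ℚ) * expM (ρ g) *
        (u⁻¹ : (Matrix (Fin n) (Fin n) ℚ)ˣ)) i j =
        ((D : ℚ) ^ (i : ℕ))⁻¹ * expM (ρ g) i j * (D : ℚ) ^ (j : ℕ) := by
      rw [Units.inv_mk, Matrix.mul_diagonal, Matrix.diagonal_mul]
    rw [e]
    have h1 := h.expM_sub_one g i j
    rcases lt_trichotomy i j with hij | rfl | hij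
    · obtain ⟨k, hk⟩ := Nat.exists_eq_add_of_lt (Fin.lt_def.1 hij)
      refine ⟨D ^ k * z (g, i, j), ?_⟩
      have := hz (g, i, j) (by simp [hg])
      push_cast
      rw [← this, hk, pow_add, pow_add]
      field_simp
    · refine ⟨1, ?_⟩
      have h2 := h1 le_rfl
      rw [Matrix.sub_apply, Matrix.one_apply_eq, sub_eq_zero] at h2
      rw [h2]
      field_simp
      simp
    · refine ⟨0, ?_⟩
      have h2 := h1 hij.le
      rw [Matrix.sub_apply, Matrix.one_apply_ne hij.ne', sub_zero] at h2
      rw [h2]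
      simp
  | one =>
    have : expM (ρ 1) = 1 := by
      rw [expM_eq_exp (h.upper 1), h.map_one, IsNilpotent.exp_zero]
    rw [this, mul_one, Units.mul_inv]
    exact one_mem _
  | mul x y _ _ hx hy =>
    rw [h.expM_mul]
    convert mul_mem hx hy using 1
    rw [mul_assoc _ _ ((u : Matrix (Fin n) (Fin n) ℚ) * _ * _), mul_assoc _ _ (_ * _),
      mul_assoc _ (expM (ρ y)) (_), Units.inv_mul_cancel_left, mul_assoc, mul_assoc]

theorem moduleFinite (h : IsLRGroup n G ρ) : Module.Finite ℤ G := by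
  obtain ⟨u, hu⟩ := h.exists_conj_integral
  let f : G →ₗ[ℤ] Matrix (Fin n) (Fin n) ℚ := AddMonoidHom.toIntLinearMap
    { toFun := fun g => (n.factorial : ℤ) • ((u : Matrix (Fin n) (Fin n) ℚ) * ρ g *
        (u⁻¹ : (Matrix (Fin n) (Fin n) ℚ)ˣ))
      map_zero' := by simp [h.map_zero]
      map_add' := fun x y => by rw [h.map_add, mul_add, add_mul, smul_add] }
  let i : Matrix (Fin n) (Fin n) ℤ →ₗ[ℤ] Matrix (Fin n) (Fin n) ℚ :=
    ((Int.castRingHom ℚ).mapMatrix (m := Fin n)).toAddMonoidHom.toIntLinearMap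
  have hf : ∀ g, f g ∈ LinearMap.range i := by
    intro g
    have e := map_truncLog (MulSemiringAction.toRingHom _ (Matrix (Fin n) (Fin n) ℚ)
      (ConjAct.toConjAct u)) n (expM (ρ g))
    rw [← logM_eq_truncLog, logM_expM (h.upper g), MulSemiringAction.toRingHom_apply,
      MulSemiringAction.toRingHom_apply, ConjAct.units_smul_def, ConjAct.units_smul_def,
      ConjAct.ofConjAct_toConjAct] at e
    change (n.factorial : ℤ) • _ ∈ ((Int.castRingHom ℚ).mapMatrix (m := Fin n)).range
    rw [e, truncLog, Finset.smul_sum]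
    refine Subring.sum_mem _ fun k hk => ?_
    have hk' := Finset.mem_Icc.1 hk
    obtain ⟨m, hm⟩ := Nat.dvd_factorial hk'.1 (show k ≤ n by omega)
    have hk0 : (k : ℚ) ≠ 0 := by exact_mod_cast (show k ≠ 0 by omega)
    have e2 : (n.factorial : ℤ) • ((((-1 : ℚ) ^ (k + 1)) / (k : ℚ)) •
        ((u : Matrix (Fin n) (Fin n) ℚ) * expM (ρ g) *
          (u⁻¹ : (Matrix (Fin n) (Fin n) ℚ)ˣ) - 1) ^ k) = ((-1) ^ (k + 1) * (m : ℤ)) •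
        ((u : Matrix (Fin n) (Fin n) ℚ) * expM (ρ g) *
          (u⁻¹ : (Matrix (Fin n) (Fin n) ℚ)ˣ) - 1) ^ k := by
      rw [← Int.cast_smul_eq_zsmul ℚ, ← Int.cast_smul_eq_zsmul ℚ, smul_smul, hm]
      congr 1
      push_cast
      field_simp
    rw [e2]
    exact zsmul_mem (pow_mem (sub_mem (hu g) (one_mem _)) k) _
  have hinj : Function.Injective (f.codRestrict (LinearMap.range i) hf) := by
    intro x y hxy
    have e : (n.factorial : ℤ) • ((u : Matrix (Fin n) (Fin n) ℚ) * ρ x *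
        (u⁻¹ : (Matrix (Fin n) (Fin n) ℚ)ˣ)) = (n.factorial : ℤ) •
        ((u : Matrix (Fin n) (Fin n) ℚ) * ρ y * (u⁻¹ : (Matrix (Fin n) (Fin n) ℚ)ˣ)) :=
      congrArg Subtype.val hxy
    rw [← Int.cast_smul_eq_zsmul ℚ, ← Int.cast_smul_eq_zsmul ℚ] at e
    have e' := smul_right_injective _ (show (((n.factorial : ℤ) : ℚ)) ≠ 0 by positivity) e
    exact h.inj (u.isUnit.mul_right_injective (u⁻¹.isUnit.mul_left_injective e'))
  exact Module.Finite.of_injective _ hinj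

attribute [local instance] LieRing.ofAssociativeRing LieAlgebra.ofAssociativeAlgebra

theorem map_lie' (h : IsLRGroup n G ρ) (x y : G) : ρ ⁅x, y⁆ = ⁅ρ x, ρ y⁆ := by
  rw [h.map_lie, Ring.lie_def]

theorem exists_isBCHRing (h : IsLRGroup n G ρ) : ∃ D s c K c', IsBCHRing G D s c K c' := by
  obtain ⟨q, hq⟩ := exists_bch_formula n
  obtain ⟨D₁, hD₁, z, hz⟩ := exists_common_denominator q.support q
  obtain ⟨D₂, hD₂, z', hz'⟩ := exists_common_denominator (Finset.range (n + n))
    fun k => (((k + 2).factorial : ℚ)⁻¹)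
  have mul_eq : ∀ x y : G, (D₁ * D₂) • (x * y - x - y) =
      ∑ w ∈ q.support, (D₂ * z w) • lieWord x y w := by
    intro x y
    apply h.inj
    rw [h.map_zsmul, h.map_sub, h.map_sub, h.map_mul, hq _ _ (h.upper x) (h.upper y), h.map_sum,
      add_assoc, add_sub_cancel_left, add_sub_cancel_left, Finsupp.sum, Finset.smul_sum]
    refine Finset.sum_congr rfl fun w hw => ?_
    rw [h.map_zsmul, map_lieWord ρ h.map_lie', ← Int.cast_smul_eq_zsmul ℚ,
      ← Int.cast_smul_eq_zsmul ℚ, smul_smul]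
    congr 1
    push_cast
    rw [← hz w hw]
    ring
  have one_eq : (1 : G) = 0 := h.inj (by rw [h.map_one, h.map_zero])
  have inv_eq : ∀ g : G, g⁻¹ = -g := fun g =>
    h.inj (by rw [h.map_inv]; exact (map_neg h.toAddMonoidHom g).symm)
  have D_ne : D₁ * D₂ ≠ 0 := mul_ne_zero hD₁ hD₂
  have pow_eq : ∀ (g : G) (k : ℕ), g ^ k = k • g := fun g k => by
    induction k with
    | zero => rw [pow_zero, zero_smul, one_eq]
    | succ k ih =>
      have e := mul_eq (g ^ k) g
      have hl : ⁅g ^ k, g⁆ = 0 := by rw [ih, nsmul_lie, lie_self, smul_zero]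
      rw [Finset.sum_eq_zero fun w _ => by rw [lieWord_eq_zero hl, smul_zero]] at e
      have := h.torsionFree _ _ D_ne e
      rw [sub_sub, sub_eq_zero] at this
      rw [pow_succ, this, ih, succ_nsmul]
  refine ⟨D₁ * D₂, q.support, fun w => D₂ * z w, n + n, fun k => D₁ * z' k, D_ne, h.torsionFree,
    h.moduleFinite, one_eq, inv_eq, ?_, mul_eq, ?_⟩
  · intro g k
    obtain ⟨m, rfl | rfl⟩ := k.eq_nat_or_neg
    · rw [zpow_natCast, natCast_zsmul, pow_eq]
    · rw [zpow_neg, zpow_natCast, inv_eq, neg_smul, natCast_zsmul, pow_eq]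
  · intro g w
    apply h.inj
    have e := bch_bch_neg (h.upper g) (h.upper w) (h.map_mul g w ▸ h.upper (g * w))
    rw [show n + 1 + (n + 1) = n + n + 1 + 1 by ring, Finset.sum_range_succ',
      Finset.sum_range_succ'] at e
    rw [h.map_zsmul, h.map_sub, h.map_sub, h.map_mul, h.map_mul, h.map_inv, e, h.map_lie',
      h.map_sum]
    simp only [Function.iterate_succ_apply, Function.iterate_zero, id, Nat.factorial_zero,
      zero_add, Nat.factorial_one, Nat.cast_one, inv_one, one_smul, add_sub_cancel_right,
      Finset.smul_sum]
    refine Finset.sum_congr rfl fun k hk => ?_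
    have hit : ∀ u, ρ ((fun u => ⁅g, u⁆)^[k] u) = (fun u => ⁅ρ g, u⁆)^[k] (ρ u) := fun u => by
      induction k generalizing u with
      | zero => rfl
      | succ k ih =>
        rw [Function.iterate_succ_apply, Function.iterate_succ_apply,
          ih (Finset.mem_range.2 (by have := Finset.mem_range.1 hk; omega)), h.map_lie']
    rw [h.map_zsmul, hit, h.map_lie', h.map_lie', ← Int.cast_smul_eq_zsmul ℚ,
      ← Int.cast_smul_eq_zsmul ℚ, smul_smul]
    congr 1
    push_cast
    rw [← hz' k hk]
    ring

end IsLRGroup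

end BCHRing

section LieRing

variable {G : Type*} [LieRing G] {D : ℤ}

/-- `T' ≤ T` are additive subgroups such that `[G, T] ⊆ D • T'`. -/
structure BracketsInto (D : ℤ) (T T' : AddSubgroup G) : Prop where
  le : T' ≤ T
  lie_mem : ∀ g : G, ∀ t ∈ T, ⁅g, t⁆ ∈ T'.map (zsmulAddGroupHom D)

namespace BracketsInto

variable {T T' : AddSubgroup G}

theorem map_le (T' : AddSubgroup G) (D : ℤ) : T'.map (zsmulAddGroupHom D) ≤ T' := by
  rintro _ ⟨t, ht, rfl⟩
  exact zsmul_mem ht D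

theorem lie_mem_map (hT : BracketsInto D T T') (g : G) {x : G}
    (hx : x ∈ T'.map (zsmulAddGroupHom D)) : ⁅g, x⁆ ∈ T'.map (zsmulAddGroupHom D) := by
  exact hT.lie_mem g x (hT.le (map_le _ _ hx))

theorem lieWord_mem (hT : BracketsInto D T T') {x y : G}
    (hxy : ⁅x, y⁆ ∈ T'.map (zsmulAddGroupHom D)) (w : List Bool) :
    lieWord x y w ∈ T'.map (zsmulAddGroupHom D) := by
  induction w with
  | nil => exact hxy
  | cons b w ih => exact hT.lie_mem_map _ ih

end BracketsInto

/-- The iterated bracket `[g₁, [g₂, … [g_k, x]]]`. -/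
def lieFold (gs : List G) (x : G) : G := gs.foldr (fun g u => ⁅g, u⁆) x

theorem lieFold_cons (g : G) (gs : List G) (x : G) : lieFold (g :: gs) x = ⁅g, lieFold gs x⁆ := rfl

/-- Additive span of the elements `D^a [g₁, … [g_k, x]]` with `x ∈ X`, `i ≤ k`, `e ≤ a + k`. -/
def scaledFolds (D : ℤ) (X : Set G) (e i : ℕ) : AddSubgroup G :=
  AddSubgroup.closure {u | ∃ (a : ℕ) (gs : List G), ∃ x ∈ X, i ≤ gs.length ∧ e ≤ a + gs.length ∧
    u = D ^ a • lieFold gs x}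

theorem mem_scaledFolds {X : Set G} {e i a : ℕ} {gs : List G} {x : G} (hx : x ∈ X)
    (hi : i ≤ gs.length) (he : e ≤ a + gs.length) :
    D ^ a • lieFold gs x ∈ scaledFolds D X e i :=
  AddSubgroup.subset_closure ⟨a, gs, x, hx, hi, he, rfl⟩

theorem scaledFolds_mono {X : Set G} {e e' i i' : ℕ} (he : e' ≤ e) (hi : i' ≤ i) :
    scaledFolds D X e i ≤ scaledFolds D X e' i' := by
  refine AddSubgroup.closure_mono ?_
  rintro _ ⟨a, gs, x, hx, h1, h2, rfl⟩
  exact ⟨a, gs, x, hx, hi.trans h1, he.trans h2, rfl⟩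

theorem lie_mem_scaledFolds {X : Set G} {e i : ℕ} (g : G) {t : G} (ht : t ∈ scaledFolds D X e i) :
    ⁅g, t⁆ ∈ scaledFolds D X (e + 1) (i + 1) := by
  induction ht using AddSubgroup.closure_induction with
  | mem t ht =>
    obtain ⟨a, gs, x, hx, h1, h2, rfl⟩ := ht
    rw [lie_zsmul, ← lieFold_cons]
    exact mem_scaledFolds hx (by simpa using h1) (by rw [List.length_cons]; omega)
  | zero => simp
  | add a b _ _ ha hb => rw [lie_add]; exact add_mem ha hb
  | neg a _ ha => rw [lie_neg]; exact neg_mem ha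

variable {n : ℕ}

theorem bracketsInto_scaledFolds (hnil : ∀ (gs : List G) x, n ≤ gs.length → lieFold gs x = 0)
    (X : Set G) {e : ℕ} (he : n ≤ e) (i : ℕ) :
    BracketsInto D (scaledFolds D X e i) (scaledFolds D X e (i + 1)) where
  le := scaledFolds_mono le_rfl (Nat.le_succ i)
  lie_mem g t ht := by
    induction ht using AddSubgroup.closure_induction with
    | mem t ht =>
      obtain ⟨a, gs, x, hx, h1, h2, rfl⟩ := ht
      cases a with
      | zero =>
        rw [hnil gs x (by omega), smul_zero, lie_zero]
        exact zero_mem _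
      | succ a =>
        refine ⟨D ^ a • lieFold (g :: gs) x,
          mem_scaledFolds hx (by simpa using h1) (by rw [List.length_cons]; omega), ?_⟩
        rw [zsmulAddGroupHom_apply, smul_smul, lie_zsmul, ← pow_succ', lieFold_cons]
    | zero => rw [lie_zero]; exact zero_mem _
    | add a b _ _ ha hb => rw [lie_add]; exact add_mem ha hb
    | neg a _ ha => rw [lie_neg]; exact neg_mem ha

theorem scaledFolds_eq_bot (hnil : ∀ (gs : List G) x, n ≤ gs.length → lieFold gs x = 0)
    (X : Set G) (e : ℕ) : scaledFolds D X e n = ⊥ := by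
  rw [scaledFolds, AddSubgroup.closure_eq_bot_iff]
  rintro _ ⟨a, gs, x, hx, h1, h2, rfl⟩
  rw [hnil gs x h1, smul_zero]
  rfl

end LieRing

section Comparison

variable {G : Type*} [Group G] [LieRing G] {D : ℤ} {s : Finset (List Bool)} {c : List Bool → ℤ}
  {K : ℕ} {c' : ℕ → ℤ} {n : ℕ}

namespace IsBCHRing

variable {T T' : AddSubgroup G}

theorem mem_of_zsmul_mem (h : IsBCHRing G D s c K c') {x : G}
    (hx : D • x ∈ T.map (zsmulAddGroupHom D)) : x ∈ T := by
  obtain ⟨t, ht, e⟩ := hx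
  have e' : D • (t - x) = 0 := by rw [smul_sub, sub_eq_zero]; exact e
  rwa [← sub_eq_zero.1 (h.torsionFree D _ h.D_ne_zero e')]

theorem mul_sub_sub_mem (h : IsBCHRing G D s c K c') (hT : BracketsInto D T T') {x y : G}
    (hxy : ⁅x, y⁆ ∈ T'.map (zsmulAddGroupHom D)) : x * y - x - y ∈ T' := by
  apply h.mem_of_zsmul_mem
  rw [h.mul_eq]
  exact sum_mem fun w _ => zsmul_mem (hT.lieWord_mem hxy w) _

theorem conj_sub_sub_mem (h : IsBCHRing G D s c K c') (hT : BracketsInto D T T') {g w : G}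
    (hw : ⁅g, ⁅g, w⁆⁆ ∈ T'.map (zsmulAddGroupHom D)) : g * w * g⁻¹ - w - ⁅g, w⁆ ∈ T' := by
  apply h.mem_of_zsmul_mem
  rw [h.conj_eq]
  refine sum_mem fun k hk => zsmul_mem ?_ _
  clear hk
  induction k with
  | zero => exact hw
  | succ k ih => rw [Function.iterate_succ_apply']; exact hT.lie_mem_map g ih

theorem inv_mul_mem_iff (h : IsBCHRing G D s c K c') (hT : BracketsInto D T T') {x y : G} :
    x⁻¹ * y ∈ T ↔ y - x ∈ T := by
  constructor
  · intro ht
    have e := h.mul_sub_sub_mem hT (hT.lie_mem x _ ht)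
    rw [mul_inv_cancel_left] at e
    simpa using add_mem (hT.le e) ht
  · intro ht
    have hl : ⁅x⁻¹, y⁆ ∈ T'.map (zsmulAddGroupHom D) := by
      have := neg_mem (hT.lie_mem x _ ht)
      rwa [lie_sub, lie_self, sub_zero, ← neg_lie, ← h.inv_eq] at this
    have e := h.mul_sub_sub_mem hT hl
    rw [h.inv_eq, sub_neg_eq_add, sub_eq_add_neg, add_assoc] at e
    rw [h.inv_eq]
    have := add_mem (hT.le e) ht
    convert this using 1
    abel

/-- An additive subgroup absorbing brackets, as a subgroup of the BCH group. -/
def toSubgroup (h : IsBCHRing G D s c K c') (hT : BracketsInto D T T') : Subgroup G where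
  carrier := T
  mul_mem' {a b} ha hb := by
    have := hT.le (h.mul_sub_sub_mem hT (hT.lie_mem a b hb))
    have e := add_mem this (add_mem ha hb)
    simpa using (by convert e using 1; abel : a * b ∈ T)
  one_mem' := by
    rw [h.one_eq]; exact T.zero_mem
  inv_mem' {a} ha := by
    rw [h.inv_eq]; exact T.neg_mem ha

theorem mem_toSubgroup (h : IsBCHRing G D s c K c') (hT : BracketsInto D T T') {x : G} :
    x ∈ h.toSubgroup hT ↔ x ∈ T := Iff.rfl

theorem normal_toSubgroup (h : IsBCHRing G D s c K c') (hT : BracketsInto D T T') :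
    (h.toSubgroup hT).Normal where
  conj_mem t ht g := by
    rw [mem_toSubgroup] at ht ⊢
    have h1 := hT.lie_mem g t ht
    have h2 := hT.le (h.conj_sub_sub_mem hT (hT.lie_mem_map g h1))
    have h3 := hT.le (BracketsInto.map_le _ _ h1)
    have := add_mem (add_mem h2 h3) ht
    convert this using 1
    abel

theorem index_toSubgroup (h : IsBCHRing G D s c K c') (hT : BracketsInto D T T') :
    (h.toSubgroup hT).index = T.index := by
  refine Nat.card_congr (Quotient.congr (Equiv.refl G) fun x y => ?_)
  change QuotientGroup.leftRel _ x y ↔ QuotientAddGroup.leftRel _ x y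
  rw [QuotientGroup.leftRel_apply, QuotientAddGroup.leftRel_apply, mem_toSubgroup,
    h.inv_mul_mem_iff hT, neg_add_eq_sub]

theorem relIndex_toSubgroup_le (h : IsBCHRing G D s c K c') (hT : BracketsInto D T T')
    {N : Subgroup G} {I : AddSubgroup G} (hNI : ∀ x ∈ N, x ∈ I) (hI : T.relIndex I ≠ 0) :
    (h.toSubgroup hT).relIndex N ≤ T.relIndex I := by
  have : Finite (I ⧸ T.addSubgroupOf I) := Nat.finite_of_card_ne_zero hI
  refine Nat.card_le_card_of_injective
    (Quotient.map' (fun x : N => (⟨x, hNI x x.2⟩ : I)) ?_) ?_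
  · intro x y hxy
    rw [QuotientGroup.leftRel_apply, Subgroup.mem_subgroupOf, mem_toSubgroup] at hxy
    rw [QuotientAddGroup.leftRel_apply, AddSubgroup.mem_addSubgroupOf]
    have := (h.inv_mul_mem_iff hT).1 hxy
    simpa [neg_add_eq_sub] using this
  · intro x y
    refine Quotient.inductionOn₂' x y fun x y hxy => ?_
    rw [Quotient.map'_mk'', Quotient.map'_mk'', Quotient.eq''] at hxy
    rw [Quotient.eq'', QuotientGroup.leftRel_apply, Subgroup.mem_subgroupOf, mem_toSubgroup]
    rw [QuotientAddGroup.leftRel_apply, AddSubgroup.mem_addSubgroupOf] at hxy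
    refine (h.inv_mul_mem_iff hT).2 ?_
    simpa [neg_add_eq_sub] using hxy

end IsBCHRing

namespace IsBCHRing

/-- Modulo deeper brackets, a highly divisible iterated bracket of elements of a normal subgroup
lies in that subgroup. -/
theorem exists_mem_normal_sub_mem (h : IsBCHRing G D s c K c')
    (hnil : ∀ (gs : List G) x, n ≤ gs.length → lieFold gs x = 0) (N : Subgroup G) [N.Normal]
    {x : G} (hx : x ∈ N) (gs : List G) (a e : ℕ) (he : n + gs.length ≤ e)
    (ha : e ≤ a + gs.length) :
    ∃ b ∈ N, D ^ a • lieFold gs x - b ∈ scaledFolds D (N : Set G) e (gs.length + 1) := by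
  induction gs generalizing e with
  | nil =>
    refine ⟨x ^ (D ^ a), zpow_mem hx _, ?_⟩
    rw [h.zpow_eq, lieFold, List.foldr_nil, sub_self]
    exact zero_mem _
  | cons g gs ih =>
    rw [List.length_cons] at he ha ⊢
    obtain ⟨e, rfl⟩ : ∃ e', e = e' + 1 := ⟨e - 1, by omega⟩
    obtain ⟨b, hb, hτ⟩ := ih e (by omega) (by omega)
    set i := gs.length
    have hb0 : b ∈ scaledFolds D (N : Set G) e i := by
      have h1 : D ^ a • lieFold gs x ∈ scaledFolds D (N : Set G) e i :=
        mem_scaledFolds hx le_rfl (by omega)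
      have := sub_mem h1 (scaledFolds_mono le_rfl (Nat.le_succ i) hτ)
      simpa using this
    have hB := bracketsInto_scaledFolds (D := D) hnil (N : Set G)
      (show n ≤ e + 1 by omega) (i + 1)
    have hgb := lie_mem_scaledFolds g hb0
    have hp := h.conj_sub_sub_mem hB (hB.lie_mem g _ hgb)
    set p := g * b * g⁻¹ with hpdef
    have hpN : p ∈ N := ‹N.Normal›.conj_mem b hb g
    have hq : p - b ∈ scaledFolds D (N : Set G) (e + 1) (i + 1) := by
      simpa using add_mem (hB.le hp) hgb
    have hpb : ⁅p, b⁻¹⁆ ∈ (scaledFolds D (N : Set G) (e + 1) (i + 1 + 1)).map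
        (zsmulAddGroupHom D) := by
      have := hB.lie_mem b _ hq
      rw [lie_sub, lie_self, sub_zero, ← lie_skew] at this
      rwa [h.inv_eq, lie_neg]
    have hr := h.mul_sub_sub_mem hB hpb
    refine ⟨p * b⁻¹, mul_mem hpN (inv_mem hb), ?_⟩
    have hgτ := lie_mem_scaledFolds g hτ
    have e1 : D ^ a • lieFold (g :: gs) x - p * b⁻¹ =
        ⁅g, D ^ a • lieFold gs x - b⁆ - (p - b - ⁅g, b⁆) - (p * b⁻¹ - p - b⁻¹) := by
      rw [lieFold_cons, lie_sub, lie_zsmul, h.inv_eq b]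
      abel
    rw [e1]
    exact sub_mem (sub_mem hgτ hp) hr

theorem mem_normal_of_mem_scaledFolds (h : IsBCHRing G D s c K c')
    (hnil : ∀ (gs : List G) x, n ≤ gs.length → lieFold gs x = 0) (N : Subgroup G) [N.Normal]
    {t : G} (ht : t ∈ scaledFolds D (N : Set G) (n + n) 0) : t ∈ N := by
  suffices H : ∀ k ≤ n, ∀ t ∈ scaledFolds D (N : Set G) (n + n) (n - k), t ∈ N by
    exact H n le_rfl t (by rwa [Nat.sub_self])
  intro k
  induction k with
  | zero =>
    intro _ t ht
    rw [Nat.sub_zero, scaledFolds_eq_bot hnil, AddSubgroup.mem_bot] at ht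
    rw [ht, ← h.one_eq]
    exact one_mem N
  | succ k ih =>
    intro hk t ht
    obtain ⟨i, hi⟩ : ∃ i, n - (k + 1) = i := ⟨_, rfl⟩
    have hi' : n - k = i + 1 := by omega
    rw [hi'] at ih
    rw [hi] at ht
    have ih := ih (by omega)
    have hB := bracketsInto_scaledFolds (D := D) hnil (N : Set G)
      (show n ≤ n + n by omega)
    have transfer : ∀ {x y}, x ∈ N → y - x ∈ scaledFolds D (N : Set G) (n + n) (i + 1) →
        y ∈ N := fun {x y} hx hxy => by
      have := ih _ ((h.inv_mul_mem_iff (hB (i + 1))).2 hxy)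
      simpa using mul_mem hx this
    induction ht using AddSubgroup.closure_induction with
    | mem t ht =>
      obtain ⟨a, gs, x, hx, h1, h2, rfl⟩ := ht
      rcases h1.eq_or_lt with h1 | h1
      · obtain ⟨b, hb, hb'⟩ := h.exists_mem_normal_sub_mem hnil N hx gs a (n + n) (by omega) h2
        rw [← h1] at hb'
        exact transfer hb hb'
      · exact ih _ (mem_scaledFolds hx h1 h2)
    | zero => rw [← h.one_eq]; exact one_mem N
    | add a b ha hb iha ihb =>
      refine transfer (mul_mem iha ihb) ?_
      have := neg_mem (h.mul_sub_sub_mem (hB i) ((hB i).lie_mem a b hb))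
      convert this using 1
      abel
    | neg a _ ha => rw [← h.inv_eq]; exact inv_mem ha

end IsBCHRing

end Comparison

section Index

theorem AddSubgroup.index_ne_zero_of_zsmul_mem {A : Type*} [AddCommGroup A] [Module.Finite ℤ A]
    (I : AddSubgroup A) {k : ℤ} (hk : k ≠ 0) (hI : ∀ x : A, k • x ∈ I) : I.index ≠ 0 := by
  have : Module.Finite ℤ (A ⧸ I) :=
    Module.Finite.of_surjective (QuotientAddGroup.mk' I).toIntLinearMap
      (QuotientAddGroup.mk'_surjective I)
  have : Finite (A ⧸ I) := by
    refine Module.finite_of_fg_torsion _ fun x => ?_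
    induction x using QuotientAddGroup.induction_on with
    | H x =>
      exact ⟨⟨k, mem_nonZeroDivisors_of_ne_zero hk⟩, (QuotientAddGroup.eq_zero_iff _).2 (hI x)⟩
  exact Nat.card_pos.ne'

theorem AddSubgroup.relIndex_of_zsmul_mem {A : Type*} [AddCommGroup A] [Module.Finite ℤ A]
    {I T : AddSubgroup A} (hI : I.index ≠ 0) {m : ℤ} (hm : m ≠ 0)
    (hinj : ∀ x : A, m • x = 0 → x = 0) (hT : I.map (zsmulAddGroupHom m) ≤ T) :
    T.relIndex I ≠ 0 ∧
      T.relIndex I ≤ ((⊤ : AddSubgroup A).map (zsmulAddGroupHom m)).index := by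
  have hle : I.map (zsmulAddGroupHom m) ≤ I := by
    rintro _ ⟨t, ht, rfl⟩
    exact zsmul_mem ht m
  have hf : Function.Injective (zsmulAddGroupHom m : A →+ A) :=
    (injective_iff_map_eq_zero _).2 hinj
  have h0 : ((⊤ : AddSubgroup A).map (zsmulAddGroupHom m)).index ≠ 0 :=
    AddSubgroup.index_ne_zero_of_zsmul_mem _ hm fun x => ⟨x, trivial, rfl⟩
  have e1 := AddSubgroup.relIndex_mul_index hle
  have e2 := AddSubgroup.relIndex_mul_index
    (AddSubgroup.map_mono (f := (zsmulAddGroupHom m : A →+ A)) (le_top (a := I)))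
  rw [AddSubgroup.relIndex_map_map_of_injective _ _ hf, AddSubgroup.relIndex_top_right, ← e1,
    mul_comm] at e2
  have e3 := Nat.eq_of_mul_eq_mul_right (Nat.pos_of_ne_zero hI) e2
  have h1 : (I.map (zsmulAddGroupHom m)).relIndex I ≠ 0 := e3 ▸ h0
  refine ⟨fun h => h1 ?_, ?_⟩
  · exact Nat.eq_zero_of_zero_dvd (h ▸ AddSubgroup.relIndex_dvd_of_le_left I hT)
  · rw [e3]
    exact AddSubgroup.relIndex_le_of_le_left hT h1

end Index

section LieRing

variable {G : Type*} [LieRing G] {D : ℤ}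

/-- The Lie ideal underlying an additive subgroup that absorbs brackets. -/
def BracketsInto.toLieIdeal {T T' : AddSubgroup G} (hT : BracketsInto D T T') : LieIdeal ℤ G where
  toSubmodule := T.toIntSubmodule
  lie_mem {g t} ht := hT.le (BracketsInto.map_le _ _ (hT.lie_mem g t ht))

theorem map_scaledFolds_le (D : ℤ) (X : Set G) (e : ℕ) :
    (scaledFolds D X 0 0).map (zsmulAddGroupHom (D ^ e)) ≤ scaledFolds D X e 0 := by
  rw [AddSubgroup.map_le_iff_le_comap, scaledFolds, AddSubgroup.closure_le]
  rintro _ ⟨a, gs, x, hx, -, -, rfl⟩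
  have := mem_scaledFolds (D := D) hx gs.length.zero_le (show e ≤ (e + a) + gs.length by omega)
  rwa [pow_add, mul_smul] at this

theorem subset_scaledFolds (D : ℤ) {X : Set G} {x : G} (hx : x ∈ X) : x ∈ scaledFolds D X 0 0 := by
  have := mem_scaledFolds (D := D) (a := 0) (gs := []) hx le_rfl le_rfl
  rwa [pow_zero, one_smul] at this

theorem scaledFolds_le_ideal (I : LieIdeal ℤ G) :
    scaledFolds D (I : Set G) 0 0 ≤ (LieSubmodule.toSubmodule I).toAddSubgroup := by
  rw [scaledFolds, AddSubgroup.closure_le]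
  rintro _ ⟨a, gs, x, hx, -, -, rfl⟩
  refine zsmul_mem ?_ _
  induction gs with
  | nil => exact hx
  | cons g gs ih => exact I.lie_mem ih

end LieRing

section Divisibility

variable {G : Type*} [Group G] [LieRing G] {D : ℤ} {s : Finset (List Bool)} {c : List Bool → ℤ}
  {K : ℕ} {c' : ℕ → ℤ} {n : ℕ}

namespace IsBCHRing

theorem pow_smul_eq_zero (h : IsBCHRing G D s c K c') (e : ℕ) {x : G} (hx : D ^ e • x = 0) :
    x = 0 :=
  h.torsionFree _ _ (pow_ne_zero e h.D_ne_zero) hx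

theorem exists_normal_index_le (h : IsBCHRing G D s c K c')
    (hnil : ∀ (gs : List G) x, n ≤ gs.length → lieFold gs x = 0) (I : LieIdeal ℤ G)
    (hI : idealIndex I ≠ 0) {v : G} (hv : v ∉ I) :
    ∃ N : Subgroup G, N.Normal ∧ v ∉ N ∧ N.index ≠ 0 ∧ N.index ≤
      ((⊤ : AddSubgroup G).map (zsmulAddGroupHom (D ^ (n + n)))).index * idealIndex I := by
  have := h.finite
  have hB := bracketsInto_scaledFolds (D := D) hnil (I : Set G) (show n ≤ n + n by omega) 0
  set A := (LieSubmodule.toSubmodule I).toAddSubgroup with hA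
  have hle : scaledFolds D (I : Set G) (n + n) 0 ≤ A :=
    (scaledFolds_mono (Nat.zero_le _) le_rfl).trans (scaledFolds_le_ideal I)
  have hmap : A.map (zsmulAddGroupHom (D ^ (n + n))) ≤ scaledFolds D (I : Set G) (n + n) 0 := by
    refine le_trans (AddSubgroup.map_mono ?_) (map_scaledFolds_le D _ _)
    exact fun x hx => subset_scaledFolds D hx
  obtain ⟨h0, h1⟩ := AddSubgroup.relIndex_of_zsmul_mem hI (pow_ne_zero (n + n) h.D_ne_zero)
    (fun x => h.pow_smul_eq_zero _) hmap
  have hidx := AddSubgroup.relIndex_mul_index hle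
  refine ⟨h.toSubgroup hB, h.normal_toSubgroup hB, fun hvT => hv (hle hvT), ?_, ?_⟩
  · rw [h.index_toSubgroup, ← hidx]
    exact mul_ne_zero h0 hI
  · rw [h.index_toSubgroup, ← hidx]
    exact Nat.mul_le_mul_right _ h1

theorem exists_ideal_index_le (h : IsBCHRing G D s c K c')
    (hnil : ∀ (gs : List G) x, n ≤ gs.length → lieFold gs x = 0) (N : Subgroup G)
    [N.Normal] (hN : N.index ≠ 0) {v : G} (hv : v ∉ N) :
    ∃ I : LieIdeal ℤ G, v ∉ I ∧ idealIndex I ≠ 0 ∧ idealIndex I ≤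
      ((⊤ : AddSubgroup G).map (zsmulAddGroupHom (D ^ (n + n)))).index * N.index := by
  have := h.finite
  have hB := bracketsInto_scaledFolds (D := D) hnil (N : Set G) (show n ≤ n + n by omega) 0
  have hTN : h.toSubgroup hB ≤ N := fun t ht => h.mem_normal_of_mem_scaledFolds hnil N ht
  have hA : (scaledFolds D (N : Set G) 0 0).index ≠ 0 := by
    refine AddSubgroup.index_ne_zero_of_zsmul_mem _ (Int.natCast_ne_zero.2 hN) fun x => ?_
    rw [← h.zpow_eq, zpow_natCast]
    exact subset_scaledFolds D (N.pow_index_mem x)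
  obtain ⟨h0, h1⟩ := AddSubgroup.relIndex_of_zsmul_mem hA (pow_ne_zero (n + n) h.D_ne_zero)
    (fun x => h.pow_smul_eq_zero _) (map_scaledFolds_le D _ _)
  have hidx := AddSubgroup.relIndex_mul_index
    (scaledFolds_mono (D := D) (X := (N : Set G)) (Nat.zero_le (n + n)) (le_refl 0))
  have hN' := Subgroup.relIndex_mul_index hTN
  rw [h.index_toSubgroup] at hN'
  refine ⟨hB.toLieIdeal, fun hvT => hv (hTN hvT), ?_, ?_⟩
  · change (scaledFolds D (N : Set G) (n + n) 0).index ≠ 0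
    rw [← hidx]
    exact mul_ne_zero h0 hA
  · change (scaledFolds D (N : Set G) (n + n) 0).index ≤ _
    rw [← hN']
    exact Nat.mul_le_mul_right _
      ((h.relIndex_toSubgroup_le hB (fun x hx => subset_scaledFolds D hx) h0).trans h1)

/-- The divisibility functions of the group and of the Lie ring agree up to a constant. -/
theorem exists_divP_le (h : IsBCHRing G D s c K c')
    (hnil : ∀ (gs : List G) x, n ≤ gs.length → lieFold gs x = 0) :
    ∃ C : ℕ, ∀ v : G, groupDivP {N : Subgroup G | N.Normal} v ≤ C * lieDivP Set.univ v ∧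
      lieDivP Set.univ v ≤ C * groupDivP {N : Subgroup G | N.Normal} v := by
  refine ⟨((⊤ : AddSubgroup G).map (zsmulAddGroupHom (D ^ (n + n)))).index, fun v => ⟨?_, ?_⟩⟩
  · by_cases hne : {k | ∃ I ∈ (Set.univ : Set (LieIdeal ℤ G)), v ∉ I ∧ idealIndex I = k ∧
        k ≠ 0}.Nonempty
    · obtain ⟨I, -, hv, hk, h0⟩ := Nat.sInf_mem hne
      rw [← hk] at h0
      obtain ⟨N, hN, hvN, h1, h2⟩ := h.exists_normal_index_le hnil I h0 hv
      rw [lieDivP, ← hk]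
      refine le_trans (Nat.sInf_le ?_) h2
      exact ⟨N, hN, hvN, rfl, h1⟩
    · refine le_of_eq_of_le (Nat.sInf_eq_zero.2 (Or.inr ?_)) (Nat.zero_le _)
      rw [Set.eq_empty_iff_forall_notMem]
      rintro k ⟨N, hN, hvN, rfl, h0⟩
      have : N.Normal := hN
      obtain ⟨I, hv, h1, -⟩ := h.exists_ideal_index_le hnil N h0 hvN
      exact hne ⟨_, I, trivial, hv, rfl, h1⟩
  · by_cases hne : {k | ∃ N ∈ {N : Subgroup G | N.Normal}, v ∉ N ∧ N.index = k ∧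
        k ≠ 0}.Nonempty
    · obtain ⟨N, hN, hv, hk, h0⟩ := Nat.sInf_mem hne
      have : N.Normal := hN
      rw [← hk] at h0
      obtain ⟨I, hvN, h1, h2⟩ := h.exists_ideal_index_le hnil N h0 hv
      rw [groupDivP, ← hk]
      refine le_trans (Nat.sInf_le ?_) h2
      exact ⟨I, trivial, hvN, rfl, h1⟩
    · refine le_of_eq_of_le (Nat.sInf_eq_zero.2 (Or.inr ?_)) (Nat.zero_le _)
      rw [Set.eq_empty_iff_forall_notMem]
      rintro k ⟨I, -, hvI, rfl, h0⟩
      obtain ⟨N, hN, hv, h1, -⟩ := h.exists_normal_index_le hnil I h0 hvI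
      exact hne ⟨_, N, hN, hv, rfl, h1⟩

end IsBCHRing

end Divisibility

noncomputable section GradedSequences

open Finset

variable {V : Type*} [LieRing V] [LieAlgebra ℝ V]

/-- A finite decreasing filtration of a Lie algebra indexed like Mathlib's lower central series. -/
structure IsBracketFiltration (Λ : ℕ → Submodule ℝ V) (c : ℕ) : Prop where
  zero_eq : Λ 0 = ⊤
  anti : Antitone Λ
  eq_bot : Λ c = ⊥
  lie_mem : ∀ {i j : ℕ} {x y : V}, x ∈ Λ i → y ∈ Λ j → ⁅x, y⁆ ∈ Λ (i + j + 1)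

/-- The bracket of formal sums, whose entry of index `i` has weight `i + 1`. -/
def gradedBracket (f g : ℕ → V) : ℕ → V
  | 0 => 0
  | k + 1 => ∑ p ∈ antidiagonal k, ⁅f p.1, g p.2⁆

/-- The analogue of `lieWord` for formal sums. -/
def gradedWord (f g : ℕ → V) : List Bool → ℕ → V
  | [] => gradedBracket f g
  | b :: w => gradedBracket (bif b then f else g) (gradedWord f g w)

/-- The product `x + y + ∑ q_w [x, y]_w`. -/
def wordMul (s : Finset (List Bool)) (q : List Bool → ℝ) (x y : V) : V :=
  x + y + ∑ w ∈ s, q w • lieWord x y w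

/-- The analogue of `wordMul` for formal sums. -/
def gradedMul (s : Finset (List Bool)) (q : List Bool → ℝ) (f g : ℕ → V) (k : ℕ) : V :=
  f k + g k + ∑ w ∈ s, q w • gradedWord f g w k

/-- `f` is a formal sum whose entries lie in the filtration. -/
def IsGradedSeq (Λ : ℕ → Submodule ℝ V) (f : ℕ → V) : Prop := ∀ i, f i ∈ Λ i

namespace IsGradedSeq

variable {Λ : ℕ → Submodule ℝ V} {c : ℕ} {f g : ℕ → V}

theorem eq_zero (hΛ : IsBracketFiltration Λ c) (hf : IsGradedSeq Λ f) {i : ℕ} (hi : c ≤ i) :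
    f i = 0 := by
  have := hΛ.anti hi (hf i)
  rwa [hΛ.eq_bot, Submodule.mem_bot] at this

theorem gradedBracket (hΛ : IsBracketFiltration Λ c) (hf : IsGradedSeq Λ f)
    (hg : IsGradedSeq Λ g) : IsGradedSeq Λ (gradedBracket f g) := by
  rintro (_ | k)
  · exact zero_mem _
  · refine sum_mem fun p hp => ?_
    rw [← mem_antidiagonal.1 hp]
    exact hΛ.lie_mem (hf _) (hg _)

theorem gradedWord (hΛ : IsBracketFiltration Λ c) (hf : IsGradedSeq Λ f)
    (hg : IsGradedSeq Λ g) (w : List Bool) : IsGradedSeq Λ (gradedWord f g w) := by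
  induction w with
  | nil => exact hf.gradedBracket hΛ hg
  | cons b w ih =>
    cases b
    · exact hg.gradedBracket hΛ ih
    · exact hf.gradedBracket hΛ ih

theorem gradedMul (hΛ : IsBracketFiltration Λ c) (hf : IsGradedSeq Λ f) (hg : IsGradedSeq Λ g)
    (s : Finset (List Bool)) (q : List Bool → ℝ) : IsGradedSeq Λ (gradedMul s q f g) := fun i =>
  add_mem (add_mem (hf i) (hg i)) <|
    sum_mem fun w _ => Submodule.smul_mem _ _ (hf.gradedWord hΛ hg w i)

theorem sum_range_eq (hΛ : IsBracketFiltration Λ c) (hf : IsGradedSeq Λ f) {m : ℕ} (hm : c ≤ m) :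
    ∑ i ∈ range m, f i = ∑ i ∈ range c, f i := by
  refine (sum_subset (range_mono hm) fun i _ hi => hf.eq_zero hΛ ?_).symm
  simpa using hi

theorem sum_gradedBracket (hΛ : IsBracketFiltration Λ c) (hf : IsGradedSeq Λ f)
    (hg : IsGradedSeq Λ g) : ∑ i ∈ range c, _root_.gradedBracket f g i =
      ⁅∑ i ∈ range c, f i, ∑ i ∈ range c, g i⁆ := by
  rw [← (hf.gradedBracket hΛ hg).sum_range_eq hΛ (show c ≤ c + c + 1 by omega), sum_range_succ',
    sum_lie_sum]
  refine (add_zero _).trans (sum_antidiagonal_eq_sum_range (fun i j => ⁅f i, g j⁆) c c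
    (fun i j hi => ?_) fun i j hj => ?_)
  · rw [hf.eq_zero hΛ hi, zero_lie]
  · rw [hg.eq_zero hΛ hj, lie_zero]

theorem sum_gradedWord (hΛ : IsBracketFiltration Λ c) (hf : IsGradedSeq Λ f)
    (hg : IsGradedSeq Λ g) (w : List Bool) : ∑ i ∈ range c, _root_.gradedWord f g w i =
      lieWord (∑ i ∈ range c, f i) (∑ i ∈ range c, g i) w := by
  induction w with
  | nil => exact hf.sum_gradedBracket hΛ hg
  | cons b w ih =>
    rw [lieWord, ← ih]
    cases b
    · exact hg.sum_gradedBracket hΛ (hf.gradedWord hΛ hg w)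
    · exact hf.sum_gradedBracket hΛ (hf.gradedWord hΛ hg w)

theorem sum_gradedMul (hΛ : IsBracketFiltration Λ c) (hf : IsGradedSeq Λ f)
    (hg : IsGradedSeq Λ g) (s : Finset (List Bool)) (q : List Bool → ℝ) :
    ∑ i ∈ range c, _root_.gradedMul s q f g i =
      wordMul s q (∑ i ∈ range c, f i) (∑ i ∈ range c, g i) := by
  simp only [_root_.gradedMul, wordMul, sum_add_distrib]
  rw [sum_comm]
  simp only [← smul_sum, hf.sum_gradedWord hΛ hg]

end IsGradedSeq

/-- The first `n` entries of `f` grow at most like `r ^ (i + e)`. -/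
def GrowthLT (N : Seminorm ℝ V) (r M : ℝ) (e n : ℕ) (f : ℕ → V) : Prop :=
  ∀ i < n, N (f i) ≤ M * r ^ (i + e)

theorem Seminorm.sum_le {V : Type*} [AddCommGroup V] [Module ℝ V] (N : Seminorm ℝ V)
    {ι : Type*} (s : Finset ι) (f : ι → V) :
    N (∑ i ∈ s, f i) ≤ ∑ i ∈ s, N (f i) :=
  le_sum_of_subadditive N (map_zero N).le (map_add_le_add N) s f

namespace GrowthLT

variable {N : Seminorm ℝ V} {r M M' B : ℝ} {e n : ℕ} {f g : ℕ → V}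

theorem gradedBracket {e₁ e₂ : ℕ} {M₁ M₂ : ℝ} (hB : 0 ≤ B)
    (hN : ∀ x y, N ⁅x, y⁆ ≤ B * N x * N y) (hr : 0 ≤ r) (h₁ : 0 ≤ M₁) (h₂ : 0 ≤ M₂)
    (hf : GrowthLT N r M₁ e₁ n f) (hg : GrowthLT N r M₂ e₂ n g) (he : e₁ + e₂ = e + 1) :
    GrowthLT N r (n * (B * M₁ * M₂)) e (n + 1) (gradedBracket f g) := by
  rintro (_ | k) hk
  · simp only [_root_.gradedBracket, map_zero]
    positivity
  · have hp : ∀ p ∈ antidiagonal k, N ⁅f p.1, g p.2⁆ ≤ B * M₁ * M₂ * r ^ (k + 1 + e) := by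
      intro p hp
      have hp := mem_antidiagonal.1 hp
      calc N ⁅f p.1, g p.2⁆ ≤ B * N (f p.1) * N (g p.2) := hN _ _
        _ ≤ B * (M₁ * r ^ (p.1 + e₁)) * (M₂ * r ^ (p.2 + e₂)) := by
            have h3 := hf p.1 (by omega)
            have h4 := hg p.2 (by omega)
            gcongr
        _ = B * M₁ * M₂ * r ^ ((p.1 + e₁) + (p.2 + e₂)) := by rw [pow_add]; ring
        _ = _ := by congr 2; omega
    have hk' : ((k + 1 : ℕ) : ℝ) ≤ n := by exact_mod_cast (by omega : k + 1 ≤ n)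
    calc N (_root_.gradedBracket f g (k + 1)) ≤ ∑ p ∈ antidiagonal k, N ⁅f p.1, g p.2⁆ :=
          N.sum_le _ _
      _ ≤ ∑ p ∈ antidiagonal k, B * M₁ * M₂ * r ^ (k + 1 + e) := sum_le_sum hp
      _ = (k + 1 : ℕ) * (B * M₁ * M₂ * r ^ (k + 1 + e)) := by
          rw [sum_const, Nat.card_antidiagonal, nsmul_eq_mul]
      _ ≤ n * (B * M₁ * M₂ * r ^ (k + 1 + e)) := by gcongr
      _ = _ := by ring

theorem mono {m : ℕ} (hf : GrowthLT N r M e n f) (hm : m ≤ n) : GrowthLT N r M e m f :=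
  fun i hi => hf i (hi.trans_le hm)

theorem weaken (hr : 1 ≤ r) (hM : 0 ≤ M) (hf : GrowthLT N r M 0 n f) : GrowthLT N r M 1 n f :=
  fun i hi => (hf i hi).trans <|
    mul_le_mul_of_nonneg_left (pow_le_pow_right₀ hr (by omega)) hM

end GrowthLT

/-- Iterated brackets starting from a bracket of growth exponent `e`. -/
theorem exists_growthLT_gradedWord (N : Seminorm ℝ V) {B : ℝ} (hB : 0 ≤ B)
    (hN : ∀ x y, N ⁅x, y⁆ ≤ B * N x * N y) (n : ℕ) {M₀ M₁ M₂ : ℝ} (h₀ : 0 ≤ M₀) (h₁ : 0 ≤ M₁)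
    (w : List Bool) :
    ∃ M, 0 ≤ M ∧ ∀ (r : ℝ) (e : ℕ) (f g : ℕ → V), 0 ≤ r → GrowthLT N r M₁ 1 n f →
      GrowthLT N r M₂ 1 n g → GrowthLT N r M₀ e (n + 1) (gradedBracket f g) →
      GrowthLT N r M e (n + 1) (gradedWord f g w) := by
  induction w with
  | nil => exact ⟨M₀, h₀, fun r e f g _ _ _ h => h⟩
  | cons b w ih =>
    obtain ⟨M, hM, ih⟩ := ih
    refine ⟨n * (B * max M₁ M₂ * M), by positivity, fun r e f g hr hf hg h => ?_⟩
    have hx : GrowthLT N r (max M₁ M₂) 1 n (bif b then f else g) := by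
      cases b
      · exact fun i hi => (hg i hi).trans
          (mul_le_mul_of_nonneg_right (le_max_right _ _) (by positivity))
      · exact fun i hi => (hf i hi).trans
          (mul_le_mul_of_nonneg_right (le_max_left _ _) (by positivity))
    exact hx.gradedBracket hB hN hr (by positivity) hM ((ih r e f g hr hf hg h).mono n.le_succ)
      (add_comm _ _)

theorem exists_growthLT_gradedWord_sum (N : Seminorm ℝ V) {B : ℝ} (hB : 0 ≤ B)
    (hN : ∀ x y, N ⁅x, y⁆ ≤ B * N x * N y) (n : ℕ) {M₀ M₁ M₂ : ℝ} (h₀ : 0 ≤ M₀) (h₁ : 0 ≤ M₁)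
    (s : Finset (List Bool)) (q : List Bool → ℝ) :
    ∃ M, 0 ≤ M ∧ ∀ (r : ℝ) (e : ℕ) (f g : ℕ → V), 0 ≤ r → GrowthLT N r M₁ 1 n f →
      GrowthLT N r M₂ 1 n g → GrowthLT N r M₀ e (n + 1) (gradedBracket f g) →
      GrowthLT N r M e (n + 1) (fun k => ∑ w ∈ s, q w • gradedWord f g w k) := by
  choose M hM H using exists_growthLT_gradedWord N hB hN n h₀ h₁ (M₂ := M₂)
  refine ⟨∑ w ∈ s, |q w| * M w, sum_nonneg fun w _ => mul_nonneg (abs_nonneg _) (hM w),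
    fun r e f g hr hf hg h i hi => (N.sum_le _ _).trans ?_⟩
  rw [sum_mul]
  refine sum_le_sum fun w _ => ?_
  rw [map_smul_eq_mul, Real.norm_eq_abs, mul_assoc]
  exact mul_le_mul_of_nonneg_left (H w r e f g hr hf hg h i hi) (abs_nonneg _)

/-- `v` is a sum of elements of the filtration with weighted size at most `r`. -/
def Ctrl (Λ : ℕ → Submodule ℝ V) (c : ℕ) (N : Seminorm ℝ V) (r : ℝ) (v : V) : Prop :=
  ∃ f : ℕ → V, IsGradedSeq Λ f ∧ (∀ i < c, N (f i) ≤ r ^ (i + 1)) ∧ ∑ i ∈ range c, f i = v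

namespace Ctrl

variable {Λ : ℕ → Submodule ℝ V} {c : ℕ} {N : Seminorm ℝ V}

theorem mono {r r' : ℝ} {v : V} (h : Ctrl Λ c N r v) (hr : 0 ≤ r) (hrr' : r ≤ r') :
    Ctrl Λ c N r' v := by
  obtain ⟨f, h1, h2, h3⟩ := h
  exact ⟨f, h1, fun i hi => (h2 i hi).trans (pow_le_pow_left₀ hr hrr' _), h3⟩

theorem neg {r : ℝ} {v : V} (h : Ctrl Λ c N r v) : Ctrl Λ c N r (-v) := by
  obtain ⟨f, h1, h2, h3⟩ := h
  refine ⟨fun i => -f i, fun i => neg_mem (h1 i), fun i hi => ?_, by rw [sum_neg_distrib, h3]⟩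
  rw [map_neg_eq_map]
  exact h2 i hi

theorem of_growthLT {f : ℕ → V} {r M : ℝ} (hr : 0 ≤ r) (hf : IsGradedSeq Λ f)
    (h : GrowthLT N r M 1 c f) : Ctrl Λ c N (max M 1 * r) (∑ i ∈ range c, f i) := by
  refine ⟨f, hf, fun i hi => (h i hi).trans ?_, rfl⟩
  rw [mul_pow]
  refine mul_le_mul_of_nonneg_right ?_ (by positivity)
  calc M ≤ max M 1 := le_max_left _ _
    _ = max M 1 ^ 1 := (pow_one _).symm
    _ ≤ max M 1 ^ (i + 1) := pow_le_pow_right₀ (le_max_right _ _) (by omega)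

end Ctrl

theorem exists_ctrl_wordMul {Λ : ℕ → Submodule ℝ V} {c : ℕ} (hΛ : IsBracketFiltration Λ c)
    (N : Seminorm ℝ V) {B : ℝ} (hB : 0 ≤ B) (hN : ∀ x y, N ⁅x, y⁆ ≤ B * N x * N y)
    (s : Finset (List Bool)) (q : List Bool → ℝ) :
    ∃ K : ℝ, 0 ≤ K ∧ ∀ (r : ℝ) (x y : V), 0 ≤ r → Ctrl Λ c N r x → Ctrl Λ c N r y →
      Ctrl Λ c N (K * r) (wordMul s q x y) := by
  obtain ⟨M, hM, H⟩ := exists_growthLT_gradedWord_sum N hB hN c (M₀ := c * (B * 1 * 1)) (M₁ := 1)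
    (M₂ := 1) (by positivity) zero_le_one s q
  refine ⟨max (1 + 1 + M) 1, by positivity, ?_⟩
  rintro r _ _ hr ⟨f, hf, hf', rfl⟩ ⟨g, hg, hg', rfl⟩
  rw [← hf.sum_gradedMul hΛ hg]
  refine Ctrl.of_growthLT hr (hf.gradedMul hΛ hg s q) fun i hi => ?_
  have hf1 : GrowthLT N r 1 1 c f := fun i hi => by simpa using hf' i hi
  have hg1 : GrowthLT N r 1 1 c g := fun i hi => by simpa using hg' i hi
  have := H r 1 f g hr hf1 hg1
    (hf1.gradedBracket hB hN hr zero_le_one zero_le_one hg1 rfl) i (by omega)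
  calc N (gradedMul s q f g i) ≤ N (f i) + N (g i) + N (∑ w ∈ s, q w • gradedWord f g w i) :=
        (map_add_le_add N _ _).trans (add_le_add_left (map_add_le_add N _ _) _)
    _ ≤ 1 * r ^ (i + 1) + 1 * r ^ (i + 1) + M * r ^ (i + 1) :=
        add_le_add (add_le_add (hf1 i hi) (hg1 i hi)) this
    _ = _ := by ring

/-- The formal sum of a product of elements of the Lie algebra. -/
def gradedProd (s : Finset (List Bool)) (q : List Bool → ℝ) (l : List V) : ℕ → V :=
  l.foldr (fun x F => gradedMul s q (Pi.single 0 x) F) 0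

theorem isGradedSeq_single {Λ : ℕ → Submodule ℝ V} {c : ℕ} (hΛ : IsBracketFiltration Λ c) (x : V) :
    IsGradedSeq Λ (Pi.single 0 x) := by
  rintro (_ | i)
  · rw [hΛ.zero_eq]; trivial
  · rw [Pi.single_eq_of_ne (Nat.succ_ne_zero i)]
    exact zero_mem _

theorem sum_single {Λ : ℕ → Submodule ℝ V} {c : ℕ} (hΛ : IsBracketFiltration Λ c) (x : V) :
    ∑ i ∈ range c, (Pi.single 0 x : ℕ → V) i = x := by
  rw [← (isGradedSeq_single hΛ x).sum_range_eq hΛ c.le_succ, sum_range_succ']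
  simp

theorem isGradedSeq_gradedProd {Λ : ℕ → Submodule ℝ V} {c : ℕ} (hΛ : IsBracketFiltration Λ c)
    (s : Finset (List Bool)) (q : List Bool → ℝ) (l : List V) :
    IsGradedSeq Λ (gradedProd s q l) := by
  induction l with
  | nil => exact fun i => zero_mem _
  | cons x l ih => exact (isGradedSeq_single hΛ x).gradedMul hΛ ih s q

theorem sum_gradedProd {Λ : ℕ → Submodule ℝ V} {c : ℕ} (hΛ : IsBracketFiltration Λ c)
    (s : Finset (List Bool)) (q : List Bool → ℝ) (l : List V) :
    ∑ i ∈ range c, gradedProd s q l i = l.foldr (wordMul s q) 0 := by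
  induction l with
  | nil => exact sum_const_zero
  | cons x l ih =>
    rw [List.foldr_cons, ← ih]
    refine ((isGradedSeq_single hΛ x).sum_gradedMul hΛ (isGradedSeq_gradedProd hΛ s q l) s
      q).trans ?_
    rw [sum_single hΛ]

/-- The entry of index `i` of a product of `k` elements of bounded size is `O(k ^ (i + 1))`. -/
theorem exists_growthLT_gradedProd (N : Seminorm ℝ V) {B : ℝ} (hB : 0 ≤ B)
    (hN : ∀ x y, N ⁅x, y⁆ ≤ B * N x * N y) (s : Finset (List Bool)) (q : List Bool → ℝ)
    {M₁ : ℝ} (h₁ : 0 ≤ M₁) (n : ℕ) :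
    ∃ M : ℝ, 0 ≤ M ∧ ∀ l : List V, (∀ x ∈ l, N x ≤ M₁) →
      GrowthLT N l.length M 1 n (gradedProd s q l) := by
  induction n with
  | zero => exact ⟨0, le_rfl, fun l _ i hi => absurd hi (Nat.not_lt_zero i)⟩
  | succ n ih =>
    obtain ⟨M, hM, ih⟩ := ih
    obtain ⟨M', hM', H⟩ := exists_growthLT_gradedWord_sum N hB hN n (M₀ := n * (B * M₁ * M))
      (by positivity) h₁ (M₂ := M) s q
    have key : ∀ l : List V, (∀ x ∈ l, N x ≤ M₁) →
        N (gradedProd s q l n) ≤ (M₁ + M') * (l.length : ℝ) ^ (n + 1) := by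
      intro l
      induction l with
      | nil => intro _; simp [gradedProd]
      | cons x l ihl =>
        intro hl
        have hl' : ∀ y ∈ l, N y ≤ M₁ := fun y hy => hl y (List.mem_cons_of_mem _ hy)
        have hL : (0 : ℝ) ≤ l.length := Nat.cast_nonneg _
        have hL1 : (1 : ℝ) ≤ l.length + 1 := by linarith
        have hx : ∀ m, GrowthLT N (l.length + 1) M₁ 0 m (Pi.single 0 x) := by
          rintro m (_ | i) _
          · simpa using hl x List.mem_cons_self
          · rw [Pi.single_eq_of_ne (Nat.succ_ne_zero i), map_zero]
            positivity
        have hF : GrowthLT N (l.length + 1) M 1 n (gradedProd s q l) := fun i hi =>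
          (ih l hl' i hi).trans <| by gcongr; linarith
        have hw := H (l.length + 1) 0 _ _ (by positivity) ((hx n).weaken hL1 h₁) hF
          ((hx n).gradedBracket hB hN (by positivity) h₁ hM hF rfl) n (by omega)
        have hx' := hx (n + 1) n (by omega)
        rw [add_zero] at hw hx'
        have hmul : (l.length : ℝ) ^ (n + 1) ≤ l.length * (l.length + 1) ^ n := by
          rw [pow_succ']
          gcongr
          linarith
        calc N (gradedProd s q (x :: l) n)
            ≤ N ((Pi.single 0 x : ℕ → V) n) + N (gradedProd s q l n) +
              N (∑ w ∈ s, q w • gradedWord (Pi.single 0 x) (gradedProd s q l) w n) :=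
              (map_add_le_add N _ _).trans (add_le_add_left (map_add_le_add N _ _) _)
          _ ≤ M₁ * (l.length + 1) ^ n + (M₁ + M') * (l.length : ℝ) ^ (n + 1) +
              M' * (l.length + 1) ^ n := add_le_add (add_le_add hx' (ihl hl')) hw
          _ ≤ M₁ * (l.length + 1) ^ n + (M₁ + M') * (l.length * (l.length + 1) ^ n) +
              M' * (l.length + 1) ^ n := by gcongr
          _ = (M₁ + M') * ((x :: l).length : ℝ) ^ (n + 1) := by
              push_cast [List.length_cons]; ring
    refine ⟨max M (M₁ + M'), by positivity, fun l hl i hi => ?_⟩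
    rcases Nat.lt_succ_iff_lt_or_eq.1 hi with hi | rfl
    · exact (ih l hl i hi).trans (by gcongr; exact le_max_left _ _)
    · exact (key l hl).trans (by gcongr; exact le_max_right _ _)

end GradedSequences

section WordNorm

variable {G : Type*} [Group G] {S : Set G}

theorem wordNorm_le {l : List G} (hl : ∀ x ∈ l, x ∈ S ∨ x⁻¹ ∈ S) : wordNorm S l.prod ≤ l.length :=
  Nat.sInf_le ⟨l, rfl, hl, rfl⟩

theorem wordNorm_one : wordNorm S (1 : G) = 0 :=
  Nat.le_zero.1 (wordNorm_le (S := S) (l := []) (by simp))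

theorem exists_list_length_eq_wordNorm (hS : Subgroup.closure S = ⊤) (g : G) :
    ∃ l : List G, l.length = wordNorm S g ∧ (∀ x ∈ l, x ∈ S ∨ x⁻¹ ∈ S) ∧ l.prod = g := by
  have hg : g ∈ Subgroup.closure S := by rw [hS]; trivial
  rw [← Subgroup.mem_toSubmonoid, Subgroup.closure_toSubmonoid] at hg
  obtain ⟨l, hl, hg⟩ := Submonoid.exists_list_of_mem_closure hg
  exact Nat.sInf_mem (s := {k | ∃ l : List G, l.length = k ∧ (∀ x ∈ l, x ∈ S ∨ x⁻¹ ∈ S) ∧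
    l.prod = g}) ⟨l.length, l, rfl, hl, hg⟩

theorem wordNorm_mul_le (hS : Subgroup.closure S = ⊤) (g h : G) :
    wordNorm S (g * h) ≤ wordNorm S g + wordNorm S h := by
  obtain ⟨l, h1, h2, h3⟩ := exists_list_length_eq_wordNorm hS g
  obtain ⟨m, h4, h5, h6⟩ := exists_list_length_eq_wordNorm hS h
  rw [← h1, ← h4, ← List.length_append, ← h3, ← h6, ← List.prod_append]
  refine wordNorm_le fun x hx => ?_
  exact (List.mem_append.1 hx).elim (h2 x) (h5 x)

theorem wordNorm_inv_le (hS : Subgroup.closure S = ⊤) (g : G) : wordNorm S g⁻¹ ≤ wordNorm S g := by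
  obtain ⟨l, h1, h2, h3⟩ := exists_list_length_eq_wordNorm hS g
  rw [← h1, ← h3, List.prod_inv_reverse, ← List.length_map (f := fun x : G => x⁻¹),
    ← List.length_reverse]
  refine wordNorm_le fun x hx => ?_
  obtain ⟨y, hy, rfl⟩ := List.mem_map.1 (List.mem_reverse.1 hx)
  rw [inv_inv]
  exact (h2 y hy).symm

theorem wordNorm_pow_le (hS : Subgroup.closure S = ⊤) (g : G) (k : ℕ) :
    wordNorm S (g ^ k) ≤ k * wordNorm S g := by
  induction k with
  | zero => simp [wordNorm_one]
  | succ k ih =>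
    rw [pow_succ, Nat.succ_mul]
    exact (wordNorm_mul_le hS _ _).trans (Nat.add_le_add_right ih _)

theorem wordNorm_zpow_le (hS : Subgroup.closure S = ⊤) (g : G) (k : ℤ) :
    wordNorm S (g ^ k) ≤ k.natAbs * wordNorm S g := by
  obtain h | h := Int.natAbs_eq k
  · conv_lhs => rw [h]
    rw [zpow_natCast]
    exact wordNorm_pow_le hS g _
  · conv_lhs => rw [h]
    rw [zpow_neg, zpow_natCast]
    exact (wordNorm_inv_le hS _).trans (wordNorm_pow_le hS g _)

theorem wordNorm_zpow_le_real (hS : Subgroup.closure S = ⊤) (g : G) {k : ℤ} {r : ℝ}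
    (hk : |(k : ℝ)| ≤ r) :
    (wordNorm S (g ^ k) : ℝ) ≤ r * wordNorm S g := by
  calc (wordNorm S (g ^ k) : ℝ) ≤ ((k.natAbs * wordNorm S g : ℕ) : ℝ) := by
        exact_mod_cast wordNorm_zpow_le hS g k
    _ = |(k : ℝ)| * wordNorm S g := by rw [Nat.cast_mul, Nat.cast_natAbs, Int.cast_abs]
    _ ≤ _ := by gcongr

theorem wordNorm_mul_le_real (hS : Subgroup.closure S = ⊤) (g h : G) :
    (wordNorm S (g * h) : ℝ) ≤ wordNorm S g + wordNorm S h := by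
  exact_mod_cast wordNorm_mul_le hS g h

theorem wordNorm_inv_le_real (hS : Subgroup.closure S = ⊤) (g : G) :
    (wordNorm S g⁻¹ : ℝ) ≤ wordNorm S g := by
  exact_mod_cast wordNorm_inv_le hS g

theorem wordNorm_eq_zero_iff (hS : Subgroup.closure S = ⊤) {g : G} : wordNorm S g = 0 ↔ g = 1 := by
  refine ⟨fun h => ?_, fun h => h ▸ wordNorm_one⟩
  obtain ⟨l, h1, -, h3⟩ := exists_list_length_eq_wordNorm hS g
  rw [h, List.length_eq_zero_iff] at h1
  rw [← h3, h1, List.prod_nil]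

theorem finite_wordNorm_le (hS : Subgroup.closure S = ⊤) (hf : S.Finite) (k : ℕ) :
    {g : G | wordNorm S g ≤ k}.Finite := by
  have hT : (S ∪ S⁻¹).Finite := hf.union hf.inv
  have : Finite ↥(S ∪ S⁻¹) := hT
  refine ((List.finite_length_le ↥(S ∪ S⁻¹) k).image fun l => (l.map (↑)).prod).subset ?_
  intro g hg
  obtain ⟨l, h1, h2, h3⟩ := exists_list_length_eq_wordNorm hS g
  lift l to List ↥(S ∪ S⁻¹) using h2
  rw [List.length_map] at h1
  exact ⟨l, h1.trans_le hg, h3⟩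

end WordNorm

section RealForm

variable {G V : Type*} [LieRing G] [LieRing V] [LieAlgebra ℝ V]

/-- `ι` realizes the Lie ring `G` as a lattice in the filtered real Lie algebra `V`. -/
structure IsRealForm (ι : G →+ V) (Λ : ℕ → Submodule ℝ V) (c : ℕ) (N : Seminorm ℝ V) (B : ℝ) :
    Prop where
  filtration : IsBracketFiltration Λ c
  map_lie : ∀ x y, ι ⁅x, y⁆ = ⁅ι x, ι y⁆
  le_span : ∀ i, Λ (i + 1) ≤ Submodule.span ℝ {u | ∃ x y : G, ι y ∈ Λ i ∧ ι ⁅x, y⁆ = u}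
  exists_zsmul_mem : ∀ (R : AddSubgroup G) (e : G), ι e ∈ Submodule.span ℝ (ι '' R) →
    ∃ m : ℤ, m ≠ 0 ∧ m • e ∈ R
  exists_functional : ∀ (H : AddSubgroup G) (ζ : H →+ ℝ),
    ∃ φ : V →ₗ[ℝ] ℝ, ∀ x : H, φ (ι x) = ζ x
  functional_le : ∀ φ : V →ₗ[ℝ] ℝ, ∃ K, 0 ≤ K ∧ ∀ x, |φ x| ≤ K * N x
  nonneg : 0 ≤ B
  norm_lie_le : ∀ x y, N ⁅x, y⁆ ≤ B * N x * N y

namespace IsRealForm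

variable {ι : G →+ V} {Λ : ℕ → Submodule ℝ V} {c : ℕ} {N : Seminorm ℝ V} {B : ℝ}

theorem injective (h : IsRealForm ι Λ c N B) (ht : ∀ (m : ℤ) (g : G), m ≠ 0 → m • g = 0 → g = 0) :
    Function.Injective ι := by
  refine (injective_iff_map_eq_zero ι).2 fun e he => ?_
  obtain ⟨m, hm, hme⟩ := h.exists_zsmul_mem ⊥ e (by rw [he]; exact zero_mem _)
  exact ht m e hm hme

/-- Coordinates on a graded piece of the lattice, bounded by the norm of any representative. -/
theorem exists_coordinates [Module.Finite ℤ G] (h : IsRealForm ι Λ c N B) (i : ℕ) :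
    ∃ (m : ℕ) (e : Fin m → G) (K : ℝ), 0 ≤ K ∧ (∀ j, ι (e j) ∈ Λ i) ∧ ∀ v, ι v ∈ Λ i →
      ∃ z : Fin m → ℤ, ι v - ∑ j, z j • ι (e j) ∈ Λ (i + 1) ∧
        ∀ u, ι v - u ∈ Λ (i + 1) → ∀ j, |(z j : ℝ)| ≤ K * N u := by
  let H : AddSubgroup G := (Λ i).toAddSubgroup.comap ι
  let π : H →ₗ[ℤ] V ⧸ Λ (i + 1) :=
    ((Λ (i + 1)).mkQ.toAddMonoidHom.comp (ι.comp H.subtype)).toIntLinearMap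
  have hπ : ∀ x : H, π x = (Λ (i + 1)).mkQ (ι x) := fun x => rfl
  have : Module.Finite ℤ H := inferInstanceAs (Module.Finite ℤ H.toIntSubmodule)
  have : Module.IsTorsionFree ℤ (V ⧸ Λ (i + 1)) := Module.IsTorsionFree.trans ℝ
  have : Module.Free ℤ (LinearMap.range π) := inferInstance
  let b := Module.finBasis ℤ (LinearMap.range π)
  have he : ∀ j, ∃ x : H, π x = b j := fun j => (b j).2
  choose e he using he
  let ζ : ∀ j, H →+ ℝ := fun j =>
    (Int.castAddHom ℝ).comp ((b.coord j).comp π.rangeRestrict).toAddMonoidHom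
  have hζ : ∀ j x, ζ j x = (b.repr (π.rangeRestrict x) j : ℤ) := fun j x => rfl
  choose φ hφ using fun j => h.exists_functional H (ζ j)
  choose K hK hKle using fun j => h.functional_le (φ j)
  have hker : ∀ j, ∀ x ∈ Λ (i + 1), φ j x = 0 := by
    intro j x hx
    replace hx := h.le_span i hx
    induction hx using Submodule.span_induction with
    | mem u hu =>
      obtain ⟨x, y, hy, rfl⟩ := hu
      have hm : ι ⁅x, y⁆ ∈ Λ (i + 1) := by
        rw [h.map_lie, ← Nat.zero_add i]
        exact h.filtration.lie_mem (by rw [h.filtration.zero_eq]; trivial) hy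
      have hH : ⁅x, y⁆ ∈ H := h.filtration.anti i.le_succ hm
      have h0 : π.rangeRestrict ⟨_, hH⟩ = 0 :=
        Subtype.ext ((Submodule.Quotient.mk_eq_zero _).2 hm)
      rw [hφ j ⟨_, hH⟩, hζ, h0]
      simp
    | zero => exact map_zero _
    | add x y _ _ hx' hy' => rw [map_add, hx', hy', add_zero]
    | smul a x _ hx' => rw [map_smul, hx', smul_zero]
  refine ⟨_, fun j => e j, ∑ j, K j, Finset.sum_nonneg fun j _ => hK j, fun j => (e j).2,
    fun v hv => ⟨fun j => b.repr (π.rangeRestrict ⟨v, hv⟩) j, ?_, fun u hu j => ?_⟩⟩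
  · have hs := congrArg Subtype.val (b.sum_repr (π.rangeRestrict ⟨v, hv⟩))
    rw [← Submodule.Quotient.mk_eq_zero, ← Submodule.mkQ_apply, map_sub, sub_eq_zero, map_sum]
    refine Eq.trans hs.symm ?_
    rw [AddSubmonoidClass.coe_finsetSum]
    refine Finset.sum_congr rfl fun j _ => ?_
    rw [map_zsmul, ← hπ, he]
    rfl
  · have e1 : φ j (ι v) = φ j u := by
      rw [← sub_eq_zero, ← map_sub]
      exact hker j _ hu
    rw [← hζ, ← hφ j ⟨v, hv⟩, e1]
    refine (hKle j u).trans (mul_le_mul_of_nonneg_right ?_ (apply_nonneg N u))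
    exact Finset.single_le_sum (fun j _ => hK j) (Finset.mem_univ j)

end IsRealForm

end RealForm

/-- Integer division of `z` by `m`, with real bounds. -/
theorem Int.exists_eq_mul_add_abs_le (z : ℤ) {m : ℤ} (hm : m ≠ 0) :
    ∃ a t : ℤ, z = a * m + t ∧ |(a : ℝ)| * |(m : ℝ)| ≤ |(z : ℝ)| ∧ |(t : ℝ)| ≤ |(m : ℝ)| := by
  refine ⟨Int.tdiv z m, Int.tmod z m, (Int.tdiv_mul_add_tmod z m).symm, ?_, ?_⟩
  · rw [← abs_mul]
    exact_mod_cast (by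
      rw [Int.abs_eq_natAbs, Int.abs_eq_natAbs, Int.natAbs_mul, Int.natAbs_tdiv]
      exact_mod_cast Nat.div_mul_le_self _ _ : |Int.tdiv z m * m| ≤ |z|)
  · exact_mod_cast (by
      rw [Int.abs_eq_natAbs, Int.abs_eq_natAbs, Int.natAbs_tmod]
      exact_mod_cast (Nat.mod_lt _ (Int.natAbs_pos.2 hm)).le : |Int.tmod z m| ≤ |m|)

section Reach

variable {G V : Type*} [Group G] [LieRing G] [LieRing V] [LieAlgebra ℝ V]
  {D : ℤ} {s : Finset (List Bool)} {q : List Bool → ℤ} {K : ℕ} {q' : ℕ → ℤ}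
  {ι : G →+ V} {Λ : ℕ → Submodule ℝ V} {c : ℕ} {N : Seminorm ℝ V} {B : ℝ} {S : Set G}

theorem IsBracketFiltration.lie_mem_succ {V : Type*} [LieRing V] [LieAlgebra ℝ V]
    {Λ : ℕ → Submodule ℝ V} {c : ℕ} (h : IsBracketFiltration Λ c) {i : ℕ} (x : V) {y : V}
    (hy : y ∈ Λ i) : ⁅x, y⁆ ∈ Λ (i + 1) := by
  rw [← Nat.zero_add i]
  exact h.lie_mem (by rw [h.zero_eq]; trivial) hy

theorem IsRealForm.mem_of_sub_mem {G V : Type*} [LieRing G] [LieRing V] [LieAlgebra ℝ V]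
    {ι : G →+ V}
    {Λ : ℕ → Submodule ℝ V} {c : ℕ} {N : Seminorm ℝ V} {B : ℝ} {i : ℕ}
    (hr : IsRealForm ι Λ c N B) {h e : G} {z : ℤ} (he : ι e ∈ Λ i)
    (hh : ι h - z • ι e ∈ Λ (i + 1)) : ι h ∈ Λ i := by
  have := add_mem (hr.filtration.anti i.le_succ hh) (zsmul_mem he z)
  simpa using this

namespace IsBCHRing

theorem map_mul (h : IsBCHRing G D s q K q') (hr : IsRealForm ι Λ c N B) (x y : G) :
    ι (x * y) = wordMul s (fun w => (q w : ℝ) / D) (ι x) (ι y) := by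
  have hD : (D : ℝ) ≠ 0 := Int.cast_ne_zero.2 h.D_ne_zero
  have e := congrArg ι (h.mul_eq x y)
  simp only [map_zsmul, map_sub, map_sum, map_lieWord _ hr.map_lie] at e
  have e1 : ι (x * y) - ι x - ι y = ∑ w ∈ s, ((q w : ℝ) / D) • lieWord (ι x) (ι y) w := by
    rw [← inv_smul_smul₀ hD (ι (x * y) - ι x - ι y), Int.cast_smul_eq_zsmul, e, Finset.smul_sum]
    refine Finset.sum_congr rfl fun w _ => ?_
    rw [← Int.cast_smul_eq_zsmul ℝ, smul_smul, inv_mul_eq_div]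
  rw [wordMul, ← e1]
  abel

theorem map_mul_sub_mem (h : IsBCHRing G D s q K q') (hr : IsRealForm ι Λ c N B) {x y : G} {i : ℕ}
    (hxy : ⁅ι x, ι y⁆ ∈ Λ i) : ι (x * y) - ι x - ι y ∈ Λ i := by
  have hw : ∀ w, lieWord (ι x) (ι y) w ∈ Λ i := by
    intro w
    induction w with
    | nil => exact hxy
    | cons b w ih => exact hr.filtration.anti i.le_succ (hr.filtration.lie_mem_succ _ ih)
  rw [h.map_mul hr, wordMul]
  have : ∑ w ∈ s, ((q w : ℝ) / D) • lieWord (ι x) (ι y) w ∈ Λ i :=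
    sum_mem fun w _ => Submodule.smul_mem _ _ (hw w)
  convert this using 1
  abel

theorem map_inv {V : Type*} [AddCommGroup V] (h : IsBCHRing G D s q K q') (ι : G →+ V) (x : G) :
    ι x⁻¹ = -ι x := by
  rw [h.inv_eq, _root_.map_neg]

theorem map_conj_sub_mem (h : IsBCHRing G D s q K q') (hr : IsRealForm ι Λ c N B) {g w : G} {i : ℕ}
    (hw : ι w ∈ Λ i) : ι (g * w * g⁻¹) - ι w - ⁅ι g, ι w⁆ ∈ Λ (i + 2) := by
  have hD : (D : ℝ) ≠ 0 := Int.cast_ne_zero.2 h.D_ne_zero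
  have hk : ∀ k, ι ((fun u => ⁅g, u⁆)^[k] ⁅g, ⁅g, w⁆⁆) ∈ Λ (i + 2) := by
    intro k
    induction k with
    | zero =>
      rw [Function.iterate_zero, id_eq, hr.map_lie, hr.map_lie]
      exact hr.filtration.lie_mem_succ _ (hr.filtration.lie_mem_succ _ hw)
    | succ k ih =>
      rw [Function.iterate_succ_apply', hr.map_lie]
      exact hr.filtration.anti (Nat.le_succ _) (hr.filtration.lie_mem_succ _ ih)
  have e := congrArg ι (h.conj_eq g w)
  simp only [map_zsmul, map_sub, map_sum, hr.map_lie g w] at e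
  rw [← Submodule.smul_mem_iff _ hD, Int.cast_smul_eq_zsmul, e]
  exact sum_mem fun k _ => zsmul_mem (hk k) _

theorem map_commutator_sub_mem (h : IsBCHRing G D s q K q') (hr : IsRealForm ι Λ c N B) {x y : G}
    {i : ℕ} (hy : ι y ∈ Λ i) : ι (x * y * x⁻¹ * y⁻¹) - ⁅ι x, ι y⁆ ∈ Λ (i + 2) := by
  have h1 := h.map_conj_sub_mem hr (g := x) hy
  have h2 : ι (x * y * x⁻¹) - ι y ∈ Λ (i + 1) := by
    have := add_mem (hr.filtration.anti (Nat.le_succ _) h1) (hr.filtration.lie_mem_succ (ι x) hy)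
    simpa using this
  have h3 : ⁅ι (x * y * x⁻¹), ι y⁻¹⁆ ∈ Λ (i + 2) := by
    have := hr.filtration.anti (show i + 2 ≤ i + 1 + i + 1 by omega)
      (hr.filtration.lie_mem h2 hy)
    rw [sub_lie, lie_self, sub_zero] at this
    rw [h.map_inv, lie_neg]
    exact neg_mem this
  have h4 := add_mem (h.map_mul_sub_mem hr h3) h1
  rw [h.map_inv ι y] at h4
  convert h4 using 1
  abel

end IsBCHRing

/-- Multiples of `e` of size `O(R ^ (i + 1))` are represented, modulo the next step of the
filtration, by group elements of word norm `O(R)`. -/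
def Reach (ι : G →+ V) (Λ : ℕ → Submodule ℝ V) (S : Set G) (i : ℕ) (e : G) : Prop :=
  ∀ K : ℝ, 0 ≤ K → ∃ K' : ℝ, 0 ≤ K' ∧ ∀ (R : ℝ) (z : ℤ), 1 ≤ R → |(z : ℝ)| ≤ K * R ^ (i + 1) →
    ∃ h : G, (wordNorm S h : ℝ) ≤ K' * R ∧ ι h - z • ι e ∈ Λ (i + 1)

namespace Reach

variable {i : ℕ}

theorem of_zero (hb : IsBCHRing G D s q K q') (ι : G →+ V) (Λ : ℕ → Submodule ℝ V)
    (hS : Subgroup.closure S = ⊤) (e : G) : Reach ι Λ S 0 e := by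
  refine fun K hK => ⟨K * wordNorm S e, by positivity, fun R z hR hz => ⟨e ^ z, ?_, ?_⟩⟩
  · refine (wordNorm_zpow_le_real hS e hz).trans (le_of_eq ?_)
    ring
  · rw [hb.zpow_eq, map_zsmul, sub_self]
    exact zero_mem _

theorem map_mul_sub_add_mem (hb : IsBCHRing G D s q K q') (hr : IsRealForm ι Λ c N B) {x y : G}
    {a b : V} (hb' : b ∈ Λ i) (hx : ι x - a ∈ Λ (i + 1)) (hy : ι y - b ∈ Λ (i + 1)) :
    ι (x * y) - (a + b) ∈ Λ (i + 1) := by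
  have hy' : ι y ∈ Λ i := by
    have := add_mem (hr.filtration.anti i.le_succ hy) hb'
    simpa using this
  have := add_mem (add_mem (hb.map_mul_sub_mem hr (hr.filtration.lie_mem_succ (ι x) hy')) hx) hy
  convert this using 1
  abel

theorem zero (hb : IsBCHRing G D s q K q') (ι : G →+ V) (Λ : ℕ → Submodule ℝ V) (S : Set G)
    (i : ℕ) : Reach ι Λ S i 0 := by
  refine fun K hK => ⟨0, le_rfl, fun R z hR hz => ⟨1, ?_, ?_⟩⟩
  · rw [wordNorm_one, Nat.cast_zero, zero_mul]
  · rw [hb.one_eq, map_zero, smul_zero, sub_zero]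
    exact zero_mem _

theorem neg {e : G} (he : Reach ι Λ S i e) : Reach ι Λ S i (-e) := by
  intro K hK
  obtain ⟨K', hK', H⟩ := he K hK
  refine ⟨K', hK', fun R z hR hz => ?_⟩
  obtain ⟨h, h1, h2⟩ := H R (-z) hR (by rwa [Int.cast_neg, abs_neg])
  refine ⟨h, h1, ?_⟩
  rwa [_root_.map_neg, smul_neg, ← neg_smul]

theorem add (hb : IsBCHRing G D s q K q') (hr : IsRealForm ι Λ c N B)
    (hS : Subgroup.closure S = ⊤) {e e' : G} (hm : ι e' ∈ Λ i) (he : Reach ι Λ S i e)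
    (he' : Reach ι Λ S i e') : Reach ι Λ S i (e + e') := by
  intro K hK
  obtain ⟨K₁, hK₁, H₁⟩ := he K hK
  obtain ⟨K₂, hK₂, H₂⟩ := he' K hK
  refine ⟨K₁ + K₂, by positivity, fun R z hR hz => ?_⟩
  obtain ⟨x, h1, h2⟩ := H₁ R z hR hz
  obtain ⟨y, h3, h4⟩ := H₂ R z hR hz
  refine ⟨x * y, ?_, ?_⟩
  · rw [add_mul]
    exact (wordNorm_mul_le_real hS x y).trans (add_le_add h1 h3)
  · rw [map_add, smul_add]
    exact map_mul_sub_add_mem hb hr (zsmul_mem hm z) h2 h4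

theorem of_zsmul (hb : IsBCHRing G D s q K q') (hr : IsRealForm ι Λ c N B)
    (hS : Subgroup.closure S = ⊤) {e : G} (hm : ι e ∈ Λ i) {m : ℤ} (h0 : m ≠ 0)
    (he : Reach ι Λ S i (m • e)) : Reach ι Λ S i e := by
  intro K hK
  obtain ⟨K', hK', H⟩ := he K hK
  refine ⟨K' + |(m : ℝ)| * wordNorm S e, by positivity, fun R z hR hz => ?_⟩
  obtain ⟨a, t, rfl, ha, ht⟩ := Int.exists_eq_mul_add_abs_le z h0
  have h1m : (1 : ℝ) ≤ |(m : ℝ)| := by exact_mod_cast Int.one_le_abs h0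
  obtain ⟨x, h1, h2⟩ := H R a hR
    ((le_mul_of_one_le_right (abs_nonneg _) h1m).trans (ha.trans hz))
  refine ⟨x * e ^ t, ?_, ?_⟩
  · refine (wordNorm_mul_le_real hS x _).trans ?_
    rw [add_mul]
    refine add_le_add h1 ((wordNorm_zpow_le_real hS e ht).trans ?_)
    exact le_mul_of_one_le_right (by positivity) hR
  · have := map_mul_sub_add_mem hb hr (y := e ^ t) (zsmul_mem hm t) h2
      (by rw [hb.zpow_eq, map_zsmul, sub_self]; exact zero_mem _)
    rwa [map_zsmul, smul_smul, ← add_smul] at this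

theorem lie (hb : IsBCHRing G D s q K q') (hr : IsRealForm ι Λ c N B)
    (hS : Subgroup.closure S = ⊤) (x : G) {e : G} (hm : ι e ∈ Λ i) (he : Reach ι Λ S i e) :
    Reach ι Λ S (i + 1) ⁅x, e⁆ := by
  have hcomm : ∀ (a b : ℤ) (y : G), ι y - b • ι e ∈ Λ (i + 1) →
      ι (x ^ a * y * (x ^ a)⁻¹ * y⁻¹) - (a * b) • ι ⁅x, e⁆ ∈ Λ (i + 2) := by
    intro a b y hy
    have h1 := hb.map_commutator_sub_mem hr (x := x ^ a) (hr.mem_of_sub_mem hm hy)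
    have h2 := hr.filtration.lie_mem_succ (ι (x ^ a)) hy
    have h3 := add_mem h1 h2
    rw [lie_sub, sub_add_sub_cancel, hb.zpow_eq x, map_zsmul, zsmul_lie, lie_zsmul, smul_smul,
      ← hr.map_lie] at h3
    rwa [hb.zpow_eq x]
  have hnorm : ∀ x y : G, (wordNorm S (x * y * x⁻¹ * y⁻¹) : ℝ) ≤
      2 * wordNorm S x + 2 * wordNorm S y := by
    intro x y
    have h1 := wordNorm_mul_le_real hS (x * y * x⁻¹) y⁻¹
    have h2 := wordNorm_mul_le_real hS (x * y) x⁻¹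
    have h3 := wordNorm_mul_le_real hS x y
    have h4 := wordNorm_inv_le_real hS x
    have h5 := wordNorm_inv_le_real hS y
    linarith
  intro K hK
  obtain ⟨K', hK', H⟩ := he K hK
  refine ⟨8 * wordNorm S x + 2 * K' + 2 * wordNorm S e, by positivity, fun R z hR hz => ?_⟩
  obtain ⟨P, hP1, hP2⟩ : ∃ P : ℤ, R ≤ P ∧ (P : ℝ) ≤ 2 * R :=
    ⟨⌈R⌉, Int.le_ceil R, by linarith [Int.ceil_lt_add_one R]⟩
  have hP0 : (0 : ℝ) < P := by linarith
  obtain ⟨a, t, rfl, ha, ht⟩ := Int.exists_eq_mul_add_abs_le z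
    (m := P) (by rintro rfl; exact hP0.ne Int.cast_zero.symm)
  rw [abs_of_pos hP0] at ha ht
  obtain ⟨y, h1, h2⟩ := H R a hR <| by
    refine le_of_mul_le_mul_right (ha.trans (hz.trans ?_)) hP0
    rw [pow_succ R (i + 1), ← mul_assoc]
    gcongr
  refine ⟨x ^ P * y * (x ^ P)⁻¹ * y⁻¹ * (x ^ t * e * (x ^ t)⁻¹ * e⁻¹), ?_, ?_⟩
  · have h3 := wordNorm_mul_le_real hS (x ^ P * y * (x ^ P)⁻¹ * y⁻¹)
      (x ^ t * e * (x ^ t)⁻¹ * e⁻¹)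
    have h4 := hnorm (x ^ P) y
    have h5 := hnorm (x ^ t) e
    have h6 := wordNorm_zpow_le_real hS x (k := P) (r := 2 * R) (by rwa [abs_of_pos hP0])
    have h7 := wordNorm_zpow_le_real hS x (k := t) (r := 2 * R) (ht.trans hP2)
    have h8 : (wordNorm S e : ℝ) ≤ wordNorm S e * R :=
      le_mul_of_one_le_right (Nat.cast_nonneg _) hR
    linarith
  · have hl : ι ⁅x, e⁆ ∈ Λ (i + 1) := by
      rw [hr.map_lie]
      exact hr.filtration.lie_mem_succ _ hm
    have h3 := hcomm t 1 e (by rw [one_smul, sub_self]; exact zero_mem _)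
    rw [mul_one] at h3
    have h4 := map_mul_sub_add_mem hb hr (zsmul_mem hl t) (hcomm P a y h2) h3
    rwa [← add_smul, mul_comm P] at h4

/-- Every lattice point of the `i`-th step of the filtration is reachable. -/
theorem of_mem (hb : IsBCHRing G D s q K q') (hr : IsRealForm ι Λ c N B)
    (hS : Subgroup.closure S = ⊤) {e : G} (he : ι e ∈ Λ i) : Reach ι Λ S i e := by
  induction i generalizing e with
  | zero => exact of_zero hb ι Λ hS e
  | succ i ih =>
    let R : AddSubgroup G :=
      { carrier := {e | ι e ∈ Λ (i + 1) ∧ Reach ι Λ S (i + 1) e}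
        add_mem' := fun {a b} ha hb' => ⟨by rw [map_add]; exact add_mem ha.1 hb'.1,
          ha.2.add hb hr hS hb'.1 hb'.2⟩
        zero_mem' := ⟨by rw [map_zero]; exact zero_mem _, zero hb ι Λ S (i + 1)⟩
        neg_mem' := fun {a} ha => ⟨by rw [_root_.map_neg]; exact neg_mem ha.1, ha.2.neg⟩ }
    obtain ⟨m, hm, hR⟩ := hr.exists_zsmul_mem R e <| by
      refine Submodule.span_mono ?_ (hr.le_span i he)
      rintro _ ⟨x, y, hy, rfl⟩
      refine ⟨⁅x, y⁆, ⟨?_, (ih hy).lie hb hr hS x hy⟩, rfl⟩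
      rw [hr.map_lie]
      exact hr.filtration.lie_mem_succ _ hy
    exact of_zsmul hb hr hS he hm hR.2

theorem exists_sum (hb : IsBCHRing G D s q K q') (hr : IsRealForm ι Λ c N B)
    (hS : Subgroup.closure S = ⊤) {J : Type*} (t : Finset J) {e : J → G}
    (he : ∀ j, ι (e j) ∈ Λ i) {K : ℝ} (hK : 0 ≤ K) :
    ∃ K' : ℝ, 0 ≤ K' ∧ ∀ (R : ℝ) (z : J → ℤ), 1 ≤ R → (∀ j, |(z j : ℝ)| ≤ K * R ^ (i + 1)) →
      ∃ h : G, (wordNorm S h : ℝ) ≤ K' * R ∧ ι h - ∑ j ∈ t, z j • ι (e j) ∈ Λ (i + 1) := by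
  classical
  induction t using Finset.induction_on with
  | empty =>
    refine ⟨0, le_rfl, fun R z hR hz => ⟨1, ?_, ?_⟩⟩
    · rw [wordNorm_one, Nat.cast_zero, zero_mul]
    · rw [hb.one_eq, map_zero, Finset.sum_empty, sub_zero]
      exact zero_mem _
  | insert j t hj ih =>
    obtain ⟨K₁, hK₁, H₁⟩ := of_mem hb hr hS (he j) K hK
    obtain ⟨K₂, hK₂, H₂⟩ := ih
    refine ⟨K₁ + K₂, by positivity, fun R z hR hz => ?_⟩
    obtain ⟨x, h1, h2⟩ := H₁ R (z j) hR (hz j)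
    obtain ⟨y, h3, h4⟩ := H₂ R z hR hz
    refine ⟨x * y, ?_, ?_⟩
    · rw [add_mul]
      exact (wordNorm_mul_le_real hS x y).trans (add_le_add h1 h3)
    · rw [Finset.sum_insert hj]
      exact map_mul_sub_add_mem hb hr (sum_mem fun k _ => zsmul_mem (he k) _) h2 h4

end Reach

end Reach

section WordNormCtrl

variable {G V : Type*} [Group G] [LieRing G] [LieRing V] [LieAlgebra ℝ V]
  {D : ℤ} {s : Finset (List Bool)} {q : List Bool → ℤ} {K : ℕ} {q' : ℕ → ℤ}
  {ι : G →+ V} {Λ : ℕ → Submodule ℝ V} {c : ℕ} {N : Seminorm ℝ V} {B : ℝ} {S : Set G}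

namespace IsBCHRing

theorem map_list_prod (h : IsBCHRing G D s q K q') (hr : IsRealForm ι Λ c N B) (l : List G) :
    ι l.prod = (l.map ι).foldr (wordMul s fun w => (q w : ℝ) / D) 0 := by
  induction l with
  | nil => rw [List.prod_nil, h.one_eq, map_zero, List.map_nil, List.foldr_nil]
  | cons x l ih => rw [List.prod_cons, h.map_mul hr, ih, List.map_cons, List.foldr_cons]

/-- Elements of word norm at most `r` have weighted size `O(r)`. -/
theorem exists_ctrl_of_wordNorm_le (h : IsBCHRing G D s q K q') (hr : IsRealForm ι Λ c N B)
    (hf : S.Finite) (hS : Subgroup.closure S = ⊤) :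
    ∃ K : ℝ, 0 ≤ K ∧ ∀ (r : ℝ) (v : G), (wordNorm S v : ℝ) ≤ r → Ctrl Λ c N (K * r) (ι v) := by
  obtain ⟨M₁, hM₁⟩ : ∃ M₁ : ℝ, ∀ x ∈ S, N (ι x) ≤ M₁ := by
    obtain ⟨M₁, hM₁⟩ := (hf.image fun x => N (ι x)).bddAbove
    exact ⟨M₁, fun x hx => hM₁ ⟨x, hx, rfl⟩⟩
  have hlet : ∀ x, x ∈ S ∨ x⁻¹ ∈ S → N (ι x) ≤ max M₁ 0 := by
    rintro x (hx | hx)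
    · exact (hM₁ x hx).trans (le_max_left _ _)
    · have := hM₁ _ hx
      rw [h.map_inv, map_neg_eq_map] at this
      exact this.trans (le_max_left _ _)
  obtain ⟨M, -, H⟩ := exists_growthLT_gradedProd N hr.nonneg hr.norm_lie_le s
    (fun w => (q w : ℝ) / D) (le_max_right M₁ 0) c
  refine ⟨max M 1, by positivity, fun r v hv => ?_⟩
  obtain ⟨l, hl, hlS, rfl⟩ := exists_list_length_eq_wordNorm hS v
  rw [h.map_list_prod hr, ← sum_gradedProd hr.filtration]
  refine (Ctrl.of_growthLT (r := (l.map ι).length) (Nat.cast_nonneg _)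
    (isGradedSeq_gradedProd hr.filtration _ _ _) (H _ ?_)).mono (by positivity) ?_
  · intro x hx
    obtain ⟨y, hy, rfl⟩ := List.mem_map.1 hx
    exact hlet y (hlS y hy)
  · rw [List.length_map, hl]
    gcongr

/-- Elements of weighted size at most `r` have word norm `O(r)`. -/
theorem exists_wordNorm_le_of_ctrl [Module.Finite ℤ G] (h : IsBCHRing G D s q K q')
    (hr : IsRealForm ι Λ c N B) (hf : S.Finite) (hS : Subgroup.closure S = ⊤) {K : ℝ}
    (hK : 0 ≤ K) :
    ∃ K' : ℝ, 0 ≤ K' ∧ ∀ (r : ℝ) (v : G), 1 ≤ r → Ctrl Λ c N (K * r) (ι v) →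
      (wordNorm S v : ℝ) ≤ K' * r := by
  obtain ⟨K₁, hK₁, H₁⟩ := h.exists_ctrl_of_wordNorm_le hr hf hS
  obtain ⟨K₂, hK₂, H₂⟩ := exists_ctrl_wordMul hr.filtration N hr.nonneg hr.norm_lie_le s
    (fun w => (q w : ℝ) / D)
  suffices ∀ i ≤ c, ∀ K : ℝ, 0 ≤ K → ∃ K' : ℝ, 0 ≤ K' ∧ ∀ (r : ℝ) (v : G), 1 ≤ r →
      ι v ∈ Λ i → Ctrl Λ c N (K * r) (ι v) → (wordNorm S v : ℝ) ≤ K' * r by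
    obtain ⟨K', hK', H⟩ := this 0 c.zero_le K hK
    exact ⟨K', hK', fun r v h1 => H r v h1 (by rw [hr.filtration.zero_eq]; trivial)⟩
  intro i hi
  induction hi using Nat.decreasingInduction with
  | self =>
    refine fun K hK => ⟨0, le_rfl, fun r v h1 hv _ => ?_⟩
    rw [hr.filtration.eq_bot, Submodule.mem_bot] at hv
    have : v = 1 := by
      rw [h.one_eq]
      exact (injective_iff_map_eq_zero ι).1 (hr.injective h.torsionFree) v hv
    rw [this, wordNorm_one, Nat.cast_zero, zero_mul]
  | of_succ i hi ih =>
    intro K hK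
    obtain ⟨m, e, K₃, hK₃, he, H₃⟩ := hr.exists_coordinates i
    have hK₄ : 0 ≤ ∑ j ∈ Finset.range (i + 1), K ^ (j + 1) := by positivity
    set K₄ := ∑ j ∈ Finset.range (i + 1), K ^ (j + 1) with hK₄_def
    obtain ⟨K₅, hK₅, H₅⟩ := Reach.exists_sum h hr hS Finset.univ he (mul_nonneg hK₃ hK₄)
    obtain ⟨K₆, hK₆, H₆⟩ := ih (K₂ * max (K₁ * K₅) K) (by positivity)
    refine ⟨K₅ + K₆, by positivity, fun r v h1 hv hc => ?_⟩
    have h0 : (0 : ℝ) ≤ r := zero_le_one.trans h1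
    obtain ⟨f, hf, hfN, hsum⟩ := id hc
    obtain ⟨z, hz, hzN⟩ := H₃ v hv
    have hu : ι v - ∑ j ∈ Finset.range (i + 1), f j ∈ Λ (i + 1) := by
      rw [← hsum, ← Finset.sum_range_add_sum_Ico f (Nat.succ_le_of_lt hi), Nat.succ_eq_add_one,
        add_sub_cancel_left]
      exact sum_mem fun j hj => hr.filtration.anti (Finset.mem_Ico.1 hj).1 (hf j)
    have huN : N (∑ j ∈ Finset.range (i + 1), f j) ≤ K₄ * r ^ (i + 1) := by
      refine (N.sum_le _ _).trans ?_
      rw [hK₄_def, Finset.sum_mul]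
      refine Finset.sum_le_sum fun j hj => (hfN j ?_).trans ?_
      · exact (Finset.mem_range.1 hj).trans_le (Nat.succ_le_of_lt hi)
      · rw [mul_pow]
        have := Nat.lt_succ_iff.1 (Finset.mem_range.1 hj)
        gcongr
    obtain ⟨x, hx1, hx2⟩ := H₅ r z h1 fun j => (hzN _ hu j).trans <| by
      rw [mul_assoc]
      gcongr
    have hxv : ι (x⁻¹ * v) ∈ Λ (i + 1) := by
      have := Reach.map_mul_sub_add_mem h hr hv
        (x := x⁻¹) (y := v) (a := -∑ j, z j • ι (e j)) (b := ι v) ?_ ?_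
      · have := add_mem this hz
        convert this using 1
        abel
      · rw [h.map_inv, ← neg_mem_iff]
        convert hx2 using 1
        abel
      · rw [sub_self]
        exact zero_mem _
    have h3 : Ctrl Λ c N (K₂ * max (K₁ * K₅) K * r) (ι (x⁻¹ * v)) := by
      rw [h.map_mul hr, mul_assoc]
      refine H₂ _ _ _ (by positivity) ?_ (hc.mono (by positivity) ?_)
      · refine (H₁ (K₅ * r) _ ((wordNorm_inv_le_real hS x).trans hx1)).mono (by positivity) ?_
        rw [← mul_assoc]
        gcongr
        exact le_max_left _ _
      · gcongr
        exact le_max_right _ _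
    have h4 := H₆ r _ h1 hxv h3
    have h5 := wordNorm_mul_le_real hS x (x⁻¹ * v)
    rw [mul_inv_cancel_left] at h5
    linarith

end IsBCHRing

end WordNormCtrl

section Seminorms

variable {V : Type*} [AddCommGroup V] [Module ℝ V]

theorem Seminorm.exists_le_norm_equivFun {J : Type*} [Fintype J] (b : Module.Basis J ℝ V)
    (p : Seminorm ℝ V) : ∃ K, 0 ≤ K ∧ ∀ x, p x ≤ K * ‖b.equivFun x‖ := by
  refine ⟨∑ j, p (b j), Finset.sum_nonneg fun j _ => apply_nonneg p _, fun x => ?_⟩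
  calc p x = p (∑ j, b.equivFun x j • b j) := by rw [b.sum_equivFun]
    _ ≤ ∑ j, p (b.equivFun x j • b j) := p.sum_le _ _
    _ ≤ ∑ j, p (b j) * ‖b.equivFun x‖ := Finset.sum_le_sum fun j _ => by
        rw [map_smul_eq_mul, mul_comm]
        exact mul_le_mul_of_nonneg_left (norm_le_pi_norm _ j) (apply_nonneg p _)
    _ = _ := (Finset.sum_mul _ _ _).symm

theorem Seminorm.exists_le_norm {W : Type*} [NormedAddCommGroup W] [NormedSpace ℝ W]
    [FiniteDimensional ℝ W] (p : Seminorm ℝ W) : ∃ K, 0 ≤ K ∧ ∀ x, p x ≤ K * ‖x‖ := by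
  let b := Module.finBasis ℝ W
  obtain ⟨K, hK, h⟩ := p.exists_le_norm_equivFun b
  let f := LinearMap.toContinuousLinearMap b.equivFun.toLinearMap
  refine ⟨K * ‖f‖, by positivity, fun x => (h x).trans ?_⟩
  rw [mul_assoc]
  exact mul_le_mul_of_nonneg_left (f.le_opNorm x) hK

theorem exists_seminorm_forall_le (V : Type*) [AddCommGroup V] [Module ℝ V]
    [FiniteDimensional ℝ V] :
    ∃ N : Seminorm ℝ V, ∀ p : Seminorm ℝ V, ∃ K, 0 ≤ K ∧ ∀ x, p x ≤ K * N x :=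
  ⟨(normSeminorm ℝ (Fin (Module.finrank ℝ V) → ℝ)).comp
    (Module.finBasis ℝ V).equivFun.toLinearMap,
    fun p => p.exists_le_norm_equivFun (Module.finBasis ℝ V)⟩

theorem exists_seminorm_bilin_le [FiniteDimensional ℝ V] {N : Seminorm ℝ V}
    (hN : ∀ p : Seminorm ℝ V, ∃ K, 0 ≤ K ∧ ∀ x, p x ≤ K * N x) (f : V →ₗ[ℝ] V →ₗ[ℝ] V) :
    ∃ B, 0 ≤ B ∧ ∀ x y, N (f x y) ≤ B * N x * N y := by
  let b := Module.finBasis ℝ V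
  choose K hK HK using fun j => hN ((normSeminorm ℝ ℝ).comp (b.coord j))
  choose M hM HM using fun j => hN (N.comp (f (b j)))
  refine ⟨∑ j, K j * M j, Finset.sum_nonneg fun j _ => mul_nonneg (hK j) (hM j), fun x y => ?_⟩
  calc N (f x y) = N (∑ j, b.coord j x • f (b j) y) := by
        conv_lhs => rw [← b.sum_repr x]
        simp only [map_sum, map_smul, LinearMap.sum_apply, LinearMap.smul_apply]
        rfl
    _ ≤ ∑ j, N (b.coord j x • f (b j) y) := N.sum_le _ _
    _ ≤ ∑ j, K j * M j * N x * N y := Finset.sum_le_sum fun j _ => by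
        rw [map_smul_eq_mul]
        calc _ ≤ (K j * N x) * (M j * N y) :=
              mul_le_mul (HK j x) (HM j y) (apply_nonneg N _)
                (mul_nonneg (hK j) (apply_nonneg N _))
          _ = _ := by ring
    _ = _ := by simp only [Finset.sum_mul]

theorem eq_zero_of_forall_seminorm_le [FiniteDimensional ℝ V] {N : Seminorm ℝ V}
    (hN : ∀ p : Seminorm ℝ V, ∃ K, 0 ≤ K ∧ ∀ x, p x ≤ K * N x) {v : V} (hv : N v = 0) :
    v = 0 := by
  refine (Module.finBasis ℝ V).forall_coord_eq_zero_iff.1 fun j => ?_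
  obtain ⟨K, -, H⟩ := hN ((normSeminorm ℝ ℝ).comp ((Module.finBasis ℝ V).coord j))
  have := H v
  rw [hv, mul_zero] at this
  exact norm_le_zero_iff.1 this

end Seminorms

section LowerCentralFiltration

variable (V : Type*) [LieRing V] [LieAlgebra ℝ V]

/-- The lower central series of a real Lie algebra, as a sequence of subspaces. -/
def lcsSubmodule (i : ℕ) : Submodule ℝ V :=
  (LieModule.lowerCentralSeries ℝ V V i).toSubmodule

variable {V}

theorem lcsSubmodule_succ (i : ℕ) :
    lcsSubmodule V (i + 1) =
      Submodule.span ℝ {u | ∃ x : V, ∃ y ∈ lcsSubmodule V i, ⁅x, y⁆ = u} := by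
  rw [lcsSubmodule, LieModule.lowerCentralSeries_succ,
    LieSubmodule.lieIdeal_oper_eq_linear_span']
  congr 1
  ext u
  exact ⟨fun ⟨x, _, y, hy, h⟩ => ⟨x, y, hy, h⟩, fun ⟨x, y, hy, h⟩ => ⟨x, trivial, y, hy, h⟩⟩

theorem lie_mem_lcsSubmodule_succ {i : ℕ} (x : V) {y : V} (hy : y ∈ lcsSubmodule V i) :
    ⁅x, y⁆ ∈ lcsSubmodule V (i + 1) := by
  rw [lcsSubmodule_succ]
  exact Submodule.subset_span ⟨x, y, hy, rfl⟩

theorem lie_mem_lcsSubmodule {i j : ℕ} {x y : V} (hx : x ∈ lcsSubmodule V i)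
    (hy : y ∈ lcsSubmodule V j) : ⁅x, y⁆ ∈ lcsSubmodule V (i + j + 1) := by
  induction i generalizing j x y with
  | zero =>
    rw [Nat.zero_add]
    exact lie_mem_lcsSubmodule_succ x hy
  | succ i ih =>
    rw [lcsSubmodule_succ] at hx
    induction hx using Submodule.span_induction with
    | mem u hu =>
      obtain ⟨a, b, hb, rfl⟩ := hu
      rw [lie_lie]
      refine sub_mem ?_ ?_
      · have := lie_mem_lcsSubmodule_succ a (ih hb hy)
        rwa [show i + 1 + j + 1 = i + j + 1 + 1 by omega]
      · have := ih hb (lie_mem_lcsSubmodule_succ a hy)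
        rwa [show i + 1 + j + 1 = i + (j + 1) + 1 by omega]
    | zero =>
      rw [zero_lie]
      exact zero_mem _
    | add u v _ _ hu hv =>
      rw [add_lie]
      exact add_mem hu hv
    | smul r u _ hu =>
      rw [smul_lie]
      exact Submodule.smul_mem _ _ hu

theorem isBracketFiltration_lcsSubmodule {c : ℕ} (h : lcsSubmodule V c = ⊥) :
    IsBracketFiltration (lcsSubmodule V) c where
  zero_eq := rfl
  anti := fun _ _ hij => LieModule.antitone_lowerCentralSeries ℝ V V hij
  eq_bot := h
  lie_mem := lie_mem_lcsSubmodule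

end LowerCentralFiltration

section Scalars

variable (G : Type*) [LieRing G]

/-- The canonical map `G → ℝ ⊗ G`. -/
def toReal : G →+ ℝ ⊗[ℤ] G := (TensorProduct.mk ℤ ℝ G 1).toAddMonoidHom

variable {G}

theorem toReal_apply (x : G) : toReal G x = 1 ⊗ₜ[ℤ] x := rfl

theorem toReal_lie (x y : G) : toReal G ⁅x, y⁆ = ⁅toReal G x, toReal G y⁆ := by
  rw [toReal_apply, toReal_apply, toReal_apply, LieAlgebra.ExtendScalars.bracket_tmul, mul_one]

theorem span_range_toReal : Submodule.span ℝ (Set.range (toReal G)) = ⊤ := by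
  refine Submodule.eq_top_iff'.2 fun v => ?_
  induction v using TensorProduct.induction_on with
  | zero => exact zero_mem _
  | tmul r x =>
    have : r ⊗ₜ[ℤ] x = r • toReal G x := by
      rw [toReal_apply, TensorProduct.smul_tmul', smul_eq_mul, mul_one]
    rw [this]
    exact Submodule.smul_mem _ _ (Submodule.subset_span ⟨x, rfl⟩)
  | add u v hu hv => exact add_mem hu hv

theorem lcsSubmodule_succ_le_of_le_span {i : ℕ}
    (h : lcsSubmodule (ℝ ⊗[ℤ] G) i ≤
      Submodule.span ℝ {u | ∃ y : G, toReal G y ∈ lcsSubmodule (ℝ ⊗[ℤ] G) i ∧ toReal G y = u}) :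
    lcsSubmodule (ℝ ⊗[ℤ] G) (i + 1) ≤
      Submodule.span ℝ {u | ∃ x y : G, toReal G y ∈ lcsSubmodule (ℝ ⊗[ℤ] G) i ∧
        toReal G ⁅x, y⁆ = u} := by
  rw [lcsSubmodule_succ, Submodule.span_le]
  rintro _ ⟨a, b, hb, rfl⟩
  have ha : a ∈ Submodule.span ℝ (Set.range (toReal G)) := by
    rw [span_range_toReal]
    trivial
  replace hb := h hb
  rw [SetLike.mem_coe]
  induction ha using Submodule.span_induction with
  | mem u hu =>
    obtain ⟨x, rfl⟩ := hu
    induction hb using Submodule.span_induction with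
    | mem u hu =>
      obtain ⟨y, hy, rfl⟩ := hu
      exact Submodule.subset_span ⟨x, y, hy, toReal_lie x y⟩
    | zero =>
      rw [lie_zero]
      exact zero_mem _
    | add u v _ _ hu hv =>
      rw [lie_add]
      exact add_mem hu hv
    | smul r u _ hu =>
      rw [lie_smul]
      exact Submodule.smul_mem _ _ hu
  | zero =>
    rw [zero_lie]
    exact zero_mem _
  | add u v _ _ hu hv =>
    rw [add_lie]
    exact add_mem hu hv
  | smul r u _ hu =>
    rw [smul_lie]
    exact Submodule.smul_mem _ _ hu

theorem lcsSubmodule_le_span (i : ℕ) :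
    lcsSubmodule (ℝ ⊗[ℤ] G) i ≤
      Submodule.span ℝ {u | ∃ y : G, toReal G y ∈ lcsSubmodule (ℝ ⊗[ℤ] G) i ∧ toReal G y = u} := by
  induction i with
  | zero =>
    refine le_top.trans (span_range_toReal.symm.le.trans (Submodule.span_mono ?_))
    rintro _ ⟨y, rfl⟩
    exact ⟨y, trivial, rfl⟩
  | succ i ih =>
    refine (lcsSubmodule_succ_le_of_le_span ih).trans (Submodule.span_mono ?_)
    rintro _ ⟨x, y, hy, rfl⟩
    refine ⟨⁅x, y⁆, ?_, rfl⟩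
    rw [toReal_lie]
    exact lie_mem_lcsSubmodule_succ _ hy

/-- Additive maps from a subgroup of `G` to `ℝ` extend to linear functionals on `ℝ ⊗ G`. -/
theorem exists_functional_toReal (H : AddSubgroup G) (ζ : H →+ ℝ) :
    ∃ φ : ℝ ⊗[ℤ] G →ₗ[ℝ] ℝ, ∀ x : H, φ (toReal G x) = ζ x := by
  obtain ⟨ψ, hψ⟩ := (Module.Baer.of_divisible ℝ).extension_property_addMonoidHom H.subtype
    H.subtype_injective ζ
  refine ⟨LinearMap.liftBaseChange ℝ ψ.toIntLinearMap, fun x => ?_⟩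
  rw [toReal_apply, LinearMap.liftBaseChange_tmul, one_smul]
  exact DFunLike.congr_fun hψ x

theorem exists_zsmul_mem_of_toReal_mem_span (R : AddSubgroup G) (e : G)
    (he : toReal G e ∈ Submodule.span ℝ (toReal G '' R)) : ∃ m : ℤ, m ≠ 0 ∧ m • e ∈ R := by
  by_contra! hR
  let f : ℤ →+ G ⧸ R := zmultiplesHom _ (e : G ⧸ R)
  have hf : Function.Injective f := by
    refine (injective_iff_map_eq_zero f).2 fun m hm => ?_
    by_contra h0
    exact hR m h0 ((QuotientAddGroup.eq_zero_iff _).1 hm)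
  obtain ⟨ψ, hψ⟩ := (Module.Baer.of_divisible ℝ).extension_property_addMonoidHom f hf
    (Int.castAddHom ℝ)
  let φ : ℝ ⊗[ℤ] G →ₗ[ℝ] ℝ :=
    LinearMap.liftBaseChange ℝ (ψ.comp (QuotientAddGroup.mk' R)).toIntLinearMap
  have hφ : ∀ x, φ (toReal G x) = ψ (x : G ⧸ R) := fun x => by
    rw [toReal_apply, LinearMap.liftBaseChange_tmul, one_smul]
    rfl
  have h0 : φ (toReal G e) = 0 := by
    have : Submodule.span ℝ (toReal G '' R) ≤ LinearMap.ker φ := by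
      rw [Submodule.span_le]
      rintro _ ⟨x, hx, rfl⟩
      rw [SetLike.mem_coe, LinearMap.mem_ker, hφ, (QuotientAddGroup.eq_zero_iff x).2 hx, map_zero]
    exact this he
  have h1 := DFunLike.congr_fun hψ 1
  rw [AddMonoidHom.comp_apply, zmultiplesHom_apply, one_smul, ← hφ, h0] at h1
  simp at h1

theorem exists_isRealForm_toReal [Module.Finite ℤ G] {c : ℕ}
    (h : lcsSubmodule (ℝ ⊗[ℤ] G) c = ⊥) {N : Seminorm ℝ (ℝ ⊗[ℤ] G)}
    (hN : ∀ p : Seminorm ℝ (ℝ ⊗[ℤ] G), ∃ K, 0 ≤ K ∧ ∀ x, p x ≤ K * N x) :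
    ∃ B, IsRealForm (toReal G) (lcsSubmodule (ℝ ⊗[ℤ] G)) c N B := by
  obtain ⟨B, hB, HB⟩ := exists_seminorm_bilin_le hN
    (LieModule.toEnd ℝ (ℝ ⊗[ℤ] G) (ℝ ⊗[ℤ] G) : ℝ ⊗[ℤ] G →ₗ[ℝ] Module.End ℝ (ℝ ⊗[ℤ] G))
  exact ⟨B, isBracketFiltration_lcsSubmodule h, toReal_lie,
    fun i => lcsSubmodule_succ_le_of_le_span (lcsSubmodule_le_span i),
    exists_zsmul_mem_of_toReal_mem_span, exists_functional_toReal,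
    fun φ => hN ((normSeminorm ℝ ℝ).comp φ), hB, HB⟩

end Scalars

section Splitting

variable {V : Type*} [LieRing V] [LieAlgebra ℝ V] {Λ : ℕ → Submodule ℝ V} {c : ℕ}
  {N : Seminorm ℝ V} {comp : Fin c → V → V} {p : Fin c → Seminorm ℝ V}

/-- Projections onto complements of the successive steps of a filtration, together with seminorms
equivalent to `N` on these complements. -/
structure IsSplitting (Λ : ℕ → Submodule ℝ V) (N : Seminorm ℝ V) (comp : Fin c → V → V)
    (p : Fin c → Seminorm ℝ V) : Prop where
  comp_mem : ∀ (i : Fin c) v, comp i v ∈ Λ i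
  sum_comp : ∀ v, ∑ i, comp i v = v
  norm_comp_le : ∀ i, ∃ K, 0 ≤ K ∧ ∀ v, N (comp i v) ≤ K * p i v
  le_norm : ∀ i, ∃ K, 0 ≤ K ∧ ∀ v, p i v ≤ K * N v
  eq_zero : ∀ (i : Fin c) (j : ℕ) v, (i : ℕ) < j → v ∈ Λ j → p i v = 0

/-- The homogeneous length attached to a splitting. -/
noncomputable def splitLength (p : Fin c → Seminorm ℝ V) (v : V) : ℝ :=
  ⨆ i : Fin c, p i v ^ (((i : ℕ) : ℝ) + 1)⁻¹

theorem splitLength_le_iff {r : ℝ} (hr : 0 ≤ r) {v : V} :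
    splitLength p v ≤ r ↔ ∀ i : Fin c, p i v ≤ r ^ ((i : ℕ) + 1) := by
  have h : ∀ i : Fin c, p i v ^ (((i : ℕ) : ℝ) + 1)⁻¹ ≤ r ↔ p i v ≤ r ^ ((i : ℕ) + 1) := by
    intro i
    rw [Real.rpow_inv_le_iff_of_pos (apply_nonneg _ _) hr (by positivity)]
    norm_cast
  simp only [← h]
  exact ⟨fun H i => (le_ciSup (Set.finite_range _).bddAbove i).trans H, fun H => Real.iSup_le H hr⟩

theorem splitLength_nonneg (v : V) : 0 ≤ splitLength p v :=
  Real.iSup_nonneg fun _ => Real.rpow_nonneg (apply_nonneg _ _) _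

namespace IsSplitting

theorem exists_ctrl_of_splitLength_le (h : IsSplitting Λ N comp p) :
    ∃ K : ℝ, 0 ≤ K ∧ ∀ (r : ℝ) (v : V), 0 ≤ r → splitLength p v ≤ r →
      Ctrl Λ c N (K * r) v := by
  choose K hK HK using h.norm_comp_le
  refine ⟨max (∑ i, K i) 1, by positivity, fun r v hr hv => ?_⟩
  let f : ℕ → V := fun i => if hi : i < c then comp ⟨i, hi⟩ v else 0
  have hsum : ∑ i ∈ Finset.range c, f i = v := by
    rw [Finset.sum_range, ← h.sum_comp v]
    exact Finset.sum_congr rfl fun i _ => dif_pos i.2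
  rw [← hsum]
  refine Ctrl.of_growthLT hr (fun i => ?_) fun i hi => ?_
  · by_cases hi : i < c
    · rw [show f i = _ from dif_pos hi]
      exact h.comp_mem ⟨i, hi⟩ v
    · rw [show f i = _ from dif_neg hi]
      exact zero_mem _
  · rw [show f i = _ from dif_pos hi]
    refine (HK _ v).trans (mul_le_mul ?_ ((splitLength_le_iff hr).1 hv ⟨i, hi⟩)
      (apply_nonneg _ _) (Finset.sum_nonneg fun j _ => hK j))
    exact Finset.single_le_sum (f := K) (fun j _ => hK j) (Finset.mem_univ _)

theorem exists_splitLength_le_of_ctrl (h : IsSplitting Λ N comp p) :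
    ∃ K : ℝ, 0 ≤ K ∧ ∀ (r : ℝ) (v : V), 1 ≤ r → Ctrl Λ c N r v → splitLength p v ≤ K * r := by
  choose K hK HK using h.le_norm
  have h0 : 0 ≤ ∑ i, K i := Finset.sum_nonneg fun j _ => hK j
  refine ⟨max (∑ i, K i * c) 1, by positivity, ?_⟩
  rintro r _ hr ⟨f, hf, hfN, rfl⟩
  have hr0 : (0 : ℝ) ≤ r := zero_le_one.trans hr
  rw [splitLength_le_iff (by positivity)]
  intro i
  calc p i (∑ j ∈ Finset.range c, f j) ≤ ∑ j ∈ Finset.range c, p i (f j) := (p i).sum_le _ _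
    _ ≤ ∑ j ∈ Finset.range c, K i * r ^ ((i : ℕ) + 1) := Finset.sum_le_sum fun j hj => by
        by_cases hij : (i : ℕ) < j
        · rw [h.eq_zero i j _ hij (hf j)]
          exact mul_nonneg (hK i) (by positivity)
        · refine (HK i _).trans (mul_le_mul_of_nonneg_left ?_ (hK i))
          refine (hfN j (Finset.mem_range.1 hj)).trans (pow_le_pow_right₀ hr ?_)
          omega
    _ = K i * c * r ^ ((i : ℕ) + 1) := by
        rw [Finset.sum_const, Finset.card_range, nsmul_eq_mul]
        ring
    _ ≤ (max (∑ i, K i * c) 1) ^ ((i : ℕ) + 1) * r ^ ((i : ℕ) + 1) := by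
        refine mul_le_mul_of_nonneg_right ?_ (by positivity)
        calc K i * c ≤ ∑ i, K i * c :=
              Finset.single_le_sum (f := fun i => K i * (c : ℝ))
                (fun j _ => mul_nonneg (hK j) (Nat.cast_nonneg _)) (Finset.mem_univ i)
          _ ≤ max (∑ i, K i * c) 1 := le_max_left _ _
          _ ≤ _ := le_self_pow₀ (le_max_right _ _) (Nat.succ_ne_zero _)
    _ = _ := (mul_pow _ _ _).symm

theorem splitLength_pos_iff (h : IsSplitting Λ N comp p) (hN : ∀ v, N v = 0 → v = 0) {v : V} :
    0 < splitLength p v ↔ v ≠ 0 := by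
  rw [(splitLength_nonneg v).lt_iff_ne', not_iff_not]
  constructor
  · intro hv
    rw [← h.sum_comp v]
    refine Finset.sum_eq_zero fun i _ => hN _ ?_
    obtain ⟨K, hK, H⟩ := h.norm_comp_le i
    have := (splitLength_le_iff le_rfl).1 hv.le i
    rw [zero_pow (Nat.succ_ne_zero _)] at this
    exact le_antisymm ((H v).trans (mul_nonpos_of_nonneg_of_nonpos hK this)) (apply_nonneg _ _)
  · rintro rfl
    refine le_antisymm ((splitLength_le_iff le_rfl).2 fun i => ?_) (splitLength_nonneg _)
    rw [map_zero, zero_pow (Nat.succ_ne_zero _)]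

end IsSplitting

end Splitting

section Guivarch

/-- Components with respect to an independent family of subspaces are unique. -/
theorem iSupIndep.comp_eq {V : Type*} [AddCommGroup V] [Module ℝ V] {c : ℕ}
    {a : Fin c → Submodule ℝ V} (ha : iSupIndep a) {comp : Fin c → V → V}
    (hmem : ∀ i v, comp i v ∈ a i) (hsum : ∀ v, ∑ i, comp i v = v) {w : Fin c → V}
    (hw : ∀ i, w i ∈ a i) (i : Fin c) : comp i (∑ j, w j) = w i :=
  (iSupIndep_iff_finsetSum_eq_imp_eq a).1 ha Finset.univ (fun j => comp j (∑ j, w j)) w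
    (fun j _ => ⟨hmem j _, hw j⟩) (hsum _) i (Finset.mem_univ i)

variable {G : Type*} [LieRing G] [Module.Finite ℤ G] {c : ℕ} {ℓ : G → ℝ}

theorem IsGuivarchLength.exists_isSplitting (h : IsGuivarchLength c ℓ)
    {N : Seminorm ℝ (ℝ ⊗[ℤ] G)}
    (hN : ∀ p : Seminorm ℝ (ℝ ⊗[ℤ] G), ∃ K, 0 ≤ K ∧ ∀ x, p x ≤ K * N x) :
    lcsSubmodule (ℝ ⊗[ℤ] G) c = ⊥ ∧
      ∃ (comp : Fin c → ℝ ⊗[ℤ] G → ℝ ⊗[ℤ] G) (p : Fin c → Seminorm ℝ (ℝ ⊗[ℤ] G)),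
        IsSplitting (lcsSubmodule (ℝ ⊗[ℤ] G)) N comp p ∧
          ∀ v, ℓ v = splitLength p (toReal G v) := by
  obtain ⟨a, n, comp, hbot, hΛ, hind, hn0, hn1, hn2, hn3, hmem, hsum, hℓ⟩ := h
  have hbot' : lcsSubmodule (ℝ ⊗[ℤ] G) c = ⊥ := by
    rw [lcsSubmodule, hbot]
    rfl
  have hadd : ∀ i x y, comp i (x + y) = comp i x + comp i y := fun i x y => by
    have := hind.comp_eq hmem hsum (w := fun j => comp j x + comp j y)
      (fun j => add_mem (hmem j x) (hmem j y)) i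
    rwa [Finset.sum_add_distrib, hsum, hsum] at this
  have hsmul : ∀ i (r : ℝ) x, comp i (r • x) = r • comp i x := fun i r x => by
    have := hind.comp_eq hmem hsum (w := fun j => r • comp j x)
      (fun j => Submodule.smul_mem _ _ (hmem j x)) i
    rwa [← Finset.smul_sum, hsum] at this
  let p : Fin c → Seminorm ℝ (ℝ ⊗[ℤ] G) := fun i =>
    Seminorm.of (fun v => n i (comp i v))
      (fun x y => by
        rw [hadd]
        exact hn3 i _ (hmem i x) _ (hmem i y))
      (fun r x => by
        rw [hsmul]
        exact hn2 i r _ (hmem i x))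
  have hcomp0 : ∀ i j, i ≠ j → ∀ x ∈ a j, comp i x = 0 := fun i j hij x hx => by
    have := hind.comp_eq hmem hsum (w := Pi.single j x) (fun k => by
      by_cases hk : k = j
      · subst hk
        rwa [Pi.single_eq_same]
      · rw [Pi.single_eq_of_ne hk]
        exact zero_mem _) i
    rwa [Finset.sum_pi_single', if_pos (Finset.mem_univ _), Pi.single_eq_of_ne hij] at this
  refine ⟨hbot', comp, p, ⟨?_, hsum, ?_, fun i => hN (p i), ?_⟩, hℓ⟩
  · intro i v
    rw [lcsSubmodule, hΛ i]
    exact Submodule.mem_iSup_of_mem i (Submodule.mem_iSup_of_mem le_rfl (hmem i v))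
  · intro i
    let _ : Norm (a i) := ⟨fun x => n i x⟩
    have core : NormedSpace.Core ℝ (a i) :=
      ⟨⟨fun x => hn0 i x x.2, fun r x => hn2 i r x x.2, fun x y => hn3 i x x.2 y y.2⟩,
        fun x => (hn1 i x x.2).trans Submodule.coe_eq_zero⟩
    let _ : NormedAddCommGroup (a i) := .ofCore core
    let _ : NormedSpace ℝ (a i) := .ofCore core
    obtain ⟨K, hK, H⟩ := (N.comp (a i).subtype).exists_le_norm
    exact ⟨K, hK, fun v => H ⟨comp i v, hmem i v⟩⟩
  · intro i j v hij hv
    suffices comp i v = 0 by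
      show n i (comp i v) = 0
      rw [this]
      exact (hn1 i 0 (zero_mem _)).2 rfl
    let φ : ℝ ⊗[ℤ] G →ₗ[ℝ] ℝ ⊗[ℤ] G :=
      { toFun := comp i, map_add' := hadd i, map_smul' := hsmul i }
    suffices lcsSubmodule (ℝ ⊗[ℤ] G) j ≤ LinearMap.ker φ from this hv
    by_cases hj : j < c
    · rw [show lcsSubmodule (ℝ ⊗[ℤ] G) j = _ from hΛ ⟨j, hj⟩]
      refine iSup₂_le fun k hk x hx => hcomp0 i k ?_ x hx
      rintro rfl
      exact absurd hij (not_lt.2 hk)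
    · rw [(isBracketFiltration_lcsSubmodule hbot').anti (not_lt.1 hj)
          |>.trans_eq hbot' |> le_bot_iff.1]
      exact bot_le

end Guivarch

theorem fDom_sSup {X : Type*} {A B : X → ℝ} {f g : X → ℕ} {C : ℕ} {K : ℝ}
    (hpos : ∀ x, 0 < A x → 0 < B x) (hAB : ∀ r x, 1 ≤ r → A x ≤ r → B x ≤ K * r)
    (hfg : ∀ x, f x ≤ C * g x) (hfin : ∀ r, {x | B x ≤ r}.Finite) :
    FDom (fun r => (sSup {d | ∃ x, 0 < A x ∧ A x ≤ r ∧ f x = d} : ℕ))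
      (fun r => (sSup {d | ∃ x, 0 < B x ∧ B x ≤ r ∧ g x = d} : ℕ)) := by
  refine ⟨max (max (C : ℝ) K) 1, by positivity, fun r hr => ?_⟩
  have h1 : 1 ≤ r := (le_max_left _ _).trans hr
  set M := max (max (C : ℝ) K) 1
  have hbdd : BddAbove {d | ∃ x, 0 < B x ∧ B x ≤ M * r ∧ g x = d} := by
    refine ((hfin (M * r)).image g).bddAbove.mono ?_
    rintro _ ⟨x, -, hx, rfl⟩
    exact ⟨x, hx, rfl⟩
  have h2 : sSup {d | ∃ x, 0 < A x ∧ A x ≤ r ∧ f x = d} ≤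
      C * sSup {d | ∃ x, 0 < B x ∧ B x ≤ M * r ∧ g x = d} := by
    refine csSup_le' ?_
    rintro _ ⟨x, hx, hxr, rfl⟩
    refine (hfg x).trans (Nat.mul_le_mul_left C (le_csSup hbdd ⟨x, hpos x hx, ?_, rfl⟩))
    refine (hAB r x h1 hxr).trans (mul_le_mul_of_nonneg_right ?_ (zero_le_one.trans h1))
    exact (le_max_right _ _).trans (le_max_left _ _)
  calc _ ≤ ((C * sSup {d | ∃ x, 0 < B x ∧ B x ≤ M * r ∧ g x = d} : ℕ) : ℝ) := Nat.cast_le.2 h2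
    _ ≤ _ := by
      rw [Nat.cast_mul]
      refine mul_le_mul_of_nonneg_right ?_ (Nat.cast_nonneg _)
      exact (le_max_left _ _).trans (le_max_left _ _)

theorem groupRF_eq_sSup (G : Type*) [Group G] (S : Set G) (r : ℝ) :
    groupRF G S r = sSup {d | ∃ g : G, 0 < (wordNorm S g : ℝ) ∧ (wordNorm S g : ℝ) ≤ r ∧
      groupDivP {N : Subgroup G | N.Normal} g = d} := by
  simp only [groupRF, groupRFP, Nat.cast_pos]

/-- For an LR-group `G ≤ (𝔲⁰(n,ℚ), ∗)` with underlying Lie ring `L` (the same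
type `G` with its Lie ring structure), the residual finiteness growth of the group w.r.t. any
finite generating set is equivalent to that of the Lie ring w.r.t. any Guivarc'h length. -/
theorem rf_LRgroup_eq_rf_lieRing
    {n : ℕ} {G : Type*} [Group G] [LieRing G]
    (ρ : G → Matrix (Fin n) (Fin n) ℚ) (hLR : IsLRGroup n G ρ)
    (S : Set G) (hSfin : S.Finite) (hSgen : Subgroup.closure S = ⊤)
    (c : ℕ) (ℓ : G → ℝ) (hℓ : IsGuivarchLength c ℓ) :
    FEquiv (fun r => (groupRF G S r : ℝ)) (fun r => (lieRF G ℓ r : ℝ)) := by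
  obtain ⟨D, s, q, K, q', hb⟩ := hLR.exists_isBCHRing
  have := hb.finite
  obtain ⟨N, hN⟩ := exists_seminorm_forall_le (ℝ ⊗[ℤ] G)
  obtain ⟨hbot, comp, p, hsplit, hℓp⟩ := hℓ.exists_isSplitting hN
  obtain ⟨B, hr⟩ := exists_isRealForm_toReal hbot hN
  have hnil : ∀ (gs : List G) (x : G), c ≤ gs.length → lieFold gs x = 0 := by
    intro gs x hgs
    have h : toReal G (lieFold gs x) ∈ lcsSubmodule (ℝ ⊗[ℤ] G) gs.length := by
      clear hgs
      induction gs with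
      | nil => trivial
      | cons g gs ih =>
        rw [lieFold_cons, toReal_lie]
        exact lie_mem_lcsSubmodule_succ _ ih
    have h0 := hr.filtration.anti hgs h
    rw [hbot, Submodule.mem_bot] at h0
    exact (injective_iff_map_eq_zero _).1 (hr.injective hb.torsionFree) _ h0
  obtain ⟨C, hC⟩ := hb.exists_divP_le hnil
  obtain ⟨K₁, hK₁, H₁⟩ := hb.exists_ctrl_of_wordNorm_le hr hSfin hSgen
  obtain ⟨K₂, hK₂, H₂⟩ := hsplit.exists_splitLength_le_of_ctrl
  obtain ⟨K₃, hK₃, H₃⟩ := hsplit.exists_ctrl_of_splitLength_le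
  obtain ⟨K₄, hK₄, H₄⟩ := hb.exists_wordNorm_le_of_ctrl hr hSfin hSgen hK₃
  have hwℓ : ∀ r v, 1 ≤ r → (wordNorm S v : ℝ) ≤ r → ℓ v ≤ K₂ * max K₁ 1 * r := by
    intro r v h1 hv
    rw [hℓp, mul_assoc]
    refine H₂ _ _ ?_ ((H₁ r v hv).mono (by positivity) ?_)
    · exact h1.trans (le_mul_of_one_le_left (by positivity) (le_max_right _ _))
    · gcongr
      exact le_max_left _ _
  have hℓw : ∀ r v, 1 ≤ r → ℓ v ≤ r → (wordNorm S v : ℝ) ≤ K₄ * r := by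
    intro r v h1 hv
    rw [hℓp] at hv
    exact H₄ r v h1 (H₃ r _ (by positivity) hv)
  have hpos : ∀ v, 0 < (wordNorm S v : ℝ) ↔ 0 < ℓ v := by
    intro v
    rw [Nat.cast_pos, Nat.pos_iff_ne_zero, Ne, wordNorm_eq_zero_iff hSgen, hb.one_eq, hℓp,
      hsplit.splitLength_pos_iff fun v => eq_zero_of_forall_seminorm_le hN, Ne,
      map_eq_zero_iff _ (hr.injective hb.torsionFree)]
  have hfin : ∀ r : ℝ, {v : G | (wordNorm S v : ℝ) ≤ r}.Finite := fun r =>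
    (finite_wordNorm_le hSgen hSfin ⌊r⌋₊).subset fun v hv => Nat.le_floor hv
  have hfin' : ∀ r : ℝ, {v : G | ℓ v ≤ r}.Finite := fun r =>
    (hfin (K₄ * max r 1)).subset fun v hv => hℓw _ v (le_max_right _ _) (hv.trans (le_max_left _ _))
  simp only [groupRF_eq_sSup]
  exact ⟨fDom_sSup (fun v => (hpos v).1) hwℓ (fun v => (hC v).1) hfin',
    fDom_sSup (fun v => (hpos v).2) hℓw (fun v => (hC v).2) hfin⟩
end
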